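/- arXiv:2311.05762 — 2 statements merged into one kernel-verified Lean document; each statement's English description precedes it below -/
import Mathlib

section
/- There exist absolute constants C_1, C_2 > 0 with the following property: for every positive integer D and every finite set A ⊆ Z^D with |A + A| ≤ K|A| for some real K ≥ 1, there is a subset A' ⊆ A with |A'| ≥ K^{−C_1/2}|A| such that the dimension of the affine span of A' (over the rationals) is at most C_2 · log K. -/
open scoped Pointwise

namespace WPFR
open Finset Real

structure IsP {Ω : Type} [Fintype Ω] (μ : Ω → ℝ) : Prop where
  nn : ∀ ω, 0 ≤ μ ω
  one : ∑ ω, μ ω = 1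

section basic
variable {Ω Ω' T : Type} [Fintype Ω] [Fintype Ω'] [Fintype T]
variable {S S' S'' S''' : Type}

open Classical in
noncomputable def pr (μ : Ω → ℝ) (X : Ω → S) (s : S) : ℝ := ∑ ω, if X ω = s then μ ω else 0

noncomputable def ent (μ : Ω → ℝ) (X : Ω → S) : ℝ := -∑ ω, μ ω * log (pr μ X (X ω))

def prd (μ : Ω → ℝ) (ν : Ω' → ℝ) : Ω × Ω' → ℝ := fun w => μ w.1 * ν w.2

def MP (μ : Ω → ℝ) (ν : T → ℝ) (f : Ω → T) : Prop :=
  ∀ F : T → ℝ, ∑ ω, μ ω * F (f ω) = ∑ t, ν t * F t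

theorem IsP.prd {μ : Ω → ℝ} {ν : Ω' → ℝ} (hμ : IsP μ) (hν : IsP ν) : IsP (prd μ ν) := by
  refine ⟨fun w => mul_nonneg (hμ.nn _) (hν.nn _), ?_⟩
  simp only [WPFR.prd, Fintype.sum_prod_type, ← Finset.mul_sum, hν.one, hμ.one, mul_one]

theorem pr_nonneg {μ : Ω → ℝ} (hμ : IsP μ) (X : Ω → S) (s : S) : 0 ≤ pr μ X s := by
  unfold pr
  refine Finset.sum_nonneg fun ω _ => ?_
  split_ifs
  · exact hμ.nn ω
  · exact le_rfl

theorem le_pr {μ : Ω → ℝ} (hμ : IsP μ) (X : Ω → S) (ω : Ω) : μ ω ≤ pr μ X (X ω) := by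
  classical
  unfold pr
  have := Finset.single_le_sum (f := fun ω' => if X ω' = X ω then μ ω' else 0)
    (fun ω' _ => by split_ifs; exacts [hμ.nn ω', le_rfl]) (Finset.mem_univ ω)
  simpa using this

theorem pr_pos {μ : Ω → ℝ} (hμ : IsP μ) (X : Ω → S) {ω : Ω} (h : μ ω ≠ 0) :
    0 < pr μ X (X ω) :=
  lt_of_lt_of_le (lt_of_le_of_ne (hμ.nn ω) (Ne.symm h)) (le_pr hμ X ω)

theorem pr_le_one {μ : Ω → ℝ} (hμ : IsP μ) (X : Ω → S) (s : S) : pr μ X s ≤ 1 := by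
  rw [← hμ.one]
  unfold pr
  refine Finset.sum_le_sum fun ω _ => ?_
  split_ifs
  · exact le_rfl
  · exact hμ.nn ω

/-- entropy only depends on the kernel relation on the support -/
theorem ent_congr {μ : Ω → ℝ} {X : Ω → S} {Y : Ω → S'}
    (h : ∀ ω ω', μ ω ≠ 0 → μ ω' ≠ 0 → (X ω = X ω' ↔ Y ω = Y ω')) : ent μ X = ent μ Y := by
  classical
  unfold ent
  congr 1
  refine Finset.sum_congr rfl fun ω _ => ?_
  by_cases h0 : μ ω = 0
  · simp [h0]
  congr 2
  unfold pr
  refine Finset.sum_congr rfl fun ω' _ => ?_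
  by_cases h1 : μ ω' = 0
  · simp [h1]
  simp only [h ω' ω h1 h0]

theorem ent_mp {μ : Ω → ℝ} {ν : T → ℝ} {f : Ω → T} (hf : MP μ ν f) (g : T → S) :
    ent μ (fun ω => g (f ω)) = ent ν g := by
  classical
  unfold ent
  congr 1
  have h1 : ∀ s, pr μ (fun ω => g (f ω)) s = pr ν g s := by
    intro s
    have := hf (fun t => if g t = s then 1 else 0)
    simpa [pr] using this
  simp only [h1]
  exact hf (fun t => log (pr ν g (g t)))

theorem ent_const {μ : Ω → ℝ} (hμ : IsP μ) {X : Ω → S}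
    (h : ∀ ω ω', μ ω ≠ 0 → μ ω' ≠ 0 → X ω = X ω') : ent μ X = 0 := by
  rw [ent_congr (Y := fun _ => ()) (fun ω ω' a b => by simp [h ω ω' a b])]
  simp [ent, pr, hμ.one]

theorem ent_nonneg {μ : Ω → ℝ} (hμ : IsP μ) (X : Ω → S) : 0 ≤ ent μ X := by
  unfold ent
  rw [neg_nonneg]
  refine Finset.sum_nonpos fun ω _ => mul_nonpos_of_nonneg_of_nonpos (hμ.nn ω) ?_
  exact Real.log_nonpos (pr_nonneg hμ _ _) (pr_le_one hμ _ _)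

theorem submod {μ : Ω → ℝ} (hμ : IsP μ) (P : Ω → S) (Q : Ω → S') (R : Ω → S'') (J : Ω → S''')
    (hPR : ∀ ω ω', μ ω ≠ 0 → μ ω' ≠ 0 → P ω = P ω' → R ω = R ω')
    (hQR : ∀ ω ω', μ ω ≠ 0 → μ ω' ≠ 0 → Q ω = Q ω' → R ω = R ω')
    (hJ : ∀ ω ω', μ ω ≠ 0 → μ ω' ≠ 0 → P ω = P ω' → Q ω = Q ω' → J ω = J ω') :
    ent μ J + ent μ R ≤ ent μ P + ent μ Q := by
  classical
  set p : Ω → ℝ := fun ω => pr μ P (P ω) with hp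
  set q : Ω → ℝ := fun ω => pr μ Q (Q ω) with hq
  set r : Ω → ℝ := fun ω => pr μ R (R ω) with hr
  set j : Ω → ℝ := fun ω => pr μ J (J ω) with hj
  have key : ∑ ω, μ ω * (p ω * q ω / (j ω * r ω)) ≤ 1 := by
    have e1 : ∀ ω, μ ω * (p ω * q ω / (j ω * r ω)) = ∑ a, ∑ b,
        (μ a * μ b) * (if P a = P ω ∧ Q b = Q ω then μ ω / (j ω * r ω) else 0) := by
      intro ω
      have : p ω * q ω = ∑ a, ∑ b, (μ a * μ b) * (if P a = P ω ∧ Q b = Q ω then 1 else 0) := by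
        simp only [hp, hq, pr, Finset.sum_mul_sum]
        refine Finset.sum_congr rfl fun a _ => Finset.sum_congr rfl fun b _ => ?_
        by_cases h1 : P a = P ω <;> by_cases h2 : Q b = Q ω <;> simp [h1, h2]
      rw [div_eq_mul_inv, this, ← mul_assoc, mul_comm (μ ω), mul_assoc, Finset.sum_mul]
      refine Finset.sum_congr rfl fun a _ => ?_
      rw [Finset.sum_mul]
      refine Finset.sum_congr rfl fun b _ => ?_
      split_ifs <;> simp [div_eq_mul_inv]
    have e2 : ∀ a b, μ a ≠ 0 → μ b ≠ 0 →
        ∑ ω, (if P a = P ω ∧ Q b = Q ω then μ ω / (j ω * r ω) else 0)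
          ≤ if R b = R a then 1 / r a else 0 := by
      intro a b ha hb
      have hra : 0 < r a := pr_pos hμ R ha
      by_cases hex : ∃ ω, μ ω ≠ 0 ∧ P a = P ω ∧ Q b = Q ω
      · obtain ⟨c, hc, hPc, hQc⟩ := hex
        have hRa : R a = R c := hPR _ _ ha hc hPc
        have hRb : R b = R c := hQR _ _ hb hc hQc
        rw [if_pos (hRb.trans hRa.symm)]
        have hjc : 0 < j c := pr_pos hμ J hc
        calc ∑ ω, (if P a = P ω ∧ Q b = Q ω then μ ω / (j ω * r ω) else 0)
            ≤ ∑ ω, (if J ω = J c then μ ω else 0) * (1 / (j c * r a)) := by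
              refine Finset.sum_le_sum fun ω _ => ?_
              by_cases h0 : μ ω = 0
              · simp [h0]
              split_ifs with h1 h2 h2
              · have : j ω = j c := by simp only [hj, h2]
                have h3 : r ω = r a := by simp only [hr, hPR _ _ ha h0 h1.1]
                rw [this, h3, div_eq_mul_one_div]
              · exact absurd (hJ _ _ h0 hc (h1.1.symm.trans hPc) (h1.2.symm.trans hQc)) h2
              · have := hμ.nn ω; positivity
              · simp
          _ = j c * (1 / (j c * r a)) := by rw [← Finset.sum_mul]; rfl
          _ = 1 / r a := by field_simp
      · have : ∑ ω, (if P a = P ω ∧ Q b = Q ω then μ ω / (j ω * r ω) else 0) = 0 := by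
          refine Finset.sum_eq_zero fun ω _ => ?_
          split_ifs with h1
          · by_cases h0 : μ ω = 0
            · simp [h0]
            · exact absurd ⟨ω, h0, h1⟩ hex
          · rfl
        rw [this]
        split_ifs <;> positivity
    simp only [e1]
    rw [Finset.sum_comm]
    calc _ = ∑ a, ∑ b, (μ a * μ b) *
          ∑ ω, (if P a = P ω ∧ Q b = Q ω then μ ω / (j ω * r ω) else 0) := by
          refine Finset.sum_congr rfl fun a _ => ?_
          rw [Finset.sum_comm]
          simp only [Finset.mul_sum]
      _ ≤ ∑ a, ∑ b, (μ a * μ b) * (if R b = R a then 1 / r a else 0) := by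
          refine Finset.sum_le_sum fun a _ => Finset.sum_le_sum fun b _ => ?_
          by_cases ha : μ a = 0
          · simp [ha]
          by_cases hb : μ b = 0
          · simp [hb]
          exact mul_le_mul_of_nonneg_left (e2 a b ha hb) (mul_nonneg (hμ.nn _) (hμ.nn _))
      _ = ∑ a, μ a * (r a * (1 / r a)) := by
          refine Finset.sum_congr rfl fun a _ => ?_
          simp only [hr, pr, Finset.sum_mul, Finset.mul_sum]
          refine Finset.sum_congr rfl fun b _ => ?_
          split_ifs <;> simp [mul_assoc]
      _ ≤ ∑ a, μ a := by
          refine Finset.sum_le_sum fun a _ => ?_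
          by_cases ha : μ a = 0
          · simp [ha]
          have : r a ≠ 0 := (pr_pos hμ R ha).ne'
          rw [mul_one_div_cancel this, mul_one]
      _ = 1 := hμ.one
  have key2 : ∑ ω, μ ω * (1 - p ω * q ω / (j ω * r ω)) ≤
      ∑ ω, μ ω * (log (j ω) + log (r ω) - log (p ω) - log (q ω)) := by
    refine Finset.sum_le_sum fun ω _ => ?_
    by_cases h0 : μ ω = 0
    · simp [h0]
    refine mul_le_mul_of_nonneg_left ?_ (hμ.nn ω)
    have a1 : 0 < p ω := pr_pos hμ P h0
    have a2 : 0 < q ω := pr_pos hμ Q h0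
    have a3 : 0 < j ω := pr_pos hμ J h0
    have a4 : 0 < r ω := pr_pos hμ R h0
    have := Real.log_le_sub_one_of_pos (x := p ω * q ω / (j ω * r ω)) (by positivity)
    rw [Real.log_div (by positivity) (by positivity), Real.log_mul a1.ne' a2.ne',
      Real.log_mul a3.ne' a4.ne'] at this
    linarith
  simp only [mul_sub, mul_add, Finset.sum_sub_distrib, Finset.sum_add_distrib, mul_one, hμ.one]
    at key2
  unfold ent
  linarith

theorem ent_le_of {μ : Ω → ℝ} (hμ : IsP μ) {X : Ω → S} {Y : Ω → S'}
    (h : ∀ ω ω', μ ω ≠ 0 → μ ω' ≠ 0 → Y ω = Y ω' → X ω = X ω') : ent μ X ≤ ent μ Y := by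
  have := submod hμ Y (fun _ => ()) (fun _ => ()) X (by simp) (by simp)
    (fun ω ω' a b c _ => h ω ω' a b c)
  rw [ent_const hμ (X := fun _ => ()) (by simp)] at this
  linarith

theorem subadd {μ : Ω → ℝ} (hμ : IsP μ) (X : Ω → S) (Y : Ω → S') :
    ent μ (fun ω => (X ω, Y ω)) ≤ ent μ X + ent μ Y := by
  have := submod hμ X Y (fun _ => ()) (fun ω => (X ω, Y ω)) (by simp) (by simp)
    (fun ω ω' a b c d => by simp [c, d])
  rw [ent_const hμ (X := fun _ => ()) (by simp)] at this
  linarith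

theorem pr_prd (μ : Ω → ℝ) (ν : Ω' → ℝ) (X : Ω → S) (Y : Ω' → S') (s : S) (t : S') :
    pr (prd μ ν) (fun w => (X w.1, Y w.2)) (s, t) = pr μ X s * pr ν Y t := by
  classical
  simp only [pr, prd, Fintype.sum_prod_type, Finset.sum_mul_sum]
  refine Finset.sum_congr rfl fun a _ => Finset.sum_congr rfl fun b _ => ?_
  by_cases h1 : X a = s <;> by_cases h2 : Y b = t <;> simp [h1, h2]

theorem ent_prd {μ : Ω → ℝ} {ν : Ω' → ℝ} (hμ : IsP μ) (hν : IsP ν) (X : Ω → S) (Y : Ω' → S') :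
    ent (prd μ ν) (fun w => (X w.1, Y w.2)) = ent μ X + ent ν Y := by
  simp only [ent, pr_prd, Fintype.sum_prod_type]
  have : ∀ a b, prd μ ν (a, b) * log (pr μ X (X a) * pr ν Y (Y b)) =
      (μ a * log (pr μ X (X a))) * ν b + μ a * (ν b * log (pr ν Y (Y b))) := by
    intro a b
    simp only [prd]
    by_cases ha : μ a = 0
    · simp [ha]
    by_cases hb : ν b = 0
    · simp [hb]
    rw [Real.log_mul (pr_pos hμ X ha).ne' (pr_pos hν Y hb).ne']
    ring
  simp only [this, Finset.sum_add_distrib, ← Finset.mul_sum, ← Finset.sum_mul, hμ.one, hν.one]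
  ring

/-! measure preserving maps -/
theorem MP.comp {U : Type} [Fintype U] {μ : Ω → ℝ} {ν : T → ℝ} {κ : U → ℝ} {f : Ω → T} {g : T → U}
    (hg : MP ν κ g) (hf : MP μ ν f) : MP μ κ (fun ω => g (f ω)) := fun F => by
  rw [← hg F, ← hf (fun t => F (g t))]

theorem MP.id (μ : Ω → ℝ) : MP μ μ (fun ω => ω) := fun _ => rfl

theorem MP.fst (μ : Ω → ℝ) {ν : Ω' → ℝ} (hν : IsP ν) : MP (prd μ ν) μ (fun w => w.1) := fun F => by
  simp only [WPFR.prd, Fintype.sum_prod_type]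
  refine Finset.sum_congr rfl fun a _ => ?_
  rw [← Finset.sum_mul, ← Finset.mul_sum, hν.one, mul_one]

theorem MP.snd {μ : Ω → ℝ} (hμ : IsP μ) (ν : Ω' → ℝ) : MP (prd μ ν) ν (fun w => w.2) := fun F => by
  simp only [WPFR.prd, Fintype.sum_prod_type]
  rw [Finset.sum_comm]
  refine Finset.sum_congr rfl fun a _ => ?_
  rw [← Finset.sum_mul, ← Finset.sum_mul, hμ.one, one_mul]

theorem MP.equiv {μ : Ω → ℝ} {ν : T → ℝ} (e : Ω ≃ T) (h : ∀ ω, μ ω = ν (e ω)) :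
    MP μ ν (fun ω => e ω) := fun F => by
  simp only [h]
  exact Equiv.sum_comp e (fun t => ν t * F t)

theorem MP.swap (μ : Ω → ℝ) (ν : Ω' → ℝ) : MP (prd μ ν) (prd ν μ) (fun w => (w.2, w.1)) :=
  MP.equiv (Equiv.prodComm Ω Ω') (fun _ => mul_comm _ _)

theorem MP.map {U U' : Type} [Fintype U] [Fintype U'] {μ : Ω → ℝ} {ν : Ω' → ℝ} {κ : U → ℝ}
    {l : U' → ℝ} {f : Ω → U} {g : Ω' → U'} (hf : MP μ κ f) (hg : MP ν l g) :
    MP (prd μ ν) (prd κ l) (fun w => (f w.1, g w.2)) := fun F => by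
  simp only [WPFR.prd, Fintype.sum_prod_type, mul_assoc, ← Finset.mul_sum]
  have : ∀ a, ∑ i, ν i * F (f a, g i) = ∑ t, l t * F (f a, t) := fun a => hg (fun t => F (f a, t))
  simp only [this]
  exact hf (fun u => ∑ t, l t * F (u, t))

/-! law -/
noncomputable def law (μ : Ω → ℝ) (X : Ω → T) : T → ℝ := fun t => pr μ X t

theorem MP.law (μ : Ω → ℝ) (X : Ω → T) : MP μ (law μ X) X := fun F => by
  classical
  simp only [WPFR.law, pr, Finset.sum_mul]
  rw [Finset.sum_comm]
  refine Finset.sum_congr rfl fun ω _ => ?_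
  simp

theorem MP.isP {μ : Ω → ℝ} {ν : T → ℝ} {f : Ω → T} (hf : MP μ ν f) (hμ : IsP μ) : ∑ t, ν t = 1 := by
  have := hf (fun _ => 1)
  simp only [mul_one, hμ.one] at this
  exact this.symm

theorem law_isP {μ : Ω → ℝ} (hμ : IsP μ) (X : Ω → T) : IsP (law μ X) :=
  ⟨fun _ => pr_nonneg hμ _ _, (MP.law μ X).isP hμ⟩

/-! conditioning -/
open Classical in
noncomputable def cnd (μ : Ω → ℝ) (Z : Ω → S) (z : S) : Ω → ℝ :=
  fun ω => if Z ω = z then μ ω / pr μ Z z else 0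

theorem cnd_isP {μ : Ω → ℝ} (hμ : IsP μ) (Z : Ω → S) {z : S} (hz : pr μ Z z ≠ 0) :
    IsP (cnd μ Z z) := by
  classical
  constructor
  · intro ω
    unfold cnd
    split_ifs
    · exact div_nonneg (hμ.nn _) (pr_nonneg hμ _ _)
    · exact le_rfl
  · have : ∀ ω, cnd μ Z z ω = (if Z ω = z then μ ω else 0) / pr μ Z z := by
      intro ω; unfold cnd; split_ifs <;> simp
    simp only [this, ← Finset.sum_div]
    exact div_self hz

theorem avg_cnd {μ : Ω → ℝ} (hμ : IsP μ) (Z : Ω → S) (F : Ω → ℝ) :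
    ∑ ω, μ ω * ∑ ω', cnd μ Z (Z ω) ω' * F ω' = ∑ ω, μ ω * F ω := by
  classical
  simp only [Finset.mul_sum]
  rw [Finset.sum_comm]
  refine Finset.sum_congr rfl fun a _ => ?_
  by_cases ha : μ a = 0
  · simp [cnd, ha]
  have h1 : ∀ ω, μ ω * (cnd μ Z (Z ω) a * F a) =
      (if Z ω = Z a then μ ω else 0) * (μ a * F a / pr μ Z (Z a)) := by
    intro ω
    unfold cnd
    by_cases h : Z a = Z ω
    · rw [if_pos h, if_pos h.symm, h]; ring
    · rw [if_neg h, if_neg (fun h' => h h'.symm)]; ring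
  simp only [h1, ← Finset.sum_mul]
  have : pr μ Z (Z a) ≠ 0 := (pr_pos hμ Z ha).ne'
  change pr μ Z (Z a) * _ = _
  field_simp

theorem ent_cnd {μ : Ω → ℝ} (hμ : IsP μ) (X : Ω → S) (Z : Ω → S') :
    ∑ ω, μ ω * ent (cnd μ Z (Z ω)) X = ent μ (fun ω => (X ω, Z ω)) - ent μ Z := by
  classical
  have h1 : ∀ ω, ent (cnd μ Z (Z ω)) X = ∑ ω', cnd μ Z (Z ω) ω' *
      (log (pr μ Z (Z ω')) - log (pr μ (fun ω => (X ω, Z ω)) (X ω', Z ω'))) := by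
    intro ω
    unfold ent
    rw [← Finset.sum_neg_distrib]
    refine Finset.sum_congr rfl fun a _ => ?_
    by_cases h : Z a = Z ω
    swap
    · simp [cnd, h]
    by_cases ha : μ a = 0
    · simp [cnd, ha]
    have h2 : pr (cnd μ Z (Z ω)) X (X a) = pr μ (fun ω => (X ω, Z ω)) (X a, Z a) / pr μ Z (Z a) := by
      simp only [pr, cnd, Finset.sum_div, ← h]
      refine Finset.sum_congr rfl fun b _ => ?_
      by_cases h3 : X b = X a <;> by_cases h4 : Z b = Z a <;> simp [h3, h4]
    have h5 := (pr_pos hμ Z ha).ne'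
    have h6 := (pr_pos hμ (fun ω => (X ω, Z ω)) ha).ne'
    rw [h2, Real.log_div h6 h5]
    ring
  simp only [h1]
  rw [avg_cnd hμ Z (fun ω' => log (pr μ Z (Z ω')) - log (pr μ (fun ω => (X ω, Z ω)) (X ω', Z ω')))]
  simp only [ent, mul_sub, Finset.sum_sub_distrib]
  ring

theorem cnd_prd (μ : Ω → ℝ) (ν : Ω' → ℝ) (Z : Ω → S) (Z' : Ω' → S') (z : S) (z' : S') :
    cnd (prd μ ν) (fun w => (Z w.1, Z' w.2)) (z, z') = prd (cnd μ Z z) (cnd ν Z' z') := by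
  classical
  funext w
  simp only [cnd, prd]
  rw [pr_prd]
  by_cases h1 : Z w.1 = z <;> by_cases h2 : Z' w.2 = z' <;> simp [h1, h2, mul_div_mul_comm]

end basic
end WPFR


namespace WPFR
open Finset Real

section dist
variable {Ω Ω' Ω'' T T' : Type} [Fintype Ω] [Fintype Ω'] [Fintype Ω''] [Fintype T] [Fintype T']
variable {S S' : Type}
variable {G Q : Type} [AddCommGroup G] [AddCommGroup Q]

theorem ent_fst (μ : Ω → ℝ) {ν : Ω' → ℝ} (hν : IsP ν) (X : Ω → S) :
    ent (prd μ ν) (fun w => X w.1) = ent μ X := ent_mp (MP.fst μ hν) X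

theorem ent_snd {μ : Ω → ℝ} (ν : Ω' → ℝ) (hμ : IsP μ) (X : Ω' → S) :
    ent (prd μ ν) (fun w => X w.2) = ent ν X := ent_mp (MP.snd hμ ν) X

noncomputable def ds (μ : Ω → ℝ) (X : Ω → G) (ν : Ω' → ℝ) (Y : Ω' → G) : ℝ :=
  ent (prd μ ν) (fun w => X w.1 - Y w.2) - ent μ X / 2 - ent ν Y / 2

variable {μ : Ω → ℝ} {ν : Ω' → ℝ} {κ : Ω'' → ℝ}

theorem le_ent_sub_left (hμ : IsP μ) (hν : IsP ν) (X : Ω → G) (Y : Ω' → G) :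
    ent μ X ≤ ent (prd μ ν) (fun w => X w.1 - Y w.2) := by
  have := submod (hμ.prd hν) (fun w => X w.1 - Y w.2) (fun w => Y w.2) (fun _ => ())
    (fun w => (X w.1, Y w.2)) (by simp) (by simp) (by
      intro w w' _ _ h1 h2
      simp only [h2, sub_left_inj] at h1
      simp [h1, h2])
  rw [ent_prd hμ hν, ent_snd ν hμ, ent_const (hμ.prd hν) (X := fun _ => ()) (by simp)] at this
  linarith

theorem le_ent_sub_right (hμ : IsP μ) (hν : IsP ν) (X : Ω → G) (Y : Ω' → G) :
    ent ν Y ≤ ent (prd μ ν) (fun w => X w.1 - Y w.2) := by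
  have := submod (hμ.prd hν) (fun w => X w.1 - Y w.2) (fun w => X w.1) (fun _ => ())
    (fun w => (X w.1, Y w.2)) (by simp) (by simp) (by
      intro w w' _ _ h1 h2
      simp only [h2, sub_right_inj] at h1
      simp [h1, h2])
  rw [ent_prd hμ hν, ent_fst μ hν, ent_const (hμ.prd hν) (X := fun _ => ()) (by simp)] at this
  linarith

theorem ds_nonneg (hμ : IsP μ) (hν : IsP ν) (X : Ω → G) (Y : Ω' → G) : 0 ≤ ds μ X ν Y := by
  have h1 := le_ent_sub_left hμ hν X Y
  have h2 := le_ent_sub_right hμ hν X Y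
  unfold ds; linarith

theorem ent_right_le (hμ : IsP μ) (hν : IsP ν) (X : Ω → G) (Y : Ω' → G) :
    ent ν Y ≤ ent μ X + 2 * ds μ X ν Y := by
  have h2 := le_ent_sub_right hμ hν X Y
  unfold ds; linarith

theorem ent_left_le (hμ : IsP μ) (hν : IsP ν) (X : Ω → G) (Y : Ω' → G) :
    ent μ X ≤ ent ν Y + 2 * ds μ X ν Y := by
  have h2 := le_ent_sub_left hμ hν X Y
  unfold ds; linarith

theorem ent_sub_comm (μ : Ω → ℝ) (ν : Ω' → ℝ) (X : Ω → G) (Y : Ω' → G) :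
    ent (prd μ ν) (fun w => X w.1 - Y w.2) = ent (prd ν μ) (fun w => Y w.1 - X w.2) := by
  rw [← ent_mp (MP.swap μ ν) (fun w => Y w.1 - X w.2)]
  apply ent_congr
  intro w w' _ _
  rw [← neg_sub, ← neg_sub (Y w'.2), neg_inj]

theorem ds_symm (μ : Ω → ℝ) (ν : Ω' → ℝ) (X : Ω → G) (Y : Ω' → G) :
    ds μ X ν Y = ds ν Y μ X := by
  unfold ds; rw [ent_sub_comm]; ring

theorem triangle_ent (hμ : IsP μ) (hν : IsP ν) (hκ : IsP κ) (X : Ω → G) (Y : Ω' → G) (Z : Ω'' → G) :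
    ent (prd μ κ) (fun w => X w.1 - Z w.2) + ent ν Y ≤
      ent (prd μ ν) (fun w => X w.1 - Y w.2) + ent (prd ν κ) (fun w => Y w.1 - Z w.2) := by
  have hP := hμ.prd (hν.prd hκ)
  have := submod hP (fun w => (X w.1 - Y w.2.1, Y w.2.1 - Z w.2.2)) (fun w => (X w.1, Z w.2.2))
    (fun w => X w.1 - Z w.2.2) (fun w => (X w.1, (Y w.2.1, Z w.2.2)))
    (by
      intro w w' _ _ h
      simp only [Prod.mk.injEq] at h
      rw [← sub_add_sub_cancel _ (Y w.2.1), h.1, h.2, sub_add_sub_cancel])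
    (by intro w w' _ _ h; simp only [Prod.mk.injEq] at h; rw [h.1, h.2])
    (by
      intro w w' _ _ h h'
      simp only [Prod.mk.injEq] at h h' ⊢
      refine ⟨h'.1, ?_, h'.2⟩
      have := h.1
      rw [h'.1, sub_right_inj] at this
      exact this)
  have e1 := subadd hP (fun w => X w.1 - Y w.2.1) (fun w => Y w.2.1 - Z w.2.2)
  have m12 : MP (prd μ (prd ν κ)) (prd μ ν) (fun w => (w.1, w.2.1)) :=
    (MP.id μ).map (MP.fst ν hκ)
  have m13 : MP (prd μ (prd ν κ)) (prd μ κ) (fun w => (w.1, w.2.2)) :=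
    (MP.id μ).map (MP.snd hν κ)
  have a1 := ent_mp m12 (fun w => X w.1 - Y w.2)
  have a2 := ent_mp m13 (fun w => X w.1 - Z w.2)
  have a3 := ent_mp m13 (fun w => (X w.1, Z w.2))
  have a4 := ent_snd (prd ν κ) hμ (fun w => Y w.1 - Z w.2)
  have a5 := ent_prd hμ hκ X Z
  have a6 := ent_prd hμ (hν.prd hκ) X (fun w => (Y w.1, Z w.2))
  have a7 := ent_prd hν hκ Y Z
  simp only at *
  linarith

theorem ds_triangle (hμ : IsP μ) (hν : IsP ν) (hκ : IsP κ) (X : Ω → G) (Y : Ω' → G) (Z : Ω'' → G) :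
    ds μ X κ Z ≤ ds μ X ν Y + ds ν Y κ Z := by
  have := triangle_ent hμ hν hκ X Y Z
  unfold ds; linarith

theorem ds_self_le (hμ : IsP μ) (hν : IsP ν) (X : Ω → G) (Y : Ω' → G) :
    ds μ X μ X ≤ 2 * ds μ X ν Y := by
  have := ds_triangle hμ hν hμ X Y X
  rw [ds_symm ν μ Y X] at this
  linarith

theorem kv (hμ : IsP μ) (hν : IsP ν) (hκ : IsP κ) (X : Ω → G) (Y : Ω' → G) (Z : Ω'' → G) :
    ent (prd μ (prd ν κ)) (fun w => X w.1 + Y w.2.1 + Z w.2.2) + ent ν Y ≤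
      ent (prd μ ν) (fun w => X w.1 + Y w.2) + ent (prd ν κ) (fun w => Y w.1 + Z w.2) := by
  have hP := hμ.prd (hν.prd hκ)
  have := submod hP (fun w => (X w.1 + Y w.2.1, Z w.2.2)) (fun w => (X w.1, Y w.2.1 + Z w.2.2))
    (fun w => X w.1 + Y w.2.1 + Z w.2.2) (fun w => (X w.1, (Y w.2.1, Z w.2.2)))
    (by intro w w' _ _ h; simp only [Prod.mk.injEq] at h; rw [h.1, h.2])
    (by intro w w' _ _ h; simp only [Prod.mk.injEq] at h; rw [add_assoc, h.1, h.2, add_assoc])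
    (by
      intro w w' _ _ h h'
      simp only [Prod.mk.injEq] at h h' ⊢
      refine ⟨h'.1, ?_, h.2⟩
      have := h.1
      rw [h'.1, add_right_inj] at this
      exact this)
  have e1 := subadd hP (fun w => X w.1 + Y w.2.1) (fun w => Z w.2.2)
  have m12 : MP (prd μ (prd ν κ)) (prd μ ν) (fun w => (w.1, w.2.1)) :=
    (MP.id μ).map (MP.fst ν hκ)
  have a1 := ent_mp m12 (fun w => X w.1 + Y w.2)
  have a2 := ent_snd (prd ν κ) hμ (fun w => Z w.2)
  have a3 := ent_snd κ hν Z
  have a5 := ent_prd hμ (hν.prd hκ) X (fun w => Y w.1 + Z w.2)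
  have a6 := ent_prd hμ (hν.prd hκ) X (fun w => (Y w.1, Z w.2))
  have a7 := ent_prd hν hκ Y Z
  simp only at *
  linarith

theorem ds_proj (hμ : IsP μ) (hν : IsP ν) (X : Ω → G) (Y : Ω' → G) (R : Ω → S)
    (h1 : ∀ a b, X a = X b → R a = R b)
    (h2 : ∀ a b a' b', μ a ≠ 0 → μ a' ≠ 0 → ν b ≠ 0 → ν b' ≠ 0 →
      X a - Y b = X a' - Y b' → R a = R a') : ent μ R ≤ 2 * ds μ X ν Y := by
  have := submod (hμ.prd hν) (fun w => X w.1 - Y w.2) (fun w => X w.1) (fun w => R w.1)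
    (fun w => (X w.1, Y w.2))
    (by
      intro w w' a b h
      simp only [prd, mul_ne_zero_iff] at a b
      exact h2 _ _ _ _ a.1 b.1 a.2 b.2 h)
    (fun w w' _ _ h => h1 _ _ h)
    (by
      intro w w' _ _ h1 h2
      simp only [h2, sub_right_inj] at h1
      simp [h1, h2])
  rw [ent_prd hμ hν, ent_fst μ hν, ent_fst μ hν] at this
  have h3 := le_ent_sub_left hμ hν X Y
  unfold ds; linarith

theorem ds_mp {μ' : T → ℝ} {ν' : T' → ℝ} {f : Ω → T} {g : Ω' → T'} (hf : MP μ μ' f)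
    (hg : MP ν ν' g) (X : T → G) (Y : T' → G) :
    ds μ (fun ω => X (f ω)) ν (fun ω => Y (g ω)) = ds μ' X ν' Y := by
  unfold ds
  rw [ent_mp hf, ent_mp hg, ← ent_mp (hf.map hg) (fun w => X w.1 - Y w.2)]

theorem avg2 (hμ : IsP μ) (hν : IsP ν) (X : Ω → G) (Y : Ω' → G) (Z : Ω → S) (Z' : Ω' → S') :
    ∑ w, prd μ ν w * ds (cnd μ Z (Z w.1)) X (cnd ν Z' (Z' w.2)) Y =
      ent (prd μ ν) (fun w => (X w.1 - Y w.2, (Z w.1, Z' w.2))) - ent μ Z / 2 - ent ν Z' / 2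
      - ent μ (fun w => (X w, Z w)) / 2 - ent ν (fun w => (Y w, Z' w)) / 2 := by
  have e := ent_cnd (hμ.prd hν) (fun w => X w.1 - Y w.2) (fun w => (Z w.1, Z' w.2))
  simp only [cnd_prd] at e
  rw [ent_prd hμ hν] at e
  have e1 := ent_cnd hμ X Z
  have e2 := ent_cnd hν Y Z'
  have f1 := MP.fst μ hν (fun a => ent (cnd μ Z (Z a)) X)
  have f2 := MP.snd hμ ν (fun a => ent (cnd ν Z' (Z' a)) Y)
  have : ∀ w, prd μ ν w * ds (cnd μ Z (Z w.1)) X (cnd ν Z' (Z' w.2)) Y =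
      prd μ ν w * ent (prd (cnd μ Z (Z w.1)) (cnd ν Z' (Z' w.2))) (fun w => X w.1 - Y w.2)
      - prd μ ν w * ent (cnd μ Z (Z w.1)) X / 2 - prd μ ν w * ent (cnd ν Z' (Z' w.2)) Y / 2 := by
    intro w; unfold ds; ring
  simp only [this, Finset.sum_sub_distrib, ← Finset.sum_div]
  rw [e, f1, f2, e1, e2]
  ring

theorem fibring (hμ : IsP μ) (hν : IsP ν) (X : Ω → G) (Y : Ω' → G) (ψ : G →+ Q) :
    ds μ (fun a => ψ (X a)) ν (fun a => ψ (Y a)) +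
    ∑ w, prd μ ν w * ds (cnd μ (fun a => ψ (X a)) (ψ (X w.1))) X
      (cnd ν (fun a => ψ (Y a)) (ψ (Y w.2))) Y ≤ ds μ X ν Y := by
  have := submod (hμ.prd hν) (fun w => X w.1 - Y w.2) (fun w => (ψ (X w.1), ψ (Y w.2)))
    (fun w => ψ (X w.1) - ψ (Y w.2)) (fun w => (X w.1 - Y w.2, (ψ (X w.1), ψ (Y w.2))))
    (by intro w w' _ _ h; simp only [← map_sub, h])
    (by intro w w' _ _ h; simp only [Prod.mk.injEq] at h; rw [h.1, h.2])
    (by intro w w' _ _ h h'; rw [h, h'])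
  have h2 := avg2 hμ hν X Y (fun a => ψ (X a)) (fun a => ψ (Y a))
  rw [h2]
  rw [ent_prd hμ hν (fun a => ψ (X a)) (fun a => ψ (Y a))] at this
  have h3 : ent μ (fun w => (X w, ψ (X w))) = ent μ X := ent_congr (by
    intro a b _ _; simp only [Prod.mk.injEq, and_iff_left_iff_imp]; intro h; rw [h])
  have h4 : ent ν (fun w => (Y w, ψ (Y w))) = ent ν Y := ent_congr (by
    intro a b _ _; simp only [Prod.mk.injEq, and_iff_left_iff_imp]; intro h; rw [h])
  rw [h3, h4]
  unfold ds
  linarith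

theorem ds_contr (hμ : IsP μ) (hν : IsP ν) (X : Ω → G) (Y : Ω' → G) (ψ : G →+ Q) :
    ds μ (fun a => ψ (X a)) ν (fun a => ψ (Y a)) ≤ ds μ X ν Y := by
  have h := fibring hμ hν X Y ψ
  have : 0 ≤ ∑ w, prd μ ν w * ds (cnd μ (fun a => ψ (X a)) (ψ (X w.1))) X
      (cnd ν (fun a => ψ (Y a)) (ψ (Y w.2))) Y := by
    refine Finset.sum_nonneg fun w _ => ?_
    by_cases h0 : prd μ ν w = 0
    · simp [h0]
    refine mul_nonneg ((hμ.prd hν).nn _) ?_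
    simp only [prd, mul_ne_zero_iff] at h0
    exact ds_nonneg (cnd_isP hμ _ (pr_pos hμ (fun a => ψ (X a)) h0.1).ne')
      (cnd_isP hν _ (pr_pos hν (fun a => ψ (Y a)) h0.2).ne') _ _
  linarith

theorem avg1 (hμ : IsP μ) (hν : IsP ν) (X : Ω → G) (Y : Ω' → G) (Z : Ω' → S) :
    ∑ b, ν b * ds μ X (cnd ν Z (Z b)) Y ≤
      ds μ X ν Y + (ent ν Y + ent ν Z - ent ν (fun a => (Y a, Z a))) / 2 := by
  have h := avg2 hμ hν X Y (fun _ => ()) Z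
  have c1 : cnd μ (fun _ => ()) () = μ := by
    funext a; simp [cnd, pr, hμ.one]
  simp only [c1] at h
  rw [MP.snd hμ ν (fun b => ds μ X (cnd ν Z (Z b)) Y)] at h
  rw [h]
  have h1 : ent μ (fun _ : Ω => ()) = 0 := ent_const hμ (by simp)
  have h2 : ent μ (fun w => (X w, ())) = ent μ X := ent_congr (by simp)
  have h3 := subadd (hμ.prd hν) (fun w => X w.1 - Y w.2) (fun w => ((), Z w.2))
  have h4 : ent (prd μ ν) (fun w => ((), Z w.2)) = ent ν Z := by
    rw [← ent_snd ν hμ]; exact ent_congr (by simp)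
  rw [h1, h2]
  unfold ds
  linarith

end dist
end WPFR


namespace WPFR
open Finset Real

section bsg
variable {Ω : Type} [Fintype Ω] {S : Type} {G : Type} [AddCommGroup G]

noncomputable def kap (μ : Ω → ℝ) (Z : Ω → S) : Ω × Ω → ℝ := fun w => μ w.1 * cnd μ Z (Z w.1) w.2

theorem kap_fst {μ : Ω → ℝ} (hμ : IsP μ) (Z : Ω → S) : MP (kap μ Z) μ (fun w => w.1) := fun F => by
  simp only [kap, Fintype.sum_prod_type]
  refine Finset.sum_congr rfl fun a _ => ?_
  rw [← Finset.sum_mul, ← Finset.mul_sum]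
  by_cases ha : μ a = 0
  · simp [ha]
  rw [(cnd_isP hμ Z (pr_pos hμ Z ha).ne').one, mul_one]

theorem kap_snd {μ : Ω → ℝ} (hμ : IsP μ) (Z : Ω → S) : MP (kap μ Z) μ (fun w => w.2) := fun F => by
  rw [← avg_cnd hμ Z F]
  simp only [kap, Fintype.sum_prod_type, Finset.mul_sum, mul_assoc]

theorem kap_isP {μ : Ω → ℝ} (hμ : IsP μ) (Z : Ω → S) : IsP (kap μ Z) := by
  constructor
  · intro w
    unfold kap
    by_cases ha : μ w.1 = 0
    · simp [ha]
    exact mul_nonneg (hμ.nn _) ((cnd_isP hμ Z (pr_pos hμ Z ha).ne').nn _)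
  · have := kap_fst hμ Z (fun _ => 1)
    simpa [hμ.one] using this

theorem kap_supp {μ : Ω → ℝ} {Z : Ω → S} {w : Ω × Ω} (h : kap μ Z w ≠ 0) : Z w.2 = Z w.1 := by
  by_contra h'
  exact h (by simp [kap, cnd, h'])

theorem kap_ent {S' : Type} {μ : Ω → ℝ} (hμ : IsP μ) (Z : Ω → S) (f : Ω × Ω → S') :
    ∑ ω, μ ω * ent (prd (cnd μ Z (Z ω)) (cnd μ Z (Z ω))) f =
      ent (kap μ Z) (fun w => (f w, Z w.1)) - ent μ Z := by
  classical
  have h := ent_cnd (kap_isP hμ Z) f (fun w => Z w.1)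
  have h1 : ∀ z, cnd (kap μ Z) (fun w => Z w.1) z = prd (cnd μ Z z) (cnd μ Z z) := by
    intro z
    have h2 : pr (kap μ Z) (fun w => Z w.1) z = pr μ Z z := by
      have := kap_fst hμ Z (fun a => if Z a = z then 1 else 0)
      simpa [pr] using this
    funext w
    simp only [cnd, prd, h2, kap]
    by_cases h3 : Z w.1 = z
    · by_cases h4 : Z w.2 = z
      · simp only [h3, h4, if_true]; ring
      · simp [h3, h4]
    · simp [h3]
  simp only [h1] at h
  rw [kap_fst hμ Z (fun a => ent (prd (cnd μ Z (Z a)) (cnd μ Z (Z a))) f),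
    ent_mp (kap_fst hμ Z) Z] at h
  exact h

theorem bsg {μ : Ω → ℝ} (hμ : IsP μ) (A B : Ω → G) (C : Ω → S) (Z : Ω → G × S)
    (hZ : Z = fun ω => (A ω + B ω, C ω)) :
    ∑ ω, μ ω * ds (cnd μ Z (Z ω)) A (cnd μ Z (Z ω)) B ≤
      2 * ent μ (fun ω => (A ω, C ω)) + 2 * ent μ (fun ω => (B ω, C ω)) - 3 * ent μ C
      - 3 * ent μ (fun ω => (A ω, B ω, C ω)) + 2 * ent μ Z := by
  have hK := kap_isP hμ Z
  have m1 := kap_fst hμ Z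
  have m2 := kap_snd hμ Z
  have supp : ∀ w, kap μ Z w ≠ 0 → A w.2 + B w.2 = A w.1 + B w.1 ∧ C w.2 = C w.1 := by
    intro w hw
    have := kap_supp hw
    simpa [hZ] using this
  have e1 := kap_ent hμ Z (fun w => A w.1 - B w.2)
  have e2 := kap_ent hμ Z (fun w => (A w.1, B w.2))
  have eA := ent_cnd hμ A Z
  have eB := ent_cnd hμ B Z
  have e3 : ∑ ω, μ ω * ent (prd (cnd μ Z (Z ω)) (cnd μ Z (Z ω))) (fun w => (A w.1, B w.2)) =
      ∑ ω, μ ω * ent (cnd μ Z (Z ω)) A + ∑ ω, μ ω * ent (cnd μ Z (Z ω)) B := by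
    rw [← Finset.sum_add_distrib]
    refine Finset.sum_congr rfl fun a _ => ?_
    by_cases ha : μ a = 0
    · simp [ha]
    have := cnd_isP hμ Z (pr_pos hμ Z ha).ne'
    rw [ent_prd this this, mul_add]
  have e4 : ∑ ω, μ ω * ds (cnd μ Z (Z ω)) A (cnd μ Z (Z ω)) B =
      ∑ ω, μ ω * ent (prd (cnd μ Z (Z ω)) (cnd μ Z (Z ω))) (fun w => A w.1 - B w.2)
      - (∑ ω, μ ω * ent (cnd μ Z (Z ω)) A) / 2 - (∑ ω, μ ω * ent (cnd μ Z (Z ω)) B) / 2 := by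
    simp only [Finset.sum_div, ← Finset.sum_sub_distrib]
    refine Finset.sum_congr rfl fun a _ => ?_
    unfold ds; ring
  have fA : ent μ (fun ω => (A ω, Z ω)) = ent μ (fun ω => (A ω, B ω, C ω)) := ent_congr (by
    intro a b _ _; simp only [hZ, Prod.mk.injEq]
    constructor
    · rintro ⟨h1, h2, h3⟩; rw [h1, add_right_inj] at h2; exact ⟨h1, h2, h3⟩
    · rintro ⟨h1, h2, h3⟩; rw [h1, h2]; exact ⟨rfl, rfl, h3⟩)
  have fB : ent μ (fun ω => (B ω, Z ω)) = ent μ (fun ω => (A ω, B ω, C ω)) := ent_congr (by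
    intro a b _ _; simp only [hZ, Prod.mk.injEq]
    constructor
    · rintro ⟨h1, h2, h3⟩; rw [h1, add_left_inj] at h2; exact ⟨h2, h1, h3⟩
    · rintro ⟨h1, h2, h3⟩; rw [h1, h2]; exact ⟨rfl, rfl, h3⟩)
  have s1 := submod hK (fun w => (A w.1, B w.2, C w.1)) (fun w => (B w.1, A w.2, C w.1))
    (fun w => (A w.1 - B w.2, C w.1)) (fun w => ((A w.1, B w.2), Z w.1))
    (by intro w w' _ _ h; simp only [Prod.mk.injEq] at h ⊢; rw [h.1, h.2.1]; exact ⟨rfl, h.2.2⟩)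
    (by
      intro w w' a b h; simp only [Prod.mk.injEq] at h ⊢
      have t : ∀ w, kap μ Z w ≠ 0 → A w.1 - B w.2 = A w.2 - B w.1 := by
        intro w hw
        rw [sub_eq_sub_iff_add_eq_add, (supp w hw).1]
      rw [t w a, t w' b, h.1, h.2.1]; exact ⟨rfl, h.2.2⟩)
    (by
      intro w w' _ _ h h'; simp only [Prod.mk.injEq, hZ] at h h' ⊢
      rw [h.1, h.2.1, h'.1, h.2.2]; simp)
  have s2 := submod hK (fun w => (A w.1, C w.1)) (fun w => (B w.2, C w.2)) (fun w => C w.1)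
    (fun w => (A w.1, B w.2, C w.1))
    (by intro w w' _ _ h; simp only [Prod.mk.injEq] at h; exact h.2)
    (by intro w w' a b h; simp only [Prod.mk.injEq] at h; rw [← (supp w a).2, ← (supp w' b).2]; exact h.2)
    (by intro w w' _ _ h h'; simp only [Prod.mk.injEq] at h h' ⊢; exact ⟨h.1, h'.1, h.2⟩)
  have s3 := submod hK (fun w => (B w.1, C w.1)) (fun w => (A w.2, C w.2)) (fun w => C w.1)
    (fun w => (B w.1, A w.2, C w.1))
    (by intro w w' _ _ h; simp only [Prod.mk.injEq] at h; exact h.2)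
    (by intro w w' a b h; simp only [Prod.mk.injEq] at h; rw [← (supp w a).2, ← (supp w' b).2]; exact h.2)
    (by intro w w' _ _ h h'; simp only [Prod.mk.injEq] at h h' ⊢; exact ⟨h.1, h'.1, h.2⟩)
  have s4 := submod hK (fun w => (A w.1 - B w.2, C w.1)) (fun w => Z w.1) (fun w => C w.1)
    (fun w => (A w.1 - B w.2, Z w.1))
    (by intro w w' _ _ h; simp only [Prod.mk.injEq] at h; exact h.2)
    (by intro w w' _ _ h; simp only [hZ, Prod.mk.injEq] at h; exact h.2)
    (by intro w w' _ _ h h'; simp only [Prod.mk.injEq] at h ⊢; exact ⟨h.1, h'⟩)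
  have g1 := ent_mp m1 (fun ω => (A ω, C ω))
  have g2 := ent_mp m2 (fun ω => (B ω, C ω))
  have g3 := ent_mp m1 (fun ω => (B ω, C ω))
  have g4 := ent_mp m2 (fun ω => (A ω, C ω))
  have g5 := ent_mp m1 C
  have g6 := ent_mp m1 Z
  linarith

end bsg

section f2
variable {G : Type} [AddCommGroup G] [Fintype G]

theorem ent_eq_sum {Ω S : Type} [Fintype Ω] [Fintype S] (μ : Ω → ℝ) (X : Ω → S) :
    ent μ X = ∑ s, negMulLog (pr μ X s) := by
  have h := MP.law μ X (fun s => log (pr μ X s))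
  unfold ent
  rw [h, ← Finset.sum_neg_distrib]
  refine Finset.sum_congr rfl fun s _ => ?_
  simp [negMulLog, law]

noncomputable def tau (p0 p q : G → ℝ) : ℝ :=
  ds p (fun x => x) q (fun x => x) +
    (ds p0 (fun x => x) p (fun x => x) + ds p0 (fun x => x) q (fun x => x)) / 20

theorem cont_ent {Ω S A : Type} [Fintype Ω] [Fintype S] [TopologicalSpace A] (X : Ω → S)
    (m : A → Ω → ℝ) (hm : ∀ ω, Continuous (fun a => m a ω)) : Continuous (fun a => ent (m a) X) := by
  classical
  simp only [ent_eq_sum]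
  refine continuous_finsetSum _ fun s _ => continuous_negMulLog.comp ?_
  unfold pr
  refine continuous_finsetSum _ fun ω _ => ?_
  split_ifs
  · exact hm ω
  · exact continuous_const

theorem exists_min (p0 : G → ℝ) : ∃ p q : G → ℝ, IsP p ∧ IsP q ∧
    ∀ p' q', IsP p' → IsP q' → tau p0 p q ≤ tau p0 p' q' := by
  classical
  have hS : ∀ p : G → ℝ, p ∈ stdSimplex ℝ G ↔ IsP p :=
    fun p => ⟨fun h => ⟨h.1, h.2⟩, fun h => ⟨h.nn, h.one⟩⟩
  have hc : Continuous (fun z : (G → ℝ) × (G → ℝ) => tau p0 z.1 z.2) := by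
    unfold tau ds
    have c1 : ∀ X : G × G → G, Continuous (fun z : (G → ℝ) × (G → ℝ) => ent (prd z.1 z.2) X) :=
      fun X => cont_ent X _ (fun ω => by unfold prd; fun_prop)
    have c2 : ∀ X : G × G → G, Continuous (fun z : (G → ℝ) × (G → ℝ) => ent (prd p0 z.1) X) :=
      fun X => cont_ent X _ (fun ω => by unfold prd; fun_prop)
    have c3 : ∀ X : G × G → G, Continuous (fun z : (G → ℝ) × (G → ℝ) => ent (prd p0 z.2) X) :=
      fun X => cont_ent X _ (fun ω => by unfold prd; fun_prop)
    have c4 : ∀ X : G → G, Continuous (fun z : (G → ℝ) × (G → ℝ) => ent z.1 X) :=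
      fun X => cont_ent X _ (fun ω => by fun_prop)
    have c5 : ∀ X : G → G, Continuous (fun z : (G → ℝ) × (G → ℝ) => ent z.2 X) :=
      fun X => cont_ent X _ (fun ω => by fun_prop)
    have := c1 (fun w => w.1 - w.2)
    have := c2 (fun w => w.1 - w.2)
    have := c3 (fun w => w.1 - w.2)
    have := c4 (fun w => w)
    have := c5 (fun w => w)
    fun_prop
  have hne : ((stdSimplex ℝ G) ×ˢ (stdSimplex ℝ G)).Nonempty :=
    ⟨(Pi.single 0 1, Pi.single 0 1), single_mem_stdSimplex ℝ 0, single_mem_stdSimplex ℝ 0⟩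
  obtain ⟨z, hz, hmin⟩ := ((isCompact_stdSimplex ℝ G).prod (isCompact_stdSimplex ℝ G)).exists_isMinOn hne
    hc.continuousOn
  refine ⟨z.1, z.2, (hS _).1 hz.1, (hS _).1 hz.2, fun p' q' hp hq => ?_⟩
  exact hmin (a := (p', q')) ⟨(hS _).2 hp, (hS _).2 hq⟩

/-- minimality phrased for random variables -/
def Mn (p0 : G → ℝ) (t : ℝ) : Prop := ∀ (Ω Ω' : Type) [Fintype Ω] [Fintype Ω'] (μ : Ω → ℝ) (ν : Ω' → ℝ)
  (X : Ω → G) (Y : Ω' → G), IsP μ → IsP ν →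
    t ≤ ds μ X ν Y + (ds p0 (fun x => x) μ X + ds p0 (fun x => x) ν Y) / 20

theorem min_rv {p0 p q : G → ℝ}
    (h : ∀ p' q', IsP p' → IsP q' → tau p0 p q ≤ tau p0 p' q') : Mn p0 (tau p0 p q) := by
  intro Ω Ω' _ _ μ ν X Y hμ hν
  have := h _ _ (law_isP hμ X) (law_isP hν Y)
  unfold tau at this ⊢
  rw [← ds_mp (MP.law μ X) (MP.law ν Y) (fun x => x) (fun x => x),
    ← ds_mp (MP.id p0) (MP.law μ X) (fun x => x) (fun x => x),
    ← ds_mp (MP.id p0) (MP.law ν Y) (fun x => x) (fun x => x)] at this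
  exact this

end f2
end WPFR


namespace WPFR
open Finset Real

section f2
variable {G : Type} [AddCommGroup G] [Fintype G]

theorem ds_add (hs : ∀ x y : G, x - y = x + y) {p0 p q : G → ℝ} (h0 : IsP p0) (hp : IsP p)
    (hq : IsP q) :
    ds p0 (fun x => x) (prd p q) (fun w => w.1 + w.2) ≤ ds p0 (fun x => x) p (fun x => x)
      + (ent (prd p q) (fun w => w.1 + w.2) - ent p (fun x => x)) / 2 := by
  have h := kv h0 hp hq (fun x => x) (fun x => x) (fun x => x)
  unfold ds
  simp only [hs, ← add_assoc] at *
  linarith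

/-- minimality plus fibring -/
theorem fourvar (hs : ∀ x y : G, x - y = x + y) {p0 p1 p2 q r : G → ℝ} (h0 : IsP p0) (h1 : IsP p1)
    (h2 : IsP p2) (hq : IsP q) (hr : IsP r) (hm : Mn p0 (tau p0 p1 p2)) :
    2 * ds p1 (fun x => x) p2 (fun x => x) + ent (prd p1 q) (fun w => w.1 + w.2)
      + ent (prd p2 r) (fun w => w.1 + w.2) + (ent p1 (fun x => x) + ent p2 (fun x => x)
        + ent q (fun x => x) + ent r (fun x => x)) / 2
      - (ent (prd p1 q) (fun w => w.1 + w.2) + ent (prd p2 r) (fun w => w.1 + w.2)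
       - (ent p1 (fun x => x) + ent p2 (fun x => x) + ent q (fun x => x) + ent r (fun x => x)) / 2) / 20
      ≤ ent (prd (prd p1 q) (prd p2 r)) (fun w => w.1.1 + w.1.2 + (w.2.1 + w.2.2))
        + ent (prd (prd p1 q) (prd p2 r))
          (fun w => (w.1.1 + w.2.1, (w.1.1 + w.1.2, w.2.1 + w.2.2))) := by
  have M1 := hm _ _ (prd p1 q) (prd p2 r) (fun w => w.1 + w.2) (fun w => w.1 + w.2)
    (h1.prd hq) (h2.prd hr)
  have a1 := ds_add hs h0 h1 hq
  have a2 := ds_add hs h0 h2 hr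
  have hA := h1.prd hq
  have hB := h2.prd hr
  have M2 : tau p0 p1 p2 ≤ ∑ w, prd (prd p1 q) (prd p2 r) w *
      (ds (cnd (prd p1 q) (fun w => w.1 + w.2) (w.1.1 + w.1.2)) (fun w => w.1)
        (cnd (prd p2 r) (fun w => w.1 + w.2) (w.2.1 + w.2.2)) (fun w => w.1)
      + (ds p0 (fun x => x) (cnd (prd p1 q) (fun w => w.1 + w.2) (w.1.1 + w.1.2)) (fun w => w.1)
      + ds p0 (fun x => x) (cnd (prd p2 r) (fun w => w.1 + w.2) (w.2.1 + w.2.2)) (fun w => w.1))/20) := by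
    calc tau p0 p1 p2 = ∑ w, prd (prd p1 q) (prd p2 r) w * tau p0 p1 p2 := by
          rw [← Finset.sum_mul, (hA.prd hB).one, one_mul]
      _ ≤ _ := by
          refine Finset.sum_le_sum fun w _ => ?_
          by_cases hw : prd (prd p1 q) (prd p2 r) w = 0
          · simp [hw]
          refine mul_le_mul_of_nonneg_left ?_ ((hA.prd hB).nn w)
          have hw' : prd p1 q w.1 ≠ 0 ∧ prd p2 r w.2 ≠ 0 := by
            constructor <;> intro h <;> apply hw
            · change prd p1 q w.1 * prd p2 r w.2 = 0
              rw [h, zero_mul]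
            · change prd p1 q w.1 * prd p2 r w.2 = 0
              rw [h, mul_zero]
          exact hm _ _ _ _ _ _
            (cnd_isP hA _ (pr_pos hA (fun w : G × G => w.1 + w.2) hw'.1).ne')
            (cnd_isP hB _ (pr_pos hB (fun w : G × G => w.1 + w.2) hw'.2).ne')
  simp only [mul_add, Finset.sum_add_distrib, ← mul_div_assoc, add_div, ← Finset.sum_div] at M2
  have b0 := avg2 hA hB (fun w => w.1) (fun w => w.1) (fun w => w.1 + w.2) (fun w => w.1 + w.2)
  have b1 := avg1 h0 hA (fun x => x) (fun w => w.1) (fun w => w.1 + w.2)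
  have b2 := avg1 h0 hB (fun x => x) (fun w => w.1) (fun w => w.1 + w.2)
  rw [← MP.fst (prd p1 q) hB (fun b => ds p0 (fun x => x)
    (cnd (prd p1 q) (fun w => w.1 + w.2) (b.1 + b.2)) (fun w => w.1))] at b1
  rw [← MP.snd hA (prd p2 r) (fun b => ds p0 (fun x => x)
    (cnd (prd p2 r) (fun w => w.1 + w.2) (b.1 + b.2)) (fun w => w.1))] at b2
  have c1 : ∀ (p q : G → ℝ), IsP p → IsP q → ent (prd p q) (fun w => (w.1, w.1 + w.2))
      = ent p (fun x => x) + ent q (fun x => x) := by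
    intro p q hp hq
    rw [← ent_prd hp hq]
    refine ent_congr fun a b _ _ => ?_
    simp only [Prod.mk.injEq]
    constructor
    · rintro ⟨h1, h2⟩; rw [h1, add_right_inj] at h2; exact ⟨h1, h2⟩
    · rintro ⟨h1, h2⟩; rw [h1, h2]; exact ⟨rfl, rfl⟩
  have d1 := MP.fst p1 hq
  have d2 := MP.fst p2 hr
  have d3 : ds p0 (fun x => x) (prd p1 q) (fun w => w.1) = ds p0 (fun x => x) p1 (fun x => x) :=
    ds_mp (MP.id p0) d1 (fun x => x) (fun x => x)
  have d4 : ds p0 (fun x => x) (prd p2 r) (fun w => w.1) = ds p0 (fun x => x) p2 (fun x => x) :=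
    ds_mp (MP.id p0) d2 (fun x => x) (fun x => x)
  have d5 := ent_fst p1 hq (fun x => x)
  have d6 := ent_fst p2 hr (fun x => x)
  rw [c1 _ _ h1 hq] at b0 b1
  rw [c1 _ _ h2 hr] at b0 b2
  rw [d3, d5] at b1
  rw [d4, d6] at b2
  have e : ds (prd p1 q) (fun w => w.1 + w.2) (prd p2 r) (fun w => w.1 + w.2) =
    ent (prd (prd p1 q) (prd p2 r)) (fun w => w.1.1 + w.1.2 + (w.2.1 + w.2.2)) -
      ent (prd p1 q) (fun w => w.1 + w.2) / 2 - ent (prd p2 r) (fun w => w.1 + w.2) / 2 := by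
    unfold ds; simp only [hs]
  have et : tau p0 p1 p2 = ds p1 (fun x => x) p2 (fun x => x) +
    (ds p0 (fun x => x) p1 (fun x => x) + ds p0 (fun x => x) p2 (fun x => x)) / 20 := rfl
  simp only [hs] at b0
  rw [e] at M1
  rw [b0] at M2
  rw [et] at M1 M2
  linarith

theorem min_zero (h2' : ∀ x : G, x + x = 0) {p0 p1 p2 : G → ℝ} (h0 : IsP p0) (h1 : IsP p1)
    (h2 : IsP p2) (hm : Mn p0 (tau p0 p1 p2)) : ds p1 (fun x => x) p2 (fun x => x) = 0 := by
  have hs : ∀ x y : G, x - y = x + y := fun x y => by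
    rw [sub_eq_iff_eq_add, add_assoc, h2', add_zero]
  have F2 := fourvar hs h0 h1 h2 h1 h2 hm
  have F1 := fourvar hs h0 h1 h2 h2 h1 hm
  have hA := h1.prd h1
  have hB := h2.prd h2
  set μ := prd (prd p1 p1) (prd p2 p2) with hμd
  have hμ : IsP μ := hA.prd hB
  -- names
  set U : (G × G) × (G × G) → G := fun w => w.1.1 + w.2.1 with hU
  set V : (G × G) × (G × G) → G := fun w => w.2.1 + w.1.2 with hV
  set W : (G × G) × (G × G) → G := fun w => w.1.1 + w.1.2 with hW
  set S : (G × G) × (G × G) → G := fun w => w.1.1 + w.1.2 + (w.2.1 + w.2.2) with hS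
  set Z : (G × G) × (G × G) → G × G := fun w => (U w + V w, S w) with hZ
  set c := ent (prd p1 p2) (fun w => w.1 + w.2) with hc
  set a := ent (prd p1 p1) (fun w => w.1 + w.2) with ha
  set b := ent (prd p2 p2) (fun w => w.1 + w.2) with hb
  set e1 := ent p1 (fun x => x) with he1
  set e2 := ent p2 (fun x => x) with he2
  set k := ds p1 (fun x => x) p2 (fun x => x) with hk
  set N := ent μ (fun w => (U w, V w, S w)) with hN
  have kc : k = c - e1 / 2 - e2 / 2 := by
    simp only [hk, ds, hs]; rfl
  have k0 : 0 ≤ k := ds_nonneg h1 h2 _ _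
  -- a, b bounds
  have ka : a - e1 ≤ 2 * k := by
    have := ds_self_le h1 h2 (fun x => x) (fun x => x)
    have e : ds p1 (fun x => x) p1 (fun x => x) = a - e1 / 2 - e1 / 2 := by simp only [ds, hs]; rfl
    rw [e] at this; linarith
  have kb : b - e2 ≤ 2 * k := by
    have := ds_self_le h2 h1 (fun x => x) (fun x => x)
    rw [ds_symm p2 p1] at this
    have e : ds p2 (fun x => x) p2 (fun x => x) = b - e2 / 2 - e2 / 2 := by simp only [ds, hs]; rfl
    rw [e] at this; linarith
  -- swap of c
  have c' : ent (prd p2 p1) (fun w => w.1 + w.2) = c := by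
    rw [hc, ← ent_mp (MP.swap p1 p2) (fun w => w.1 + w.2)]
    exact ent_congr (fun w w' _ _ => by simp only [add_comm])
  -- triple entropies
  have N2 : ent μ (fun w => (w.1.1 + w.2.1, (w.1.1 + w.1.2, w.2.1 + w.2.2))) = N := by
    refine ent_congr ?_
    rintro ⟨⟨x, y⟩, ⟨z, t⟩⟩ ⟨⟨x', y'⟩, ⟨z', t'⟩⟩ _ _
    have i1 := h2' x; have i2 := h2' y; have i3 := h2' z; have i4 := h2' t
    have i5 := h2' x'; have i6 := h2' y'; have i7 := h2' z'; have i8 := h2' t'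
    simp only [hU, hV, hS, Prod.mk.injEq]
    clear * - i1 i2 i3 i4 i5 i6 i7 i8
    constructor
    · rintro ⟨g1, g2, g3⟩
      have e1 : z + y = (x + z) + (x + y) := by
        have : (x + z) + (x + y) = (x + x) + (z + y) := by abel
        rw [this, i1, zero_add]
      have e2 : z' + y' = (x' + z') + (x' + y') := by
        have : (x' + z') + (x' + y') = (x' + x') + (z' + y') := by abel
        rw [this, i5, zero_add]
      exact ⟨g1, by rw [e1, e2, g1, g2], by rw [g2, g3]⟩
    · rintro ⟨g1, g2, g3⟩; refine ⟨g1, ?_, ?_⟩ <;> grind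
  let eq : (G × G) × (G × G) ≃ (G × G) × (G × G) :=
    ⟨fun w => ((w.1.1, w.2.2), (w.2.1, w.1.2)), fun w => ((w.1.1, w.2.2), (w.2.1, w.1.2)),
      fun _ => rfl, fun _ => rfl⟩
  have mI : MP μ (prd (prd p1 p2) (prd p2 p1)) (fun w => ((w.1.1, w.2.2), (w.2.1, w.1.2))) :=
    MP.equiv eq (fun w => by simp only [hμd, prd, eq, Equiv.coe_fn_mk]; ring)
  have N1 : ent (prd (prd p1 p2) (prd p2 p1))
      (fun w => (w.1.1 + w.2.1, (w.1.1 + w.1.2, w.2.1 + w.2.2))) = N := by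
    rw [← ent_mp mI]
    refine ent_congr ?_
    rintro ⟨⟨x, y⟩, ⟨z, t⟩⟩ ⟨⟨x', y'⟩, ⟨z', t'⟩⟩ _ _
    simp only [hU, hV, hS, Prod.mk.injEq]
    clear * - x y z t x' y' z' t'
    constructor
    · rintro ⟨g1, g2, g3⟩; refine ⟨g1, ?_, ?_⟩ <;> grind
    · rintro ⟨g1, g2, g3⟩; refine ⟨g1, ?_, ?_⟩ <;> grind
  have S1 : ent (prd (prd p1 p2) (prd p2 p1)) (fun w => w.1.1 + w.1.2 + (w.2.1 + w.2.2)) = ent μ S := by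
    rw [← ent_mp mI]
    refine ent_congr fun w w' _ _ => ?_
    have : ∀ w : (G × G) × (G × G), w.1.1 + w.2.2 + (w.2.1 + w.1.2) = S w := fun w => by
      simp only [hS]; abel
    simp only [this]
  rw [c', N1, S1] at F1
  rw [N2] at F2
  -- pair entropies
  have m12 : MP μ (prd p1 p2) (fun w => (w.1.1, w.2.1)) := (MP.fst p1 h1).map (MP.fst p2 h2)
  have m34 : MP μ (prd p1 p2) (fun w => (w.1.2, w.2.2)) := (MP.snd h1 p1).map (MP.snd h2 p2)
  have m23 : MP μ (prd p2 p1) (fun w => (w.2.1, w.1.2)) :=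
    (MP.swap p1 p2).comp ((MP.snd h1 p1).map (MP.fst p2 h2))
  let eq2 : (G × G) × (G × G) ≃ (G × G) × (G × G) :=
    ⟨fun w => ((w.1.1, w.2.1), (w.1.2, w.2.2)), fun w => ((w.1.1, w.2.1), (w.1.2, w.2.2)),
      fun _ => rfl, fun _ => rfl⟩
  have mJ : MP μ (prd (prd p1 p2) (prd p1 p2)) (fun w => ((w.1.1, w.2.1), (w.1.2, w.2.2))) :=
    MP.equiv eq2 (fun w => by simp only [hμd, prd, eq2, Equiv.coe_fn_mk]; ring)
  have HU : ent μ U = c := ent_mp m12 (fun w => w.1 + w.2)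
  have HV : ent μ V = c := (ent_mp m23 (fun w => w.1 + w.2)).trans c'
  have HUS : ent μ (fun w => (U w, S w)) = 2 * c := by
    have h := ent_prd (h1.prd h2) (h1.prd h2) (fun w => w.1 + w.2) (fun w => w.1 + w.2)
    rw [two_mul, ← h, ← ent_mp mJ]
    refine ent_congr ?_
    rintro ⟨⟨x, y⟩, ⟨z, t⟩⟩ ⟨⟨x', y'⟩, ⟨z', t'⟩⟩ _ _
    simp only [hU, hS, Prod.mk.injEq]
    clear * - x y z t x' y' z' t'
    constructor
    · rintro ⟨g1, g2⟩; refine ⟨g1, ?_⟩; grind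
    · rintro ⟨g1, g2⟩; refine ⟨g1, ?_⟩; grind
  have HVS : ent μ (fun w => (V w, S w)) = 2 * c := by
    have h := ent_prd (h1.prd h2) (h2.prd h1) (fun w => w.1 + w.2) (fun w => w.1 + w.2)
    have h' : (2 : ℝ) * c = c + ent (prd p2 p1) (fun w => w.1 + w.2) := by rw [c']; ring
    rw [h', hc, ← h, ← ent_mp mI]
    refine ent_congr ?_
    rintro ⟨⟨x, y⟩, ⟨z, t⟩⟩ ⟨⟨x', y'⟩, ⟨z', t'⟩⟩ _ _
    simp only [hV, hS, Prod.mk.injEq]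
    clear * - x y z t x' y' z' t'
    constructor
    · rintro ⟨g1, g2⟩; refine ⟨?_, g1⟩; grind
    · rintro ⟨g1, g2⟩; refine ⟨g2, ?_⟩; grind
  have HZ : ent μ Z = a + b := by
    have h := ent_prd hA hB (fun w => w.1 + w.2) (fun w => w.1 + w.2)
    rw [ha, hb, ← h]
    refine ent_congr ?_
    rintro ⟨⟨x, y⟩, ⟨z, t⟩⟩ ⟨⟨x', y'⟩, ⟨z', t'⟩⟩ _ _
    have i1 := h2' z; have i2 := h2' z'
    simp only [hZ, hU, hV, hS, Prod.mk.injEq]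
    clear * - x y t x' y' t' i1 i2
    constructor
    · rintro ⟨g1, g2⟩; have g3 : x + y = x' + y' := by grind
      rw [g3] at g2; exact ⟨g3, add_left_cancel g2⟩
    · rintro ⟨g1, g2⟩; refine ⟨?_, ?_⟩ <;> grind
  have HUZ : ent μ (fun w => (U w, Z w)) = N := by
    refine ent_congr fun w w' _ _ => ?_
    simp only [hZ, Prod.mk.injEq]
    constructor
    · rintro ⟨g1, g2, g3⟩; rw [g1, add_right_inj] at g2; exact ⟨g1, g2, g3⟩
    · rintro ⟨g1, g2, g3⟩; rw [g1, g2]; exact ⟨rfl, rfl, g3⟩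
  have HVZ : ent μ (fun w => (V w, Z w)) = N := by
    refine ent_congr fun w w' _ _ => ?_
    simp only [hZ, Prod.mk.injEq]
    constructor
    · rintro ⟨g1, g2, g3⟩; rw [g1, add_left_inj] at g2; exact ⟨g2, g1, g3⟩
    · rintro ⟨g1, g2, g3⟩; rw [g1, g2]; exact ⟨rfl, rfl, g3⟩
  -- H(S) bound
  have HS : ent μ S ≤ c + 2 * k := by
    have k1 := kv h1 h2 (h1.prd h2) (fun x => x) (fun x => x) (fun w => w.1 + w.2)
    have k2 := kv h2 h1 h2 (fun x => x) (fun x => x) (fun x => x)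
    let eq3 : (G × G) × (G × G) ≃ G × (G × (G × G)) :=
      ⟨fun w => (w.1.1, (w.2.1, (w.1.2, w.2.2))), fun w => ((w.1, w.2.2.1), (w.2.1, w.2.2.2)),
        fun _ => rfl, fun _ => rfl⟩
    have mK : MP μ (prd p1 (prd p2 (prd p1 p2))) (fun w => (w.1.1, (w.2.1, (w.1.2, w.2.2)))) :=
      MP.equiv eq3 (fun w => by simp only [hμd, prd, eq3, Equiv.coe_fn_mk]; ring)
    rw [← ent_mp mK] at k1
    have t : (fun w : (G × G) × (G × G) => w.1.1 + w.2.1 + (w.1.2 + w.2.2)) = S := by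
      funext w; simp only [hS]; abel
    simp only [← add_assoc] at k1 k2 t
    rw [t] at k1
    rw [c'] at k2
    linarith
  -- endgame
  have E := bsg hμ U V S Z hZ
  have M : tau p0 p1 p2 ≤ ∑ w, μ w * (ds (cnd μ Z (Z w)) U (cnd μ Z (Z w)) V
      + (ds p0 (fun x => x) (cnd μ Z (Z w)) U + ds p0 (fun x => x) (cnd μ Z (Z w)) V) / 20) := by
    calc tau p0 p1 p2 = ∑ w, μ w * tau p0 p1 p2 := by rw [← Finset.sum_mul, hμ.one, one_mul]
      _ ≤ _ := by
          refine Finset.sum_le_sum fun w _ => ?_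
          by_cases hw : μ w = 0
          · simp [hw]
          refine mul_le_mul_of_nonneg_left ?_ (hμ.nn w)
          have := cnd_isP hμ Z (pr_pos hμ Z hw).ne'
          exact hm _ _ _ _ _ _ this this
  simp only [mul_add, Finset.sum_add_distrib, ← mul_div_assoc, add_div, ← Finset.sum_div] at M
  have A1 := avg1 h0 hμ (fun x => x) U Z
  have A2 := avg1 h0 hμ (fun x => x) V Z
  have D1 : ds p0 (fun x => x) μ U = ds p0 (fun x => x) (prd p1 p2) (fun w => w.1 + w.2) :=
    ds_mp (MP.id p0) m12 (fun x => x) (fun w => w.1 + w.2)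
  have D2 : ds p0 (fun x => x) μ V = ds p0 (fun x => x) (prd p2 p1) (fun w => w.1 + w.2) :=
    ds_mp (MP.id p0) m23 (fun x => x) (fun w => w.1 + w.2)
  have B1 := ds_add hs h0 h1 h2
  have B2 := ds_add hs h0 h2 h1
  have et : tau p0 p1 p2 = k +
    (ds p0 (fun x => x) p1 (fun x => x) + ds p0 (fun x => x) p2 (fun x => x)) / 20 := rfl
  rw [c'] at B2
  rw [HUZ, HU, HZ, D1] at A1
  rw [HVZ, HV, HZ, D2] at A2
  rw [HUS, HVS, HZ] at E
  rw [et] at M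
  linarith

end f2
end WPFR

namespace WPFR
open Finset Real

theorem zero_sub {G : Type} [AddCommGroup G] [Fintype G] {p : G → ℝ} (hp : IsP p)
    (h : ds p (fun x => x) p (fun x => x) = 0) :
    ∃ H : AddSubgroup G, (∀ x y, p x ≠ 0 → p y ≠ 0 → x - y ∈ H) ∧
      ent p (fun x => x) = log (Nat.card H) := by
  classical
  have hpr : ∀ t, pr p (fun x => x) t = p t := fun t => by simp [pr]
  have hq : ∀ t, pr (prd p p) (fun w => w.1 - w.2) t = ∑ y, p y • p (t + y) := fun t => by
    simp only [pr, prd, Fintype.sum_prod_type, smul_eq_mul]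
    rw [Finset.sum_comm]
    refine Finset.sum_congr rfl fun y _ => ?_
    simp only [sub_eq_iff_eq_add, Finset.sum_ite_eq', Finset.mem_univ, if_true, mul_comm]
  have hj : ∀ t ∈ (Finset.univ : Finset G), ∑ y, p y • negMulLog (p (t + y)) ≤
      negMulLog (∑ y, p y • p (t + y)) := fun t _ =>
    concaveOn_negMulLog.le_map_sum (fun y _ => hp.nn y) hp.one (fun y _ => hp.nn _)
  have e1 : ∑ t, ∑ y, p y • negMulLog (p (t + y)) = ent p (fun x => x) := by
    rw [Finset.sum_comm, ent_eq_sum]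
    simp only [← Finset.smul_sum, hpr]
    have : ∀ y, ∑ t, negMulLog (p (t + y)) = ∑ t, negMulLog (p t) := fun y =>
      Equiv.sum_comp (Equiv.addRight y) (fun t => negMulLog (p t))
    simp only [this, ← Finset.sum_smul, hp.one, one_smul]
  have e2 : ∑ t, negMulLog (∑ y, p y • p (t + y)) = ent p (fun x => x) := by
    have : ent (prd p p) (fun w => w.1 - w.2) = ent p (fun x => x) := by
      unfold ds at h; linarith
    rw [← this, ent_eq_sum]
    simp only [hq]
  have e3 := (Finset.sum_eq_sum_iff_of_le hj).1 (e1.trans e2.symm)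
  have e4 : ∀ t y, p y ≠ 0 → p (t + y) = ∑ y, p y • p (t + y) := fun t y hy =>
    (strictConcaveOn_negMulLog.map_sum_eq_iff' (t := Finset.univ) (w := p)
      (p := fun y => p (t + y)) (fun y _ => hp.nn y) hp.one
      (fun y _ => hp.nn _)).1 (e3 t (Finset.mem_univ t)).symm y (Finset.mem_univ y) hy
  let H : AddSubgroup G :=
    { carrier := {h | ∀ t, p (t + h) = p t}
      zero_mem' := fun t => by rw [add_zero]
      add_mem' := fun {a b} ha hb t => by rw [← add_assoc, hb, ha]
      neg_mem' := fun {a} ha t => by have := ha (t + -a); rw [neg_add_cancel_right] at this; exact this.symm }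
  have hH : ∀ x y, p x ≠ 0 → p y ≠ 0 → x - y ∈ H := fun x y hx hy t => by
    have a := e4 (t - y) x hx
    rw [← e4 (t - y) y hy, sub_add_cancel] at a
    rw [← a]; congr 1; abel
  refine ⟨H, hH, ?_⟩
  obtain ⟨x0, hx0⟩ : ∃ x, p x ≠ 0 := by
    by_contra! hc
    have := hp.one
    simp [hc] at this
  have hx : ∀ x, p x = if x - x0 ∈ H then p x0 else 0 := fun x => by
    split_ifs with h
    · have := h x0; rw [add_sub_cancel] at this; exact this
    · by_contra hc; exact h (hH _ _ hc hx0)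
  have hc : (Nat.card H : ℝ) * p x0 = 1 := by
    rw [← hp.one]
    conv_rhs => enter [2, x]; rw [hx x]
    rw [← Equiv.sum_comp (Equiv.addRight x0)]
    simp [Finset.sum_ite, Nat.card_eq_fintype_card, Fintype.card_subtype]
  have hl : ∀ x, p x * log (p x) = p x * log (p x0) := fun x => by
    rw [hx x]; split_ifs <;> simp
  simp only [ent, hpr, hl]
  rw [← Finset.sum_mul, hp.one, one_mul, ← log_inv]
  congr 1
  exact (eq_inv_of_mul_eq_one_left hc).symm

theorem pfr_basic {G : Type} [AddCommGroup G] [Fintype G] (h2 : ∀ x : G, x + x = 0) {p0 : G → ℝ}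
    (h0 : IsP p0) : ∃ H : AddSubgroup G,
      ent p0 (fun x => (QuotientAddGroup.mk' H x)) ≤ 44 * ds p0 (fun x => x) p0 (fun x => x) ∧
      log (Nat.card H) ≤ ent p0 (fun x => x) + 44 * ds p0 (fun x => x) p0 (fun x => x) := by
  obtain ⟨p, q, hp, hq, hm⟩ := exists_min p0
  have hz := min_zero h2 h0 hp hq (min_rv hm)
  have hs := ds_self_le hp hq (fun x => x) (fun x => x)
  have hpp : ds p (fun x => x) p (fun x => x) = 0 :=
    le_antisymm (by linarith) (ds_nonneg hp hp _ _)
  obtain ⟨H, hH, hl⟩ := zero_sub hp hpp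
  have ht := hm p0 p0 h0 h0
  have hd : ds p0 (fun x => x) p (fun x => x) ≤ 22 * ds p0 (fun x => x) p0 (fun x => x) := by
    have := ds_nonneg h0 hq (fun x => x) (fun x => x)
    unfold tau at ht
    linarith
  refine ⟨H, ?_, ?_⟩
  · have := ds_proj h0 hp (fun x => x) (fun x => x) (fun x => QuotientAddGroup.mk' H x)
      (fun a b h => by rw [h]) (by
        intro a b a' b' _ _ hb hb' h
        have h1 := hH _ _ hb' hb
        simp only [QuotientAddGroup.mk'_apply]
        rw [QuotientAddGroup.eq]
        have : -a + a' = b' - b := by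
          have : a' = a - b + b' := by rw [h]; abel
          rw [this]; abel
        rw [this]; exact h1)
    linarith
  · have := ent_right_le h0 hp (fun x => x) (fun x => x)
    rw [hl] at this
    linarith

end WPFR

namespace WPFR
open Finset Real

theorem pfr_rv {G Ω Ω' : Type} [AddCommGroup G] [Finite G] [Fintype Ω] [Fintype Ω']
    (h2 : ∀ x : G, x + x = 0) {μ : Ω → ℝ}
    {ν : Ω' → ℝ} (hμ : IsP μ) (hν : IsP ν) (X : Ω → G) (Y : Ω' → G) : ∃ H : AddSubgroup G,
      ent μ (fun x => (QuotientAddGroup.mk' H (X x))) ≤ 88 * ds μ X ν Y ∧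
      ent ν (fun x => (QuotientAddGroup.mk' H (Y x))) ≤ 90 * ds μ X ν Y ∧
      log (Nat.card H) ≤ ent μ X + 88 * ds μ X ν Y := by
  have := Fintype.ofFinite G
  have m := MP.law μ X
  obtain ⟨H, a, b⟩ := pfr_basic h2 (law_isP hμ X)
  rw [← ds_mp m m (fun x => x) (fun x => x), ← ent_mp m] at a b
  have c := ds_self_le hμ hν X Y
  have d := ent_right_le hμ hν (fun x => (QuotientAddGroup.mk' H (X x)))
    (fun x => (QuotientAddGroup.mk' H (Y x)))
  have e := ds_contr hμ hν X Y (QuotientAddGroup.mk' H)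
  exact ⟨H, by linarith, by linarith, by linarith⟩

theorem iter {Ω Ω' : Type} [Fintype Ω] [Fintype Ω'] {μ : Ω → ℝ}
    {ν : Ω' → ℝ} (hμ : IsP μ) (hν : IsP ν) (n : ℕ) : ∀ (G : Type) [AddCommGroup G] [Finite G],
    Nat.card G = n → (∀ x : G, x + x = 0) → ∀ (X : Ω → G) (Y : Ω' → G),
    ∃ (Q : Type) (_ : AddCommGroup Q) (_ : Finite Q) (f : G →+ Q), Function.Surjective f ∧
      log (Nat.card G) + 2 * (ent μ (fun a => f (X a)) + ent ν (fun a => f (Y a))) ≤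
        log (Nat.card Q) + 2 * (ent μ X + ent ν Y) ∧
      ent μ (fun a => f (X a)) + ent ν (fun a => f (Y a)) ≤
        300 * ds μ (fun a => f (X a)) ν (fun a => f (Y a)) := by
  induction n using Nat.strong_induction_on with
  | _ n ih =>
  intro G _ _ hn h2 X Y
  by_cases hc : ent μ X + ent ν Y ≤ 300 * ds μ X ν Y
  · exact ⟨G, inferInstance, inferInstance, AddMonoidHom.id G, Function.surjective_id, le_refl _, hc⟩
  push Not at hc
  obtain ⟨H, a, b, c⟩ := pfr_rv h2 hμ hν X Y
  have d := ent_left_le hμ hν X Y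
  have d' := ent_right_le hμ hν X Y
  have d0 := ds_nonneg hμ hν X Y
  have hcard := AddSubgroup.card_eq_card_quotient_mul_card_addSubgroup H
  have hH : 1 < Nat.card H := by
    rw [AddSubgroup.one_lt_card_iff_ne_bot]
    rintro rfl
    have : ent μ (fun x => (QuotientAddGroup.mk' (⊥ : AddSubgroup G) (X x))) = ent μ X := by
      refine ent_congr fun w w' _ _ => ?_
      simp only [QuotientAddGroup.mk'_apply]
      rw [QuotientAddGroup.eq, AddSubgroup.mem_bot, neg_add_eq_zero]
    rw [this] at a
    linarith
  have hQ : 0 < Nat.card (G ⧸ H) := Nat.card_pos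
  have hlt : Nat.card (G ⧸ H) < n := by
    rw [← hn, hcard]; nlinarith
  obtain ⟨Q, i1, i2, f, hf, e1, e2⟩ := ih _ hlt (G ⧸ H) rfl (by
    intro x
    obtain ⟨y, rfl⟩ := QuotientAddGroup.mk'_surjective H x
    rw [← map_add, h2, map_zero]) (fun x => (QuotientAddGroup.mk' H (X x)))
      (fun x => (QuotientAddGroup.mk' H (Y x)))
  refine ⟨Q, i1, i2, f.comp (QuotientAddGroup.mk' H), hf.comp (QuotientAddGroup.mk'_surjective H), ?_, e2⟩
  have hl : log (Nat.card G) = log (Nat.card (G ⧸ H)) + log (Nat.card H) := by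
    rw [hcard, Nat.cast_mul, log_mul]
    · exact_mod_cast hQ.ne'
    · positivity
  simp only [AddMonoidHom.comp_apply]
  linarith

end WPFR

namespace WPFR
open Finset Real

theorem tf_bound {G Q Ω Ω' : Type} [AddCommGroup G] [AddCommGroup Q] [Fintype Ω] [Fintype Ω']
    (ht : ∀ x y : G, x + x = y + y → x = y) (φ : G →+ Q) (hq : ∀ q : Q, q + q = 0) {μ : Ω → ℝ}
    {ν : Ω' → ℝ} (hμ : IsP μ) (hν : IsP ν) (X : Ω → G) (Y : Ω' → G) :
    ent μ (fun a => φ (X a)) ≤ 10 * ds μ X ν Y := by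
  have hP := hμ.prd (hν.prd hν)
  set P := prd μ (prd ν ν) with hPd
  have s := submod hP (fun w => (X w.1, Y w.2.1))
    (fun w => (X w.1 - Y w.2.1 - Y w.2.2, Y w.2.1 - Y w.2.2))
    (fun w => X w.1 - (Y w.2.1 + Y w.2.1)) (fun w => (X w.1, (Y w.2.1, Y w.2.2)))
    (by
      intro w w' _ _ h
      simp only [Prod.mk.injEq] at h
      rw [h.1, h.2])
    (by
      intro w w' _ _ h
      simp only [Prod.mk.injEq] at h
      have e : ∀ w : Ω × Ω' × Ω', X w.1 - (Y w.2.1 + Y w.2.1) =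
        (X w.1 - Y w.2.1 - Y w.2.2) - (Y w.2.1 - Y w.2.2) := fun w => by abel
      rw [e w, e w', h.1, h.2])
    (by
      intro w w' _ _ h h'
      simp only [Prod.mk.injEq] at h h' ⊢
      refine ⟨h.1, h.2, ?_⟩
      have := h'.2
      rw [h.2] at this
      exact sub_right_injective this)
  have m1 : MP P (prd μ ν) (fun w => (w.1, w.2.1)) := (MP.id μ).map (MP.fst ν hν)
  have e1 : ent P (fun w => (X w.1, (Y w.2.1, Y w.2.2))) = ent μ X + (ent ν Y + ent ν Y) := by
    rw [← ent_prd hν hν, ← ent_prd hμ (hν.prd hν)]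
  have e2 : ent P (fun w => (X w.1, Y w.2.1)) = ent μ X + ent ν Y := by
    rw [← ent_prd hμ hν]; exact ent_mp m1 (fun w => (X w.1, Y w.2))
  have e3 : ent P (fun w => X w.1 - (Y w.2.1 + Y w.2.1)) =
      ent (prd μ ν) (fun w => X w.1 - (Y w.2 + Y w.2)) :=
    ent_mp m1 (fun w => X w.1 - (Y w.2 + Y w.2))
  have e4 := subadd hP (fun w => X w.1 - Y w.2.1 - Y w.2.2) (fun w => Y w.2.1 - Y w.2.2)
  have e5 : ent P (fun w => Y w.2.1 - Y w.2.2) = ent (prd ν ν) (fun w => Y w.1 - Y w.2) :=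
    ent_snd (prd ν ν) hμ (fun w => Y w.1 - Y w.2)
  have k := kv hν hμ hν (fun b => - Y b) X (fun b => - Y b)
  let eq : Ω × Ω' × Ω' ≃ Ω' × Ω × Ω' :=
    ⟨fun w => (w.2.1, (w.1, w.2.2)), fun w => (w.2.1, (w.1, w.2.2)), fun _ => rfl, fun _ => rfl⟩
  have m2 : MP P (prd ν (prd μ ν)) (fun w => (w.2.1, (w.1, w.2.2))) :=
    MP.equiv eq (fun w => by simp only [hPd, prd, eq, Equiv.coe_fn_mk]; ring)
  rw [← ent_mp m2, ← ent_mp (MP.swap μ ν)] at k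
  have f1 : (fun w : Ω × Ω' × Ω' => -Y w.2.1 + X w.1 + -Y w.2.2) =
    fun w => X w.1 - Y w.2.1 - Y w.2.2 := by funext w; abel
  have f2 : (fun w : Ω × Ω' => -Y w.2 + X w.1) = fun w => X w.1 - Y w.2 := by funext w; abel
  have f3 : (fun w : Ω × Ω' => X w.1 + -Y w.2) = fun w => X w.1 - Y w.2 := by funext w; abel
  simp only [f1, f2, f3] at k
  have hyy := ds_self_le hν hμ Y X
  rw [ds_symm ν μ] at hyy
  have hx := ent_right_le hμ hν X Y
  have h2Y : ent ν (fun b => Y b + Y b) = ent ν Y :=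
    ent_congr fun w w' _ _ => ⟨ht _ _, fun h => by rw [h]⟩
  have key : ds μ X ν (fun b => Y b + Y b) ≤ 5 * ds μ X ν Y := by
    unfold ds at hyy hx ⊢
    rw [h2Y]
    linarith
  have := ds_proj hμ hν X (fun b => Y b + Y b) (fun a => φ (X a)) (fun a b h => by rw [h])
    (by
      intro a b a' b' _ _ _ _ h
      have := congrArg φ h
      simpa [hq] using this)
  linarith

end WPFR

namespace WPFR
open Finset Real

theorem exists_supp {Ω : Type} [Fintype Ω] {p : Ω → ℝ} (hp : IsP p) : ∃ x, p x ≠ 0 := by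
  by_contra! hc
  have := hp.one
  simp [hc] at this

theorem exists_le_avg {Ω : Type} [Fintype Ω] {p : Ω → ℝ} (hp : IsP p) (F : Ω → ℝ) (c : ℝ)
    (h : ∑ w, p w * F w ≤ c) : ∃ w, p w ≠ 0 ∧ F w ≤ c := by
  by_contra! hc
  obtain ⟨x, hx⟩ := exists_supp hp
  have h1 : ∑ w, p w * c < ∑ w, p w * F w := by
    refine Finset.sum_lt_sum (fun w _ => ?_) ⟨x, Finset.mem_univ x, ?_⟩
    · by_cases hw : p w = 0
      · simp [hw]
      · exact mul_le_mul_of_nonneg_left (hc w hw).le (hp.nn w)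
    · exact mul_lt_mul_of_pos_left (hc x hx) (lt_of_le_of_ne (hp.nn x) (Ne.symm hx))
  rw [← Finset.sum_mul, hp.one, one_mul] at h1
  linarith

theorem cnd_supp {Ω S : Type} [Fintype Ω] {μ : Ω → ℝ} {Z : Ω → S} {z : S} {a : Ω}
    (h : cnd μ Z z a ≠ 0) : μ a ≠ 0 ∧ Z a = z := by
  unfold cnd at h
  split_ifs at h with h'
  · exact ⟨fun h0 => h (by simp [h0]), h'⟩
  · exact absurd rfl h

theorem ds_shift {D : ℕ} {Ω Ω' : Type} [Fintype Ω] [Fintype Ω'] {μ : Ω → ℝ} {ν : Ω' → ℝ}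
    {L : Submodule ℤ (Fin D → ℤ)} {X : Ω → Fin D → ℤ} {Y : Ω' → Fin D → ℤ} {X' : Ω → L} {Y' : Ω' → L}
    {c c' : Fin D → ℤ} (hX : ∀ a, μ a ≠ 0 → X a = X' a + c) (hY : ∀ a, ν a ≠ 0 → Y a = Y' a + c') :
    ds μ X ν Y = ds μ X' ν Y' := by
  have e1 : ent μ X = ent μ X' := ent_congr fun a b ha hb => by
    rw [hX a ha, hX b hb, add_left_inj, Subtype.ext_iff]
  have e2 : ent ν Y = ent ν Y' := ent_congr fun a b ha hb => by
    rw [hY a ha, hY b hb, add_left_inj, Subtype.ext_iff]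
  have e3 : ent (prd μ ν) (fun w => X w.1 - Y w.2) = ent (prd μ ν) (fun w => X' w.1 - Y' w.2) :=
    ent_congr fun a b ha hb => by
      rw [hX a.1 (left_ne_zero_of_mul ha), hX b.1 (left_ne_zero_of_mul hb),
        hY a.2 (right_ne_zero_of_mul ha), hY b.2 (right_ne_zero_of_mul hb),
        add_sub_add_comm, add_sub_add_comm, add_left_inj, Subtype.ext_iff]
      rfl
  unfold ds
  rw [e1, e2, e3]

theorem step {D : ℕ} {Ω Ω' : Type} [Fintype Ω] [Fintype Ω'] {μ : Ω → ℝ} {ν : Ω' → ℝ}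
    (hμ : IsP μ) (hν : IsP ν) (X : Ω → Fin D → ℤ) (Y : Ω' → Fin D → ℤ) :
    (∃ (r : ℕ) (v : Fin r → Fin D → ℤ), (∀ a b, μ a ≠ 0 → μ b ≠ 0 →
      X a - X b ∈ Submodule.span ℤ (Set.range v)) ∧ (r : ℝ) * log 2 ≤ 40 * ds μ X ν Y) ∨
    (∃ (Q : Type) (Z : Ω → Q) (Z' : Ω' → Q),
      ((∃ a b, μ a ≠ 0 ∧ μ b ≠ 0 ∧ Z a ≠ Z b) ∨ (∃ a b, ν a ≠ 0 ∧ ν b ≠ 0 ∧ Z' a ≠ Z' b)) ∧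
      300 * ∑ w, prd μ ν w * ds (cnd μ Z (Z w.1)) X (cnd ν Z' (Z' w.2)) Y + (ent μ Z + ent ν Z') ≤
        300 * ds μ X ν Y) := by
  classical
  obtain ⟨a0, ha0⟩ := exists_supp hμ
  obtain ⟨b0, hb0⟩ := exists_supp hν
  set T : Set (Fin D → ℤ) := {x | ∃ a, μ a ≠ 0 ∧ X a - X a0 = x} ∪ {x | ∃ a, ν a ≠ 0 ∧ Y a - Y b0 = x}
    with hT
  set L := Submodule.span ℤ T with hL
  have hXL : ∀ a, μ a ≠ 0 → X a - X a0 ∈ L := fun a ha =>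
    Submodule.subset_span (Or.inl ⟨a, ha, rfl⟩)
  have hYL : ∀ a, ν a ≠ 0 → Y a - Y b0 ∈ L := fun a ha =>
    Submodule.subset_span (Or.inr ⟨a, ha, rfl⟩)
  let X' : Ω → L := fun a => if h : μ a ≠ 0 then ⟨X a - X a0, hXL a h⟩ else 0
  let Y' : Ω' → L := fun a => if h : ν a ≠ 0 then ⟨Y a - Y b0, hYL a h⟩ else 0
  have hX' : ∀ a, μ a ≠ 0 → (X' a : Fin D → ℤ) = X a - X a0 := fun a h => by simp [X', h]
  have hY' : ∀ a, ν a ≠ 0 → (Y' a : Fin D → ℤ) = Y a - Y b0 := fun a h => by simp [Y', h]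
  have hX2 : ∀ a, μ a ≠ 0 → X a = X' a + X a0 := fun a h => by rw [hX' a h, sub_add_cancel]
  have hY2 : ∀ a, ν a ≠ 0 → Y a = Y' a + Y b0 := fun a h => by rw [hY' a h, sub_add_cancel]
  have hds : ds μ X ν Y = ds μ X' ν Y' := ds_shift hX2 hY2
  let r := Module.finrank ℤ L
  let b : Module.Basis (Fin r) ℤ L := Module.finBasis ℤ L
  let φ0 : (Fin r → ℤ) →+ (Fin r → ZMod 2) :=
    { toFun := fun x i => (x i : ZMod 2)
      map_zero' := by funext i; simp
      map_add' := fun x y => by funext i; simp }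
  let φ : L →+ (Fin r → ZMod 2) := φ0.comp b.equivFun.toLinearMap.toAddMonoidHom
  have hφ : Function.Surjective φ := by
    refine Function.Surjective.comp (g := φ0) ?_ b.equivFun.surjective
    intro y
    choose x hx using fun i => ZMod.intCast_surjective (y i)
    exact ⟨x, funext hx⟩
  have h2 : ∀ x : Fin r → ZMod 2, x + x = 0 := fun x => by
    funext i; exact CharTwo.add_self_eq_zero (x i)
  have htf : ∀ x y : L, x + x = y + y → x = y := fun x y h => by
    apply Subtype.ext
    funext i
    have := congrFun (congrArg Subtype.val h) i
    simp only [Submodule.coe_add, Pi.add_apply] at this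
    omega
  have t1 := tf_bound htf φ h2 hμ hν X' Y'
  have t2 := tf_bound htf φ h2 hν hμ Y' X'
  rw [ds_symm ν μ] at t2
  obtain ⟨Q, iQ, iF, f, hf, f1, f2⟩ := iter hμ hν _ (Fin r → ZMod 2) rfl h2 (fun a => φ (X' a))
    (fun a => φ (Y' a))
  let ψ : L →+ Q := f.comp φ
  have hψ : Function.Surjective ψ := hf.comp hφ
  by_cases hc : (∃ a b, μ a ≠ 0 ∧ μ b ≠ 0 ∧ ψ (X' a) ≠ ψ (X' b)) ∨
      (∃ a b, ν a ≠ 0 ∧ ν b ≠ 0 ∧ ψ (Y' a) ≠ ψ (Y' b))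
  · right
    refine ⟨Q, fun a => ψ (X' a), fun a => ψ (Y' a), hc, ?_⟩
    have hfib := fibring hμ hν X' Y' ψ
    have hs : ∀ w : Ω × Ω', ds (cnd μ (fun a => ψ (X' a)) (ψ (X' w.1))) X
        (cnd ν (fun a => ψ (Y' a)) (ψ (Y' w.2))) Y = ds (cnd μ (fun a => ψ (X' a)) (ψ (X' w.1))) X'
        (cnd ν (fun a => ψ (Y' a)) (ψ (Y' w.2))) Y' := fun w =>
      ds_shift (fun a h => hX2 a (cnd_supp h).1) (fun a h => hY2 a (cnd_supp h).1)
    simp only [hs, hds]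
    change ent μ (fun a => ψ (X' a)) + ent ν (fun a => ψ (Y' a)) ≤
      300 * ds μ (fun a => ψ (X' a)) ν (fun a => ψ (Y' a)) at f2
    linarith
  · left
    push Not at hc
    obtain ⟨hc1, hc2⟩ := hc
    refine ⟨r, fun i => (b i : Fin D → ℤ), ?_, ?_⟩
    · intro x y hx hy
      have hm : X x - X y ∈ L := by
        have := L.sub_mem (hXL x hx) (hXL y hy)
        rwa [sub_sub_sub_cancel_right] at this
      have h3 := Submodule.mem_map_of_mem (f := L.subtype) (b.mem_span ⟨_, hm⟩)
      rw [Submodule.map_span, ← Set.range_comp] at h3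
      exact h3
    · have hX0 : X' a0 = 0 := Subtype.ext (by rw [hX' a0 ha0, sub_self]; rfl)
      have hY0 : Y' b0 = 0 := Subtype.ext (by rw [hY' b0 hb0, sub_self]; rfl)
      have hle : L ≤ (LinearMap.ker ψ.toIntLinearMap).map L.subtype := by
        refine Submodule.span_le.2 ?_
        rintro x (⟨a, ha, rfl⟩ | ⟨a, ha, rfl⟩)
        · refine ⟨X' a, ?_, hX' a ha⟩
          have := hc1 a a0 ha ha0
          rw [hX0, map_zero] at this
          exact this
        · refine ⟨Y' a, ?_, hY' a ha⟩
          have := hc2 a b0 ha hb0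
          rw [hY0, map_zero] at this
          exact this
      have hz : ∀ q : Q, q = 0 := fun q => by
        obtain ⟨l, rfl⟩ := hψ q
        obtain ⟨k, hk, hkl⟩ := hle l.2
        have : k = l := Subtype.ext hkl
        rw [← this]; exact hk
      have hQ : Nat.card Q = 1 := by
        rw [Nat.card_eq_one_iff_unique]
        exact ⟨⟨fun a b => by rw [hz a, hz b]⟩, ⟨0⟩⟩
      have n1 := ent_nonneg hμ (fun a => f (φ (X' a)))
      have n2 := ent_nonneg hν (fun a => f (φ (Y' a)))
      rw [hQ, Nat.cast_one, log_one] at f1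
      have hG : log (Nat.card (Fin r → ZMod 2)) = r * log 2 := by
        simp [Nat.card_eq_fintype_card, ZMod.card]
      rw [hG] at f1
      rw [hds]
      linarith

theorem main_ind {D : ℕ} {Ω Ω' : Type} [Fintype Ω] [Fintype Ω']
    (X : Ω → Fin D → ℤ) (Y : Ω' → Fin D → ℤ) (n : ℕ) : ∀ (μ : Ω → ℝ) (ν : Ω' → ℝ),
    IsP μ → IsP ν → Nat.card {a // μ a ≠ 0} + Nat.card {a // ν a ≠ 0} = n →
    ∃ E : Finset Ω, 0 < ∑ a ∈ E, μ a ∧ -log (∑ a ∈ E, μ a) ≤ 300 * ds μ X ν Y ∧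
      ∃ (r : ℕ) (v : Fin r → Fin D → ℤ), (∀ a ∈ E, ∀ b ∈ E,
        X a - X b ∈ Submodule.span ℤ (Set.range v)) ∧ (r : ℝ) * log 2 ≤ 40 * ds μ X ν Y := by
  classical
  induction n using Nat.strong_induction_on with
  | _ n ih =>
  intro μ ν hμ hν hn
  rcases step hμ hν X Y with ⟨r, v, h1, h2⟩ | ⟨Q, Z, Z', h1, h2⟩
  · have hone : ∑ a ∈ Finset.univ.filter (fun a => μ a ≠ 0), μ a = 1 := by
      rw [Finset.sum_filter_ne_zero, hμ.one]
    refine ⟨Finset.univ.filter (fun a => μ a ≠ 0), ?_, ?_, r, v, ?_, h2⟩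
    · rw [hone]; norm_num
    · rw [hone, log_one, neg_zero]; have := ds_nonneg hμ hν X Y; positivity
    · intro a ha b hb
      exact h1 a b (Finset.mem_filter.1 ha).2 (Finset.mem_filter.1 hb).2
  · have g1 := MP.fst μ hν (fun a => log (pr μ Z (Z a)))
    have g2 := MP.snd hμ ν (fun a => log (pr ν Z' (Z' a)))
    have g : ∑ w, prd μ ν w * (300 * ds (cnd μ Z (Z w.1)) X (cnd ν Z' (Z' w.2)) Y
        - log (pr μ Z (Z w.1)) - log (pr ν Z' (Z' w.2))) ≤ 300 * ds μ X ν Y := by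
      simp only [mul_sub, Finset.sum_sub_distrib, mul_left_comm _ (300 : ℝ), ← Finset.mul_sum]
      rw [g1, g2]
      unfold ent at h2
      linarith
    obtain ⟨w, hw, hF⟩ := exists_le_avg (hμ.prd hν) _ _ g
    have hw1 : μ w.1 ≠ 0 := left_ne_zero_of_mul hw
    have hw2 : ν w.2 ≠ 0 := right_ne_zero_of_mul hw
    have p1 := pr_pos hμ Z hw1
    have p2 := pr_pos hν Z' hw2
    have q1 := log_nonpos p1.le (pr_le_one hμ Z (Z w.1))
    have q2 := log_nonpos p2.le (pr_le_one hν Z' (Z' w.2))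
    have hc1 := cnd_isP hμ Z p1.ne'
    have hc2 := cnd_isP hν Z' p2.ne'
    have hlt : Nat.card {a // cnd μ Z (Z w.1) a ≠ 0} + Nat.card {a // cnd ν Z' (Z' w.2) a ≠ 0} < n := by
      rw [← hn]
      simp only [Nat.card_eq_fintype_card, Fintype.card_subtype]
      have s1 : Finset.univ.filter (fun a => cnd μ Z (Z w.1) a ≠ 0) ⊆
          Finset.univ.filter (fun a => μ a ≠ 0) := fun a ha => by
        simp only [Finset.mem_filter, Finset.mem_univ, true_and] at ha ⊢
        exact (cnd_supp ha).1
      have s2 : Finset.univ.filter (fun a => cnd ν Z' (Z' w.2) a ≠ 0) ⊆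
          Finset.univ.filter (fun a => ν a ≠ 0) := fun a ha => by
        simp only [Finset.mem_filter, Finset.mem_univ, true_and] at ha ⊢
        exact (cnd_supp ha).1
      rcases h1 with ⟨a, b, ha, hb, hab⟩ | ⟨a, b, ha, hb, hab⟩
      · refine add_lt_add_of_lt_of_le (Finset.card_lt_card ?_) (Finset.card_le_card s2)
        refine s1.ssubset_of_ne fun he => hab ?_
        have k : ∀ a, μ a ≠ 0 → Z a = Z w.1 := fun a ha => by
          have : a ∈ Finset.univ.filter (fun a => μ a ≠ 0) := by simp [ha]
          rw [← he] at this
          exact (cnd_supp (Finset.mem_filter.1 this).2).2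
        rw [k a ha, k b hb]
      · refine add_lt_add_of_le_of_lt (Finset.card_le_card s1) (Finset.card_lt_card ?_)
        refine s2.ssubset_of_ne fun he => hab ?_
        have k : ∀ a, ν a ≠ 0 → Z' a = Z' w.2 := fun a ha => by
          have : a ∈ Finset.univ.filter (fun a => ν a ≠ 0) := by simp [ha]
          rw [← he] at this
          exact (cnd_supp (Finset.mem_filter.1 this).2).2
        rw [k a ha, k b hb]
    obtain ⟨E, e0, e1, r, v, e2, e3⟩ := ih _ hlt _ _ hc1 hc2 rfl
    have hE : ∑ a ∈ E.filter (fun a => Z a = Z w.1), μ a =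
        pr μ Z (Z w.1) * ∑ a ∈ E, cnd μ Z (Z w.1) a := by
      rw [Finset.sum_filter, Finset.mul_sum]
      refine Finset.sum_congr rfl fun a _ => ?_
      unfold cnd
      split_ifs
      · rw [mul_div_cancel₀ _ p1.ne']
      · rw [mul_zero]
    refine ⟨E.filter (fun a => Z a = Z w.1), ?_, ?_, r, v, ?_, ?_⟩
    · rw [hE]; positivity
    · rw [hE, log_mul p1.ne' e0.ne']; linarith
    · intro a ha b hb
      exact e2 a (Finset.mem_filter.1 ha).1 b (Finset.mem_filter.1 hb).1
    · linarith

end WPFR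

namespace WPFR
open Finset Real

theorem ent_le_log {Ω S : Type} [Fintype Ω] [Fintype S] {μ : Ω → ℝ} (hμ : IsP μ) (F : Ω → S) :
    ent μ F ≤ log (Fintype.card S) := by
  obtain ⟨a, _⟩ := exists_supp hμ
  have : Nonempty S := ⟨F a⟩
  have hn : (0 : ℝ) < Fintype.card S := by exact_mod_cast Fintype.card_pos
  have h := concaveOn_negMulLog.le_map_sum (t := (Finset.univ : Finset S))
    (w := fun _ => (Fintype.card S : ℝ)⁻¹) (p := fun s => pr μ F s) (fun _ _ => by positivity)
    (by simp [hn.ne']) (fun s _ => pr_nonneg hμ F s)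
  simp only [smul_eq_mul, ← Finset.mul_sum] at h
  rw [← ent_eq_sum] at h
  have h1 : ∑ s, pr μ F s = 1 := (law_isP hμ F).one
  rw [h1, mul_one, negMulLog, log_inv] at h
  have h2 : (Fintype.card S : ℝ)⁻¹ * ent μ F ≤ (Fintype.card S : ℝ)⁻¹ * log (Fintype.card S) := by
    linarith
  exact le_of_mul_le_mul_left h2 (by positivity)

theorem exists_set {D : ℕ} (A : Finset (Fin D → ℤ)) (hA : A.Nonempty) (K : ℝ) (hK : 1 ≤ K)
    (h : ((A + A).card : ℝ) ≤ K * A.card) : ∃ A' ⊆ A, K ^ (-600 / 2 : ℝ) * A.card ≤ (A'.card : ℝ) ∧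
      ∃ (r : ℕ) (v : Fin r → Fin D → ℤ), (∀ a ∈ A', ∀ b ∈ A',
        a - b ∈ Submodule.span ℤ (Set.range v)) ∧ (r : ℝ) * log 2 ≤ 40 * log K := by
  classical
  have hn : (0 : ℝ) < A.card := by exact_mod_cast hA.card_pos
  have hK0 : 0 < K := by linarith
  let μ : A → ℝ := fun _ => (A.card : ℝ)⁻¹
  have hμ : IsP μ := ⟨fun _ => by positivity, by simp [μ, hn.ne']⟩
  let X : A → Fin D → ℤ := fun a => a.1
  let Y : A → Fin D → ℤ := fun a => -a.1
  have hX : ent μ X = log A.card := by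
    have : ∀ a : A, pr μ X (X a) = (A.card : ℝ)⁻¹ := fun a => by
      simp only [pr, X, Subtype.val_inj, Finset.sum_ite_eq', Finset.mem_univ, if_true, μ]
    simp only [ent, this]
    rw [← Finset.sum_mul, hμ.one, log_inv]; ring
  have hY : ent μ Y = log A.card := by
    rw [← hX]
    exact ent_congr fun a b _ _ => neg_inj
  have hD : ds μ X μ Y ≤ log K := by
    let F : A × A → (A + A : Finset (Fin D → ℤ)) := fun w => ⟨w.1.1 + w.2.1, Finset.add_mem_add w.1.2 w.2.2⟩
    have e1 : ent (prd μ μ) (fun w => X w.1 - Y w.2) = ent (prd μ μ) F :=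
      ent_congr fun a b _ _ => by simp only [X, Y, F, sub_neg_eq_add, Subtype.mk.injEq]
    have e2 := ent_le_log (hμ.prd hμ) F
    rw [Fintype.card_coe] at e2
    have hpos : (0 : ℝ) < (A + A).card := by exact_mod_cast (hA.add hA).card_pos
    have e3 := log_le_log hpos h
    rw [log_mul hK0.ne' hn.ne'] at e3
    unfold ds
    rw [e1, hX, hY]
    linarith
  obtain ⟨E, h0, h1, r, v, h2, h3⟩ := main_ind X Y _ μ μ hμ hμ rfl
  refine ⟨E.map (Function.Embedding.subtype _), ?_, ?_, r, v, ?_, by linarith⟩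
  · intro x hx
    obtain ⟨a, _, rfl⟩ := Finset.mem_map.1 hx
    exact a.2
  · rw [Finset.card_map]
    have hs : ∑ a ∈ E, μ a = E.card / A.card := by simp [μ, div_eq_mul_inv]
    rw [hs] at h0 h1
    rw [← le_div_iff₀ hn, rpow_def_of_pos hK0, ← le_log_iff_exp_le h0]
    linarith
  · intro a ha b hb
    obtain ⟨a, ha', rfl⟩ := Finset.mem_map.1 ha
    obtain ⟨b, hb', rfl⟩ := Finset.mem_map.1 hb
    exact h2 a ha' b hb'

theorem dim_le {D r : ℕ} (A' : Set (Fin D → ℤ)) (v : Fin r → Fin D → ℤ)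
    (h : ∀ a ∈ A', ∀ b ∈ A', a - b ∈ Submodule.span ℤ (Set.range v)) :
    Module.finrank ℚ (affineSpan ℚ ((fun (v : Fin D → ℤ) (i : Fin D) => (v i : ℚ)) '' A')).direction
      ≤ r := by
  let c : (Fin D → ℤ) →ₗ[ℤ] (Fin D → ℚ) :=
    { toFun := fun v i => (v i : ℚ)
      map_add' := fun x y => by funext i; simp
      map_smul' := fun x y => by funext i; simp }
  have hle : (affineSpan ℚ ((fun (v : Fin D → ℤ) (i : Fin D) => (v i : ℚ)) '' A')).direction ≤
      Submodule.span ℚ (Set.range fun i => c (v i)) := by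
    rw [direction_affineSpan, vectorSpan_def, Submodule.span_le]
    rintro x ⟨_, ⟨a, ha, rfl⟩, _, ⟨b, hb, rfl⟩, rfl⟩
    have h1 := Submodule.mem_map_of_mem (f := c) (h a ha b hb)
    rw [Submodule.map_span, ← Set.range_comp] at h1
    have h2 := Submodule.span_subset_span ℤ ℚ _ h1
    rw [map_sub] at h2
    exact h2
  refine (Submodule.finrank_mono hle).trans ?_
  have := finrank_range_le_card (R := ℚ) (fun i => c (v i))
  simpa [Set.finrank] using this

end WPFR

/-- **Weak polynomial Freiman–Ruzsa over the integers.** There are absolute constants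
`C₁, C₂ > 0` such that: for every positive integer `D` and every finite `A ⊆ ℤ^D` with
`|A + A| ≤ K|A|` (`K ≥ 1`), there is `A' ⊆ A` with `|A'| ≥ K^(-C₁/2) |A|` whose affine
span over `ℚ` has dimension at most `C₂ log K`. -/
theorem weak_pfr_over_Z :
    ∃ C₁ C₂ : ℝ, 0 < C₁ ∧ 0 < C₂ ∧
      ∀ (D : ℕ), 0 < D → ∀ (A : Finset (Fin D → ℤ)) (K : ℝ), 1 ≤ K →
        ((A + A).card : ℝ) ≤ K * A.card →
        ∃ A' : Finset (Fin D → ℤ), A' ⊆ A ∧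
          K ^ (-C₁ / 2) * A.card ≤ (A'.card : ℝ) ∧
          (Module.finrank ℚ
              (affineSpan ℚ ((fun (v : Fin D → ℤ) (i : Fin D) => (v i : ℚ)) ''
                (A' : Set (Fin D → ℤ)))).direction : ℝ) ≤ C₂ * Real.log K := by
  have hl2 : 0 < Real.log 2 := Real.log_pos (by norm_num)
  refine ⟨600, 40 / Real.log 2, by norm_num, by positivity, ?_⟩
  intro D _ A K hK h
  rcases A.eq_empty_or_nonempty with rfl | hA
  · refine ⟨∅, le_refl _, by simp, ?_⟩
    have h0 := WPFR.dim_le (D := D) (r := 0) ((∅ : Finset (Fin D → ℤ)) : Set (Fin D → ℤ)) Fin.elim0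
      (by simp)
    have hK' := Real.log_nonneg hK
    rw [Nat.le_zero.1 h0, Nat.cast_zero]
    positivity
  · obtain ⟨A', h1, h2, r, v, h3, h4⟩ := WPFR.exists_set A hA K hK h
    refine ⟨A', h1, h2, ?_⟩
    have h5 := WPFR.dim_le (A' : Set (Fin D → ℤ)) v (fun a ha b hb => h3 a ha b hb)
    have h6 : (r : ℝ) ≤ 40 / Real.log 2 * Real.log K := by
      rw [div_mul_eq_mul_div, le_div_iff₀ hl2]; exact h4
    exact le_trans (by exact_mod_cast h5) h6
end

section
/- There is an absolute constant C_3 with the following property: if f : F_2^m → F_2^n is a function such that the set {f(x) + f(y) − f(x+y) : x, y ∈ F_2^m} has cardinality at most K, then f can be written as f = g + h, where g : F_2^m → F_2^n is a group homomorphism (linear map) and the range of h is a set of cardinality at most O(K^{C_3}). -/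
open Finset

namespace PFRx

set_option linter.unusedSectionVars false

/-- Probability mass function. -/
def Pm {Ω : Type*} [Fintype Ω] (p : Ω → ℝ) : Prop := (∀ x, 0 ≤ p x) ∧ ∑ x, p x = 1

open Classical in
/-- Push-forward. -/
noncomputable def law {Ω S : Type*} [Fintype Ω] (μ : Ω → ℝ) (X : Ω → S) (s : S) : ℝ :=
  ∑ ω, if X ω = s then μ ω else 0

/-- Entropy of a mass function. -/
noncomputable def ent {S : Type*} [Fintype S] (p : S → ℝ) : ℝ := ∑ s, Real.negMulLog (p s)

/-- Entropy of a random variable. -/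
noncomputable def H {Ω S : Type*} [Fintype Ω] [Fintype S] (μ : Ω → ℝ) (X : Ω → S) : ℝ :=
  ent (law μ X)

/-- Product mass function. -/
def tens {Ω S : Type*} (p : Ω → ℝ) (q : S → ℝ) (x : Ω × S) : ℝ := p x.1 * q x.2

section basics
variable {Ω Ω' S T R : Type*} [Fintype Ω] [Fintype Ω'] [Fintype S] [Fintype T] [Fintype R]

lemma law_sum (μ : Ω → ℝ) (X : Ω → S) (F : S → ℝ) :
    ∑ s, law μ X s * F s = ∑ ω, μ ω * F (X ω) := by
  classical
  simp only [law, Finset.sum_mul]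
  rw [Finset.sum_comm]
  refine Finset.sum_congr rfl fun ω _ => ?_
  simp [ite_mul]

lemma law_nonneg {μ : Ω → ℝ} (h : ∀ x, 0 ≤ μ x) (X : Ω → S) (s : S) : 0 ≤ law μ X s := by
  classical
  unfold law
  exact Finset.sum_nonneg fun ω _ => by split_ifs <;> simp [h]

lemma law_pm {μ : Ω → ℝ} (h : Pm μ) (X : Ω → S) : Pm (law μ X) := by
  refine ⟨law_nonneg h.1 X, ?_⟩
  have := law_sum μ X (fun _ => 1)
  simpa [h.2] using this

lemma law_ext {p q : S → ℝ} (h : ∀ F : S → ℝ, ∑ s, p s * F s = ∑ s, q s * F s) : p = q := by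
  classical
  funext s
  have := h (fun t => if t = s then 1 else 0)
  simpa using this

lemma law_comp (μ : Ω → ℝ) (X : Ω → S) (f : S → T) :
    law (law μ X) f = law μ (fun ω => f (X ω)) := by
  apply law_ext
  intro F
  rw [law_sum, law_sum μ X (fun s => F (f s)), law_sum]

lemma law_id (μ : Ω → ℝ) : law μ (fun x => x) = μ := by
  apply law_ext
  intro F
  rw [law_sum]

lemma law_le {μ : Ω → ℝ} (h : ∀ x, 0 ≤ μ x) (X : Ω → S) (ω : Ω) : μ ω ≤ law μ X (X ω) := by
  classical
  unfold law
  have := Finset.single_le_sum (f := fun ω' => if X ω' = X ω then μ ω' else 0)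
    (fun i _ => by split_ifs <;> simp [h]) (Finset.mem_univ ω)
  simpa using this

lemma H_eq (μ : Ω → ℝ) (X : Ω → S) : H μ X = - ∑ ω, μ ω * Real.log (law μ X (X ω)) := by
  rw [← law_sum μ X (fun s => Real.log (law μ X s))]
  simp [H, ent, Real.negMulLog, Finset.sum_neg_distrib]

lemma H_comp_law (μ : Ω → ℝ) (X : Ω → S) (f : S → T) :
    H (law μ X) f = H μ (fun ω => f (X ω)) := by
  simp only [H, law_comp]

lemma ent_law_le {p : S → ℝ} (h : ∀ x, 0 ≤ p x) (f : S → T) : ent (law p f) ≤ ent p := by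
  have h1 := H_eq p f
  have h2 := H_eq p (fun x => x)
  rw [H, law_id] at h2
  change H p f ≤ _
  rw [h1, h2]
  apply neg_le_neg
  apply Finset.sum_le_sum
  intro s _
  rcases (h s).eq_or_lt with h0 | h0
  · simp [← h0]
  · exact mul_le_mul_of_nonneg_left (Real.log_le_log h0 (law_le h f s)) (h s)

lemma H_le {μ : Ω → ℝ} (h : ∀ x, 0 ≤ μ x) (X : Ω → S) (Y : Ω → T) (f : S → T)
    (hf : ∀ ω, f (X ω) = Y ω) : H μ Y ≤ H μ X := by
  have : Y = fun ω => f (X ω) := by funext ω; rw [hf]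
  rw [this, ← H_comp_law]
  exact ent_law_le (law_nonneg h X) f

lemma H_congr {μ : Ω → ℝ} (h : ∀ x, 0 ≤ μ x) (X : Ω → S) (Y : Ω → T) (f : S → T) (g : T → S)
    (hf : ∀ ω, f (X ω) = Y ω) (hg : ∀ ω, g (Y ω) = X ω) : H μ X = H μ Y :=
  le_antisymm (H_le h Y X g hg) (H_le h X Y f hf)

lemma law_equiv {μ : Ω → ℝ} {ν : Ω' → ℝ} (e : Ω ≃ Ω') (he : ∀ ω, ν (e ω) = μ ω) (X : Ω' → S) :
    law μ (fun ω => X (e ω)) = law ν X := by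
  apply law_ext
  intro F
  rw [law_sum, law_sum, ← Equiv.sum_comp e]
  simp [he]

lemma H_equiv {μ : Ω → ℝ} {ν : Ω' → ℝ} (e : Ω ≃ Ω') (he : ∀ ω, ν (e ω) = μ ω) (X : Ω' → S) :
    H μ (fun ω => X (e ω)) = H ν X := by
  rw [H, H, law_equiv e he]

lemma tens_pm {p : Ω → ℝ} {q : S → ℝ} (hp : Pm p) (hq : Pm q) : Pm (tens p q) := by
  refine ⟨fun x => mul_nonneg (hp.1 _) (hq.1 _), ?_⟩
  simp only [tens]
  rw [Fintype.sum_prod_type]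
  simp [← Finset.mul_sum, hp.2, hq.2]

lemma law_tens (p : Ω → ℝ) (q : Ω' → ℝ) (X : Ω → S) (Y : Ω' → T) :
    law (tens p q) (fun ω => (X ω.1, Y ω.2)) = tens (law p X) (law q Y) := by
  apply law_ext
  intro F
  rw [law_sum, Fintype.sum_prod_type, Fintype.sum_prod_type]
  simp only [tens, mul_assoc, ← Finset.mul_sum]
  rw [law_sum p X (fun s => ∑ t, law q Y t * F (s, t))]
  refine Finset.sum_congr rfl fun x _ => ?_
  rw [law_sum q Y (fun t => F (X x, t))]

lemma law_tens_fst (p : Ω → ℝ) {q : Ω' → ℝ} (hq : Pm q) (X : Ω → S) :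
    law (tens p q) (fun ω => X ω.1) = law p X := by
  apply law_ext
  intro F
  rw [law_sum, law_sum, Fintype.sum_prod_type]
  refine Finset.sum_congr rfl fun x _ => ?_
  simp only [tens]
  rw [← Finset.sum_mul, ← Finset.mul_sum, hq.2, mul_one]

lemma law_tens_snd {p : Ω → ℝ} (q : Ω' → ℝ) (hp : Pm p) (X : Ω' → S) :
    law (tens p q) (fun ω => X ω.2) = law q X := by
  apply law_ext
  intro F
  rw [law_sum, law_sum, Fintype.sum_prod_type]
  simp [tens, mul_assoc, ← Finset.mul_sum, ← Finset.sum_mul, hp.2]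

/-- Chain rule. -/
lemma ent_chain (w : S → ℝ) (a : S → T → ℝ) (ha : ∀ s, Pm (a s)) :
    ent (fun x : S × T => w x.1 * a x.1 x.2) = ent w + ∑ s, w s * ent (a s) := by
  unfold ent
  rw [Fintype.sum_prod_type, ← Finset.sum_add_distrib]
  refine Finset.sum_congr rfl fun s _ => ?_
  simp only [Real.negMulLog_mul, Finset.sum_add_distrib, ← Finset.mul_sum, ← Finset.sum_mul,
    (ha s).2, one_mul]

lemma ent_tens (p : S → ℝ) (q : T → ℝ) (hp : Pm p) (hq : Pm q) :
    ent (tens p q) = ent p + ent q := by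
  have := ent_chain p (fun _ => q) (fun _ => hq)
  rw [← Finset.sum_mul, hp.2, one_mul] at this
  exact this

lemma H_tens {p : Ω → ℝ} {q : Ω' → ℝ} (hp : Pm p) (hq : Pm q) (X : Ω → S) (Y : Ω' → T) :
    H (tens p q) (fun ω => (X ω.1, Y ω.2)) = H p X + H q Y := by
  rw [H, law_tens, ent_tens _ _ (law_pm hp X) (law_pm hq Y)]; rfl

lemma law_fst (P : S × T → ℝ) (s : S) : law P Prod.fst s = ∑ t, P (s, t) := by
  classical
  unfold law
  rw [Fintype.sum_prod_type, Finset.sum_comm]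
  simp

lemma submod {μ : Ω → ℝ} (h : Pm μ) (X : Ω → S) (Y : Ω → T) (Z : Ω → R) :
    H μ (fun ω => (X ω, Y ω, Z ω)) + H μ Z ≤
      H μ (fun ω => (X ω, Z ω)) + H μ (fun ω => (Y ω, Z ω)) := by
  set A := law μ (fun ω => (X ω, Y ω, Z ω)) with hA
  set B := law μ Z with hB
  set C := law μ (fun ω => (X ω, Z ω)) with hC
  set D := law μ (fun ω => (Y ω, Z ω)) with hD
  have hB0 := law_nonneg h.1 Z
  have hC0 := law_nonneg h.1 (fun ω => (X ω, Z ω))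
  have hD0 := law_nonneg h.1 (fun ω => (Y ω, Z ω))
  have hA0 := law_nonneg h.1 (fun ω => (X ω, Y ω, Z ω))
  have hCs : ∀ r, ∑ s, C (s, r) = B r := by
    intro r
    have : B = law C Prod.snd := by rw [hC, law_comp]
    rw [this]
    classical
    unfold law
    rw [Fintype.sum_prod_type]
    simp
  have hDs : ∀ r, ∑ s, D (s, r) = B r := by
    intro r
    have : B = law D Prod.snd := by rw [hD, law_comp]
    rw [this]
    classical
    unfold law
    rw [Fintype.sum_prod_type]
    simp
  rw [H_eq, H_eq, H_eq, H_eq]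
  have key : ∀ ω, μ ω * (Real.log (C (X ω, Z ω)) + Real.log (D (Y ω, Z ω))
      - Real.log (A (X ω, Y ω, Z ω)) - Real.log (B (Z ω))) ≤
      μ ω * (C (X ω, Z ω) * D (Y ω, Z ω) / (A (X ω, Y ω, Z ω) * B (Z ω)) - 1) := by
    intro ω
    rcases (h.1 ω).eq_or_lt with h0 | h0
    · simp [← h0]
    have a := h0.trans_le (law_le h.1 (fun ω => (X ω, Y ω, Z ω)) ω)
    have b := h0.trans_le (law_le h.1 Z ω)
    have c := h0.trans_le (law_le h.1 (fun ω => (X ω, Z ω)) ω)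
    have d := h0.trans_le (law_le h.1 (fun ω => (Y ω, Z ω)) ω)
    rw [← hA] at a
    rw [← hB] at b
    rw [← hC] at c
    rw [← hD] at d
    apply mul_le_mul_of_nonneg_left _ h0.le
    have := Real.log_le_sub_one_of_pos (div_pos (mul_pos c d) (mul_pos a b))
    rw [Real.log_div (mul_pos c d).ne' (mul_pos a b).ne', Real.log_mul c.ne' d.ne',
      Real.log_mul a.ne' b.ne'] at this
    linarith
  have key2 : ∑ ω, μ ω * (C (X ω, Z ω) * D (Y ω, Z ω) / (A (X ω, Y ω, Z ω) * B (Z ω)) - 1) ≤ 0 := by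
    have e1 := law_sum μ (fun ω => (X ω, Y ω, Z ω))
      (fun x => C (x.1, x.2.2) * D (x.2.1, x.2.2) / (A x * B x.2.2))
    simp only [mul_sub, Finset.sum_sub_distrib, mul_one, h.2]
    rw [← e1, ← hA]
    have : ∑ x, A x * (C (x.1, x.2.2) * D (x.2.1, x.2.2) / (A x * B x.2.2)) ≤
        ∑ x : S × T × R, C (x.1, x.2.2) * D (x.2.1, x.2.2) / B x.2.2 := by
      apply Finset.sum_le_sum
      intro x _
      have nn : 0 ≤ C (x.1, x.2.2) * D (x.2.1, x.2.2) / B x.2.2 :=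
        div_nonneg (mul_nonneg (hC0 _) (hD0 _)) (hB0 _)
      by_cases hx : A x = 0
      · simpa [hx] using nn
      · apply le_of_eq
        rw [div_mul_eq_div_div, div_right_comm, mul_div_cancel₀ _ hx]
    have e2 : ∑ x : S × T × R, C (x.1, x.2.2) * D (x.2.1, x.2.2) / B x.2.2 = ∑ r, B r := by
      rw [Fintype.sum_prod_type]
      simp only [Fintype.sum_prod_type]
      rw [Finset.sum_congr rfl fun x _ => Finset.sum_comm, Finset.sum_comm]
      refine Finset.sum_congr rfl fun r _ => ?_
      simp only [← Finset.sum_div, ← Finset.mul_sum, ← Finset.sum_mul, hCs, hDs]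
      by_cases hr : B r = 0
      · simp [hr]
      · field_simp
    rw [e2, (law_pm h Z).2] at this
    linarith
  have := (Finset.sum_le_sum fun ω (_ : ω ∈ Finset.univ) => key ω).trans key2
  simp only [mul_sub, mul_add, Finset.sum_sub_distrib, Finset.sum_add_distrib] at this
  linarith

lemma subadd {μ : Ω → ℝ} (h : Pm μ) (X : Ω → S) (Y : Ω → T) :
    H μ (fun ω => (X ω, Y ω)) ≤ H μ X + H μ Y := by
  have h1 := submod h X Y (fun _ => ())
  have h2 : H μ (fun _ => ()) = 0 := by
    have := (law_pm h (fun _ => ())).2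
    simp only [Finset.univ_unique, PUnit.default_eq_unit, Finset.sum_singleton] at this
    simp [H, ent, this]
  rw [h2] at h1
  rw [H_congr h.1 (fun ω => (X ω, ())) X Prod.fst (fun x => (x, ())) (by simp) (by simp),
    H_congr h.1 (fun ω => (Y ω, ())) Y Prod.fst (fun x => (x, ())) (by simp) (by simp),
    H_congr h.1 (fun ω => (X ω, Y ω, ())) (fun ω => (X ω, Y ω)) (fun x => (x.1, x.2.1))
      (fun x => (x.1, x.2, ())) (by simp) (by simp)] at h1
  linarith

lemma exists_kernel [Nonempty T] (α : S × T → ℝ) (h : ∀ x, 0 ≤ α x) :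
    ∃ a : S → T → ℝ, (∀ s, Pm (a s)) ∧ ∀ s t, α (s, t) = law α Prod.fst s * a s t := by
  classical
  obtain ⟨t0⟩ := ‹Nonempty T›
  refine ⟨fun s t => if law α Prod.fst s = 0 then (if t = t0 then 1 else 0)
    else α (s, t) / law α Prod.fst s, fun s => ?_, fun s t => ?_⟩
  · by_cases hs : law α Prod.fst s = 0
    · simp only [hs, if_true]
      exact ⟨fun x => by dsimp only; split_ifs <;> simp, by simp⟩
    · simp only [hs, if_false]
      refine ⟨fun x => div_nonneg (h _) (law_nonneg h _ _), ?_⟩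
      rw [← Finset.sum_div, ← law_fst, div_self hs]
  · by_cases hs : law α Prod.fst s = 0
    · have := law_le h Prod.fst (s, t)
      simp only [hs, if_true, zero_mul]
      exact le_antisymm (this.trans hs.le) (h _)
    · simp only [hs, if_false]
      field_simp

end basics

section group
variable {G : Type*} [AddCommGroup G] [Fintype G]

/-- Convolution of mass functions. -/
noncomputable def conv (p q : G → ℝ) : G → ℝ := law (tens p q) (fun x => x.1 + x.2)

/-- Entropic Ruzsa distance (with plus sign). -/
noncomputable def dd (p q : G → ℝ) : ℝ := ent (conv p q) - (ent p + ent q) / 2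

variable {Ω Ω' I : Type*} [Fintype Ω] [Fintype Ω'] [Fintype I]

lemma conv_sum (p q : G → ℝ) (F : G → ℝ) :
    ∑ s, conv p q s * F s = ∑ x, p x * ∑ y, q y * F (x + y) := by
  unfold conv
  rw [law_sum, Fintype.sum_prod_type]
  simp only [tens, Finset.mul_sum, mul_assoc]

lemma conv_pm {p q : G → ℝ} (hp : Pm p) (hq : Pm q) : Pm (conv p q) :=
  law_pm (tens_pm hp hq) _

lemma law_tens_add (μ : Ω → ℝ) (ν : Ω' → ℝ) (X : Ω → G) (Y : Ω' → G) :
    law (tens μ ν) (fun ω => X ω.1 + Y ω.2) = conv (law μ X) (law ν Y) := by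
  unfold conv
  rw [← law_tens, law_comp]

lemma conv_comm (p q : G → ℝ) : conv p q = conv q p := by
  apply law_ext
  intro F
  rw [conv_sum, conv_sum]
  simp only [Finset.mul_sum]
  rw [Finset.sum_comm]
  refine Finset.sum_congr rfl fun x _ => Finset.sum_congr rfl fun y _ => ?_
  rw [add_comm x y]; ring

lemma conv_assoc (p q r : G → ℝ) : conv (conv p q) r = conv p (conv q r) := by
  apply law_ext
  intro F
  rw [conv_sum, conv_sum p q (fun x => ∑ y, r y * F (x + y)), conv_sum]
  refine Finset.sum_congr rfl fun x _ => ?_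
  rw [conv_sum q r (fun y => F (x + y))]
  simp only [add_assoc]

lemma ent_le_conv {p q : G → ℝ} (hp : Pm p) (hq : Pm q) : ent p ≤ ent (conv p q) := by
  have hT := tens_pm hp hq
  have h1 := subadd hT (fun x => x.1 + x.2) (fun x => x.2)
  have h2 : H (tens p q) (fun x => (x.1 + x.2, x.2)) = ent p + ent q := by
    rw [H_congr hT.1 (fun x => (x.1 + x.2, x.2)) (fun x => x) (fun y => (y.1 - y.2, y.2))
      (fun y => (y.1 + y.2, y.2)) (by simp) (by simp), H, law_id, ent_tens _ _ hp hq]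
  have h3 : H (tens p q) (fun x => x.2) = ent q := by
    rw [H, law_tens_snd q hp (fun x => x), law_id]
  rw [h2, h3] at h1
  change _ ≤ ent (conv p q) + _ at h1
  linarith

lemma ent_le_conv' {p q : G → ℝ} (hp : Pm p) (hq : Pm q) : ent q ≤ ent (conv p q) := by
  rw [conv_comm]; exact ent_le_conv hq hp

/-- Kaimanovich–Vershik. -/
lemma kv {p q r : G → ℝ} (hp : Pm p) (hq : Pm q) (hr : Pm r) :
    ent (conv (conv p q) r) + ent q ≤ ent (conv p q) + ent (conv q r) := by
  have hqr := tens_pm hq hr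
  have hT := tens_pm hp hqr
  have h1 := submod hT (fun x => x.1) (fun x => x.2.2) (fun x => x.1 + (x.2.1 + x.2.2))
  have e0 : H (tens p (tens q r)) (fun x => x.1 + (x.2.1 + x.2.2)) = ent (conv (conv p q) r) := by
    rw [conv_assoc, H, law_tens_add p (tens q r) (fun x => x) (fun x => x.1 + x.2), law_id]; rfl
  have e1 : H (tens p (tens q r)) (fun x => (x.1, x.1 + (x.2.1 + x.2.2))) =
      ent p + ent (conv q r) := by
    rw [H_congr hT.1 (fun x => (x.1, x.1 + (x.2.1 + x.2.2))) (fun x => (x.1, x.2.1 + x.2.2))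
      (fun y => (y.1, y.2 - y.1)) (fun y => (y.1, y.1 + y.2)) (by simp) (by simp),
      H_tens hp hqr (fun x => x) (fun x => x.1 + x.2), H, law_id]; rfl
  have e2 : H (tens p (tens q r)) (fun x => (x.2.2, x.1 + (x.2.1 + x.2.2))) =
      ent r + ent (conv p q) := by
    rw [H_congr hT.1 (fun x => (x.2.2, x.1 + (x.2.1 + x.2.2))) (fun x => (x.1 + x.2.1, x.2.2))
      (fun y => (y.2 - y.1, y.1)) (fun y => (y.2, y.1 + y.2))
      (by intro x; ext <;> simp; abel) (by intro x; ext <;> simp; abel)]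
    have := H_equiv (μ := tens p (tens q r)) (ν := tens (tens p q) r)
      (Equiv.prodAssoc G G G).symm (by intro x; simp [tens, mul_assoc])
      (fun x => (x.1.1 + x.1.2, x.2))
    simp only [Equiv.prodAssoc_symm_apply] at this
    rw [this, H_tens (tens_pm hp hq) hr (fun x => x.1 + x.2) (fun x => x), H, H, law_id,
      add_comm]; rfl
  have e3 : H (tens p (tens q r)) (fun x => (x.1, x.2.2, x.1 + (x.2.1 + x.2.2))) =
      ent p + (ent q + ent r) := by
    rw [H_congr hT.1 (fun x => (x.1, x.2.2, x.1 + (x.2.1 + x.2.2))) (fun x => x)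
      (fun y => (y.1, y.2.2 - y.1 - y.2.1, y.2.1)) (fun y => (y.1, y.2.2, y.1 + (y.2.1 + y.2.2)))
      (by simp) (by simp), H, law_id, ent_tens _ _ hp hqr,
      ent_tens _ _ hq hr]
  rw [e0, e1, e2, e3] at h1
  linarith

lemma triangle {p q r : G → ℝ} (hp : Pm p) (hq : Pm q) (hr : Pm r) :
    dd p r ≤ dd p q + dd q r := by
  have h1 := kv hp hq hr
  have h2 : ent (conv p r) ≤ ent (conv (conv p q) r) := by
    rw [conv_assoc, conv_comm q r, ← conv_assoc]
    exact ent_le_conv (conv_pm hp hr) hq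
  unfold dd
  linarith

lemma dd_comm (p q : G → ℝ) : dd p q = dd q p := by
  unfold dd; rw [conv_comm]; ring

lemma dd_nonneg {p q : G → ℝ} (hp : Pm p) (hq : Pm q) : 0 ≤ dd p q := by
  have h1 := ent_le_conv hp hq
  have h2 := ent_le_conv' hp hq
  unfold dd; linarith

lemma ent_mix {S : Type*} [Fintype S] {w : I → ℝ} (hw : Pm w) {c : I → S → ℝ} (hc : ∀ i, Pm (c i))
    (m : S → ℝ) (hm : ∀ F : S → ℝ, ∑ s, m s * F s = ∑ i, w i * ∑ s, c i s * F s) :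
    ∑ i, w i * ent (c i) ≤ ent m := by
  set P : I × S → ℝ := fun x => w x.1 * c x.1 x.2 with hP
  have hPP : Pm P := by
    refine ⟨fun x => mul_nonneg (hw.1 _) ((hc _).1 _), ?_⟩
    rw [Fintype.sum_prod_type]
    simp only [hP, ← Finset.mul_sum, (hc _).2, mul_one, hw.2]
  have h := subadd hPP (fun x => x.1) (fun x => x.2)
  have e1 : law P (fun x => x.1) = w := by
    apply law_ext; intro F
    rw [law_sum, Fintype.sum_prod_type]
    refine Finset.sum_congr rfl fun i _ => ?_
    simp only [hP]
    rw [← Finset.sum_mul, ← Finset.mul_sum, (hc i).2, mul_one]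
  have e2 : law P (fun x => x.2) = m := by
    apply law_ext; intro F
    rw [law_sum, Fintype.sum_prod_type, hm]
    simp only [hP, Finset.mul_sum, mul_assoc]
  have e3 : H P (fun x => (x.1, x.2)) = ent P := by
    rw [H]; exact congrArg ent (law_id P)
  rw [e3, H, H, e1, e2, hP, ent_chain w c hc] at h
  linarith

/-- Approximate-minimiser property. -/
def Mini (η : ℝ) (p q : G → ℝ) : Prop :=
  ∀ a b : G → ℝ, Pm a → Pm b → dd p q ≤ dd a b + η * (dd p a + dd q b)

lemma cond_min {η : ℝ} (hη : 0 ≤ η) {p q : G → ℝ} (hp : Pm p) (hq : Pm q) (hM : Mini η p q)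
    {μ : Ω → ℝ} (hμ : Pm μ) (A B : Ω → G) (Z : Ω → I) (a b : I → G → ℝ)
    (ha : ∀ i, Pm (a i)) (hb : ∀ i, Pm (b i))
    (hl : ∀ F : I → G → G → ℝ, ∑ ω, μ ω * F (Z ω) (A ω) (B ω) =
      ∑ z, law μ Z z * ∑ x, a z x * ∑ y, b z y * F z x y) :
    dd p q ≤ (H μ (fun ω => (Z ω, A ω + B ω)) - H μ Z)
      - (H μ (fun ω => (Z ω, A ω)) - H μ Z) / 2 - (H μ (fun ω => (Z ω, B ω)) - H μ Z) / 2
      + η * ((ent (conv p (law μ A)) - ent p / 2 - (H μ (fun ω => (Z ω, A ω)) - H μ Z) / 2)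
        + (ent (conv q (law μ B)) - ent q / 2 - (H μ (fun ω => (Z ω, B ω)) - H μ Z) / 2)) := by
  set w := law μ Z with hw
  have hwp : Pm w := law_pm hμ Z
  have eA : H μ (fun ω => (Z ω, A ω)) = H μ Z + ∑ z, w z * ent (a z) := by
    rw [H, H, ← hw, ← ent_chain w a ha]
    congr 1
    apply law_ext; intro F
    rw [law_sum, Fintype.sum_prod_type, hl (fun z x y => F (z, x))]
    simp only [← Finset.sum_mul, (hb _).2, one_mul, Finset.mul_sum, mul_assoc]
  have eB : H μ (fun ω => (Z ω, B ω)) = H μ Z + ∑ z, w z * ent (b z) := by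
    rw [H, H, ← hw, ← ent_chain w b hb]
    congr 1
    apply law_ext; intro F
    rw [law_sum, Fintype.sum_prod_type, hl (fun z x y => F (z, y))]
    refine Finset.sum_congr rfl fun z _ => ?_
    rw [← Finset.sum_mul, (ha _).2, one_mul]
    simp only [Finset.mul_sum, mul_assoc]
  have eC : H μ (fun ω => (Z ω, A ω + B ω)) = H μ Z + ∑ z, w z * ent (conv (a z) (b z)) := by
    rw [H, H, ← hw, ← ent_chain w (fun z => conv (a z) (b z)) (fun z => conv_pm (ha z) (hb z))]
    congr 1
    apply law_ext; intro F
    rw [law_sum, Fintype.sum_prod_type, hl (fun z x y => F (z, x + y))]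
    refine Finset.sum_congr rfl fun z _ => ?_
    rw [← conv_sum (a z) (b z) (fun s => F (z, s)), Finset.mul_sum]
    simp only [mul_assoc]
  have mA : ∑ z, w z * ent (conv p (a z)) ≤ ent (conv p (law μ A)) := by
    apply ent_mix hwp (fun z => conv_pm hp (ha z))
    intro F
    rw [conv_comm, conv_sum, law_sum μ A (fun x => ∑ y, p y * F (x + y)),
      hl (fun z x y => ∑ y, p y * F (x + y))]
    refine Finset.sum_congr rfl fun z _ => ?_
    rw [conv_comm, conv_sum]
    simp only [← Finset.sum_mul, (hb _).2, one_mul]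
  have mB : ∑ z, w z * ent (conv q (b z)) ≤ ent (conv q (law μ B)) := by
    apply ent_mix hwp (fun z => conv_pm hq (hb z))
    intro F
    rw [conv_comm, conv_sum, law_sum μ B (fun x => ∑ y, q y * F (x + y)),
      hl (fun z _ x => ∑ y, q y * F (x + y))]
    refine Finset.sum_congr rfl fun z _ => ?_
    rw [conv_comm, conv_sum]
    simp only [← Finset.sum_mul, (ha _).2, one_mul]
  have main : ∑ z, w z * dd p q ≤ ∑ z, w z * (dd (a z) (b z) + η * (dd p (a z) + dd q (b z))) :=
    Finset.sum_le_sum fun z _ => mul_le_mul_of_nonneg_left (hM _ _ (ha z) (hb z)) (hwp.1 z)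
  rw [← Finset.sum_mul, hwp.2, one_mul] at main
  have ex : ∑ z, w z * (dd (a z) (b z) + η * (dd p (a z) + dd q (b z))) =
      (∑ z, w z * ent (conv (a z) (b z))) - (∑ z, w z * ent (a z)) / 2
        - (∑ z, w z * ent (b z)) / 2 + η * (((∑ z, w z * ent (conv p (a z))) - ent p / 2
          - (∑ z, w z * ent (a z)) / 2) + ((∑ z, w z * ent (conv q (b z))) - ent q / 2
          - (∑ z, w z * ent (b z)) / 2)) := by
    have e1 : ent p = ∑ z, w z * ent p := by rw [← Finset.sum_mul, hwp.2, one_mul]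
    have e2 : ent q = ∑ z, w z * ent q := by rw [← Finset.sum_mul, hwp.2, one_mul]
    rw [e1, e2]
    simp only [Finset.sum_div, ← Finset.sum_sub_distrib, ← Finset.sum_add_distrib, Finset.mul_sum]
    refine Finset.sum_congr rfl fun z _ => ?_
    unfold dd
    ring
  rw [ex] at main
  rw [eA, eB, eC]
  have := mul_le_mul_of_nonneg_left (add_le_add mA mB) hη
  nlinarith

end group

section bsg
variable {G : Type*} [AddCommGroup G] [Fintype G]
variable {Ω I T : Type*} [Fintype Ω] [Fintype I] [Fintype T]

lemma law_transfer {Ω Ω' S R : Type*} [Fintype Ω] [Fintype Ω'] [Fintype S] [Fintype R]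
    {μ : Ω → ℝ} {ν : Ω' → ℝ} {X : Ω → S} {Y : Ω' → S}
    (h : law μ X = law ν Y) (f : S → R) : law μ (fun ω => f (X ω)) = law ν (fun ω => f (Y ω)) := by
  rw [← law_comp, h, law_comp]

lemma H_transfer {Ω Ω' S R : Type*} [Fintype Ω] [Fintype Ω'] [Fintype S] [Fintype R]
    {μ : Ω → ℝ} {ν : Ω' → ℝ} {X : Ω → S} {Y : Ω' → S}
    (h : law μ X = law ν Y) (f : S → R) : H μ (fun ω => f (X ω)) = H ν (fun ω => f (Y ω)) := by
  rw [H, H, law_transfer h]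

/-- Entropic Balog–Szemerédi–Gowers combined with minimality. -/
lemma bsg_min (h2 : ∀ x : G, x + x = 0) {η : ℝ} (hη : 0 ≤ η) {p q : G → ℝ} (hp : Pm p) (hq : Pm q)
    (hM : Mini η p q) {μ : Ω → ℝ} (hμ : Pm μ) (A B : Ω → G) (S : Ω → T) (HAS HBS HS HABS HZ : ℝ)
    (eAS : H μ (fun ω => (A ω, S ω)) = HAS) (eBS : H μ (fun ω => (B ω, S ω)) = HBS)
    (eS : H μ S = HS) (eABS : H μ (fun ω => (A ω, B ω, S ω)) = HABS)
    (eZ : H μ (fun ω => (A ω + B ω, S ω)) = HZ) :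
    dd p q ≤ 2 * HAS + 2 * HBS - 3 * HS - 3 * HABS + 2 * HZ
      + η * ((ent (conv p (law μ A)) - ent p / 2 - (HABS - HZ) / 2)
        + (ent (conv q (law μ B)) - ent q / 2 - (HABS - HZ) / 2)) := by
  have c1 : ∀ x y : G, x + (x + y) = y := fun x y => by rw [← add_assoc, h2, zero_add]
  have c2 : ∀ x y : G, x + y + y = x := fun x y => by rw [add_assoc, h2, add_zero]
  have c3 : ∀ x y : G, y + (x + y) = x := fun x y => by rw [add_comm x, c1]
  have c4 : ∀ x y : G, x + y + x = y := fun x y => by rw [add_comm x, c2]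
  set Z : Ω → G × T := fun ω => (A ω + B ω, S ω) with hZdef
  obtain ⟨a, ha, ha'⟩ := exists_kernel (law μ (fun ω => (Z ω, A ω))) (law_nonneg hμ.1 _)
  obtain ⟨b, hb, hb'⟩ := exists_kernel (law μ (fun ω => (Z ω, B ω))) (law_nonneg hμ.1 _)
  rw [law_comp] at ha' hb'
  change ∀ s t, _ = law μ Z s * _ at ha'
  change ∀ s t, _ = law μ Z s * _ at hb'
  set w := law μ Z with hw
  have hwp : Pm w := law_pm hμ Z
  set ν : (G × T) × G × G → ℝ := fun x => w x.1 * (a x.1 x.2.1 * b x.1 x.2.2) with hν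
  have hE : ∀ F : (G × T) → G → G → ℝ, ∑ x, ν x * F x.1 x.2.1 x.2.2 =
      ∑ z, w z * ∑ x, a z x * ∑ y, b z y * F z x y := by
    intro F
    rw [Fintype.sum_prod_type]
    simp only [Fintype.sum_prod_type, hν, Finset.mul_sum, mul_assoc]
  have hνp : Pm ν := by
    refine ⟨fun x => mul_nonneg (hwp.1 _) (mul_nonneg ((ha _).1 _) ((hb _).1 _)), ?_⟩
    have := hE (fun _ _ _ => 1)
    simpa [(ha _).2, (hb _).2, hwp.2] using this
  have lZA : law ν (fun x => (x.1, x.2.1)) = law μ (fun ω => (Z ω, A ω)) := by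
    apply law_ext; intro F
    rw [law_sum, hE (fun z x y => F (z, x))]
    refine Eq.trans ?_ (Fintype.sum_prod_type _).symm
    refine Finset.sum_congr rfl fun z _ => ?_
    simp only [← Finset.sum_mul, (hb _).2, one_mul, ha', Finset.mul_sum, mul_assoc]
  have lZB : law ν (fun x => (x.1, x.2.2)) = law μ (fun ω => (Z ω, B ω)) := by
    apply law_ext; intro F
    rw [law_sum, hE (fun z x y => F (z, y))]
    refine Eq.trans ?_ (Fintype.sum_prod_type _).symm
    refine Finset.sum_congr rfl fun z _ => ?_
    rw [← Finset.sum_mul, (ha _).2, one_mul]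
    simp only [hb', Finset.mul_sum, mul_assoc]
  have hZA : H μ (fun ω => (Z ω, A ω)) = HABS := by
    rw [← eABS]
    exact H_congr hμ.1 _ _ (fun y => (y.2, y.2 + y.1.1, y.1.2)) (fun y => ((y.1 + y.2.1, y.2.2), y.1))
      (by simp [hZdef, c1]) (by simp [hZdef])
  have hZB : H μ (fun ω => (Z ω, B ω)) = HABS := by
    rw [← eABS]
    exact H_congr hμ.1 _ _ (fun y => (y.2 + y.1.1, y.2, y.1.2)) (fun y => ((y.1 + y.2.1, y.2.2), y.2.1))
      (by simp [hZdef, c3]) (by simp [hZdef])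
  have nZ : law ν (fun x => x.1) = w := law_transfer lZA Prod.fst
  have nA : law ν (fun x => x.2.1) = law μ A := law_transfer lZA Prod.snd
  have nB : law ν (fun x => x.2.2) = law μ B := law_transfer lZB Prod.snd
  have nS : H ν (fun x => x.1.2) = HS := (H_transfer lZA (fun y => y.1.2)).trans eS
  have hHZ : H ν (fun x => x.1) = HZ := by rw [H, nZ, ← eZ]; rfl
  have nZA : H ν (fun x => (x.1, x.2.1)) = HABS := by rw [H, lZA, ← hZA]; rfl
  have nZB : H ν (fun x => (x.1, x.2.2)) = HABS := by rw [H, lZB, ← hZB]; rfl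
  have nAS : H ν (fun x => (x.2.1, x.1.2)) = HAS :=
    (H_transfer lZA (fun y => (y.2, y.1.2))).trans eAS
  have nBS : H ν (fun x => (x.2.2, x.1.2)) = HBS :=
    (H_transfer lZB (fun y => (y.2, y.1.2))).trans eBS
  have nBS' : H ν (fun x => (x.1.1 + x.2.1, x.1.2)) = HBS := by
    refine (H_transfer lZA (fun y => (y.1.1 + y.2, y.1.2))).trans ?_
    rw [← eBS]
    simp only [hZdef, c4]
  have nAS' : H ν (fun x => (x.1.1 + x.2.2, x.1.2)) = HAS := by
    refine (H_transfer lZB (fun y => (y.1.1 + y.2, y.1.2))).trans ?_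
    rw [← eAS]
    simp only [hZdef, c2]
  have chA : HABS = HZ + ∑ z, w z * ent (a z) := by
    rw [← hZA, ← eZ, H, H, ← hw, ← ent_chain w a ha]
    congr 1
    funext x
    exact ha' x.1 x.2
  have chB : HABS = HZ + ∑ z, w z * ent (b z) := by
    rw [← hZB, ← eZ, H, H, ← hw, ← ent_chain w b hb]
    congr 1
    funext x
    exact hb' x.1 x.2
  have chAB : H ν (fun x => x) = HZ + (∑ z, w z * ent (a z) + ∑ z, w z * ent (b z)) := by
    rw [H, law_id, ← Finset.sum_add_distrib, ← eZ, H, ← hw]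
    simp only [← mul_add]
    simp only [← fun z => ent_tens _ _ (ha z) (hb z)]
    rw [← ent_chain w (fun z => tens (a z) (b z)) (fun z => tens_pm (ha z) (hb z))]
    rfl
  have main := cond_min hη hp hq hM hνp (fun x => x.2.1) (fun x => x.2.2) (fun x => x.1) a b ha hb
    (by rw [nZ]; exact hE)
  rw [nZA, nZB, nA, nB, hHZ] at main
  -- H[Z, D] - H[Z] ≤ H[D, S] - H[S]
  have s1 := submod hνp (fun x => x.1.1) (fun x => x.2.1 + x.2.2) (fun x => x.1.2)
  rw [nS, H_congr hνp.1 (fun x => (x.1.1, x.2.1 + x.2.2, x.1.2)) (fun x => (x.1, x.2.1 + x.2.2))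
    (fun y => ((y.1, y.2.2), y.2.1)) (fun y => (y.1.1, y.2, y.1.2)) (by simp) (by simp)] at s1
  have e1 : H ν (fun x => (x.1.1, x.1.2)) = HZ := hHZ
  rw [e1] at s1
  have s2 := submod hνp (fun x => x.2.1) (fun x => x.1.1 + x.2.1)
    (fun x => (x.2.1 + x.2.2, x.1.2))
  rw [H_congr hνp.1 (fun x => (x.2.1, x.1.1 + x.2.1, (x.2.1 + x.2.2, x.1.2))) (fun x => x)
    (fun y => ((y.1 + y.2.1, y.2.2.2), y.1, y.1 + y.2.2.1))
    (fun x => (x.2.1, x.1.1 + x.2.1, (x.2.1 + x.2.2, x.1.2))) (by simp [c1, c3]) (by simp), chAB,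
    H_congr hνp.1 (fun x => (x.2.1, (x.2.1 + x.2.2, x.1.2))) (fun x => (x.2.1, x.2.2, x.1.2))
    (fun y => (y.1, y.1 + y.2.1, y.2.2)) (fun y => (y.1, y.1 + y.2.1, y.2.2)) (by simp [c1]) (by simp),
    H_congr hνp.1 (fun x => (x.1.1 + x.2.1, (x.2.1 + x.2.2, x.1.2)))
    (fun x => (x.1.1 + x.2.1, x.1.1 + x.2.2, x.1.2))
    (fun y => (y.1, y.1 + y.2.1, y.2.2)) (fun y => (y.1, y.1 + y.2.1, y.2.2))
    (by intro x; simp [← add_assoc, c2])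
    (by intro x; simp only [Prod.mk.injEq, true_and, and_true]
        rw [add_add_add_comm, h2, zero_add])] at s2
  have s3 := submod hνp (fun x => x.2.1) (fun x => x.2.2) (fun x => x.1.2)
  have s4 := submod hνp (fun x => x.1.1 + x.2.1) (fun x => x.1.1 + x.2.2) (fun x => x.1.2)
  rw [nS, nAS, nBS] at s3
  rw [nS, nAS', nBS'] at s4
  linarith
end bsg

section four
variable {G : Type*} [AddCommGroup G] [Fintype G]

lemma kernel_exp {Ω I T : Type*} [Fintype Ω] [Fintype I] [Fintype T] [Nonempty T] {μ : Ω → ℝ}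
    (hμ : Pm μ) (C : Ω → I) (A : Ω → T) :
    ∃ a : I → T → ℝ, (∀ i, Pm (a i)) ∧ ∀ F : I → T → ℝ,
      ∑ ω, μ ω * F (C ω) (A ω) = ∑ u, law μ C u * ∑ x, a u x * F u x := by
  obtain ⟨a, ha, ha'⟩ := exists_kernel (law μ (fun ω => (C ω, A ω))) (law_nonneg hμ.1 _)
  refine ⟨a, ha, fun F => ?_⟩
  rw [law_comp] at ha'
  rw [← law_sum μ (fun ω => (C ω, A ω)) (fun y => F y.1 y.2), Fintype.sum_prod_type]
  simp only [ha', Finset.mul_sum, mul_assoc]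

lemma cond_min_prod {Ω Ω' I J : Type*} [Fintype Ω] [Fintype Ω'] [Fintype I] [Fintype J]
    {η : ℝ} (hη : 0 ≤ η) {p q : G → ℝ} (hp : Pm p) (hq : Pm q) (hM : Mini η p q)
    {μ : Ω → ℝ} (hμ : Pm μ) {ν : Ω' → ℝ} (hν : Pm ν) (A : Ω → G) (B : Ω' → G)
    (C : Ω → I) (D : Ω' → J) :
    dd p q ≤ (H (tens μ ν) (fun ω => ((C ω.1, D ω.2), A ω.1 + B ω.2)) - (H μ C + H ν D))
      - (H μ (fun ω => (C ω, A ω)) - H μ C) / 2 - (H ν (fun ω => (D ω, B ω)) - H ν D) / 2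
      + η * ((ent (conv p (law μ A)) - ent p / 2 - (H μ (fun ω => (C ω, A ω)) - H μ C) / 2)
        + (ent (conv q (law ν B)) - ent q / 2 - (H ν (fun ω => (D ω, B ω)) - H ν D) / 2)) := by
  obtain ⟨a, ha, ha'⟩ := kernel_exp hμ C A
  obtain ⟨b, hb, hb'⟩ := kernel_exp hν D B
  have main := cond_min hη hp hq hM (tens_pm hμ hν) (fun ω => A ω.1) (fun ω => B ω.2)
    (fun ω => (C ω.1, D ω.2)) (fun i => a i.1) (fun i => b i.2) (fun _ => ha _) (fun _ => hb _) (by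
      intro F
      rw [law_tens, Fintype.sum_prod_type, Fintype.sum_prod_type]
      simp only [tens, mul_assoc, ← Finset.mul_sum]
      rw [ha' (fun u x => ∑ y, ν y * F (u, D y) x (B y))]
      refine Finset.sum_congr rfl fun u _ => ?_
      congr 1
      rw [Finset.sum_congr rfl fun x _ => by rw [hb' (fun v y => F (u, v) x y)]]
      simp only [Finset.mul_sum]
      rw [Finset.sum_comm]
      refine Finset.sum_congr rfl fun v _ => Finset.sum_congr rfl fun x _ =>
        Finset.sum_congr rfl fun y _ => ?_
      ring)
  have e1 : H (tens μ ν) (fun ω => (C ω.1, D ω.2)) = H μ C + H ν D := H_tens hμ hν C D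
  have e2 : H (tens μ ν) (fun ω => ((C ω.1, D ω.2), A ω.1)) =
      H μ (fun ω => (C ω, A ω)) + H ν D := by
    rw [← H_tens hμ hν (fun ω => (C ω, A ω)) D]
    exact H_congr (tens_pm hμ hν).1 _ _ (fun y => ((y.1.1, y.2), y.1.2))
      (fun y => ((y.1.1, y.2), y.1.2)) (by simp) (by simp)
  have e3 : H (tens μ ν) (fun ω => ((C ω.1, D ω.2), B ω.2)) =
      H μ C + H ν (fun ω => (D ω, B ω)) := by
    rw [← H_tens hμ hν C (fun ω => (D ω, B ω))]
    exact H_congr (tens_pm hμ hν).1 _ _ (fun y => (y.1.1, (y.1.2, y.2)))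
      (fun y => ((y.1, y.2.1), y.2.2)) (by simp) (by simp)
  rw [e1, e2, e3, law_tens_fst μ hν A, law_tens_snd ν hμ B] at main
  ring_nf at main ⊢
  linarith

/-- swap second coordinates -/
def swapY (G : Type*) : (G × G) × (G × G) ≃ (G × G) × (G × G) where
  toFun ω := ((ω.1.1, ω.2.2), (ω.2.1, ω.1.2))
  invFun ω := ((ω.1.1, ω.2.2), (ω.2.1, ω.1.2))
  left_inv _ := rfl
  right_inv _ := rfl

/-- swap first coordinates -/
def swapX (G : Type*) : (G × G) × (G × G) ≃ (G × G) × (G × G) where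
  toFun ω := ((ω.2.1, ω.1.2), (ω.1.1, ω.2.2))
  invFun ω := ((ω.2.1, ω.1.2), (ω.1.1, ω.2.2))
  left_inv _ := rfl
  right_inv _ := rfl

/-- regroup -/
def regr (G : Type*) : (G × G) × (G × G) ≃ (G × G) × (G × G) where
  toFun ω := ((ω.1.1, ω.2.1), (ω.1.2, ω.2.2))
  invFun ω := ((ω.1.1, ω.2.1), (ω.1.2, ω.2.2))
  left_inv _ := rfl
  right_inv _ := rfl

lemma H_pair {p q : G → ℝ} (hp : Pm p) (hq : Pm q) :
    H (tens p q) (fun x => (x.1 + x.2, x.1)) = ent p + ent q ∧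
    H (tens p q) (fun x => (x.1 + x.2, x.2)) = ent p + ent q ∧
    H (tens p q) (fun x => x.1 + x.2) = ent (conv p q) ∧
    law (tens p q) (fun x => x.1) = p ∧ law (tens p q) (fun x => x.2) = q := by
  have hT := tens_pm hp hq
  refine ⟨?_, ?_, rfl, ?_, ?_⟩
  · rw [← ent_tens _ _ hp hq]
    refine (H_congr hT.1 (fun x => (x.1 + x.2, x.1)) (fun x => x) (fun y => (y.2, y.1 - y.2))
      (fun y => (y.1 + y.2, y.1)) (by simp) (by simp)).trans ?_
    simp only [H, law_id]
  · rw [← ent_tens _ _ hp hq]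
    refine (H_congr hT.1 (fun x => (x.1 + x.2, x.2)) (fun x => x) (fun y => (y.1 - y.2, y.2))
      (fun y => (y.1 + y.2, y.2)) (by simp) (by simp)).trans ?_
    simp only [H, law_id]
  · rw [law_tens_fst p hq (fun x => x), law_id]
  · rw [law_tens_snd q hp (fun x => x), law_id]

lemma endgame (h2 : ∀ x : G, x + x = 0) {p q : G → ℝ} (hp : Pm p) (hq : Pm q)
    (hM : Mini (1/1000) p q) : dd p q ≤ 0 := by
  have hη : (0:ℝ) ≤ 1/1000 := by norm_num
  have c1 : ∀ x y : G, x + (x + y) = y := fun x y => by rw [← add_assoc, h2, zero_add]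
  have c2 : ∀ x y : G, x + y + y = x := fun x y => by rw [add_assoc, h2, add_zero]
  have c3 : ∀ x y : G, y + (x + y) = x := fun x y => by rw [add_comm x, c1]
  have c4 : ∀ x y : G, x + y + x = y := fun x y => by rw [add_comm x, c2]
  have hpq := tens_pm hp hq
  have hpp := tens_pm hp hp
  have hqq := tens_pm hq hq
  have hC := conv_pm hp hq
  set P := tens (tens p q) (tens p q) with hP
  have hPp : Pm P := tens_pm hpq hpq
  set h := ent p with hh
  set h' := ent q with hh'
  set u := ent (conv p q) with hu
  set pp := ent (conv p p) with hpp'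
  set qq := ent (conv q q) with hqq'
  set s := ent (conv (conv p q) (conv p q)) with hs
  have lawS : law P (fun ω => (ω.1.1 + ω.1.2) + (ω.2.1 + ω.2.2)) = conv (conv p q) (conv p q) :=
    law_tens_add (tens p q) (tens p q) (fun x => x.1 + x.2) (fun x => x.1 + x.2)
  have HS : H P (fun ω => (ω.1.1 + ω.1.2) + (ω.2.1 + ω.2.2)) = s := by rw [H, lawS]
  have lawU : law P (fun ω => ω.1.1 + ω.1.2) = conv p q :=
    law_tens_fst (tens p q) hpq (fun x => x.1 + x.2)
  have lawV : law P (fun ω => ω.2.1 + ω.1.2) = conv p q := by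
    refine (law_equiv (swapX G) (ν := P) ?_ (fun ω => ω.1.1 + ω.1.2)).trans lawU
    intro ω; simp only [hP, tens, swapX, Equiv.coe_fn_mk]; ring
  have lawW : law P (fun ω => ω.1.1 + ω.2.1) = conv p p := by
    have := law_tens_add (tens p q) (tens p q) (fun x => x.1) (fun x => x.1)
    rwa [(H_pair hp hq).2.2.2.1] at this
  have HUS : H P (fun ω => (ω.1.1 + ω.1.2, (ω.1.1 + ω.1.2) + (ω.2.1 + ω.2.2))) = 2 * u := by
    rw [H_congr hPp.1 _ (fun ω => (ω.1.1 + ω.1.2, ω.2.1 + ω.2.2)) (fun y => (y.1, y.2 - y.1))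
      (fun y => (y.1, y.1 + y.2)) (by simp) (by simp)]
    have := H_tens hpq hpq (fun x => x.1 + x.2) (fun x => x.1 + x.2)
    rw [this, two_mul]; rfl
  have HVS : H P (fun ω => (ω.2.1 + ω.1.2, (ω.1.1 + ω.1.2) + (ω.2.1 + ω.2.2))) = 2 * u := by
    rw [← HUS]
    have := H_equiv (swapX G) (μ := P) (ν := P)
      (by intro ω; simp only [hP, tens, swapX, Equiv.coe_fn_mk]; ring)
      (fun ω => (ω.1.1 + ω.1.2, (ω.1.1 + ω.1.2) + (ω.2.1 + ω.2.2)))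
    rw [← this]
    congr 1
    funext ω
    simp only [swapX, Equiv.coe_fn_mk]
    congr 1
    abel
  have HWS : H P (fun ω => (ω.1.1 + ω.2.1, (ω.1.1 + ω.1.2) + (ω.2.1 + ω.2.2))) = pp + qq := by
    have := H_equiv (regr G) (μ := P) (ν := tens (tens p p) (tens q q))
      (by intro ω; simp only [hP, tens, regr, Equiv.coe_fn_mk]; ring)
      (fun ω => (ω.1.1 + ω.1.2, ω.2.1 + ω.2.2))
    rw [H_tens hpp hqq (fun x => x.1 + x.2) (fun x => x.1 + x.2)] at this
    refine Eq.trans ?_ this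
    exact H_congr hPp.1 _ _ (fun y => (y.1, y.2 - y.1))
      (fun y => (y.1, y.1 + y.2)) (by intro ω; simp [regr]; abel) (by intro ω; simp [regr]; abel)
  set x1 := H P (fun ω => (ω.1.1 + ω.1.2, ω.2.1 + ω.1.2, (ω.1.1 + ω.1.2) + (ω.2.1 + ω.2.2)))
    with hx1
  set x2 := H P (fun ω => (ω.1.1 + ω.1.2, ω.1.1 + ω.2.1, (ω.1.1 + ω.1.2) + (ω.2.1 + ω.2.2)))
    with hx2
  have HVWS : H P (fun ω => (ω.2.1 + ω.1.2, ω.1.1 + ω.2.1, (ω.1.1 + ω.1.2) + (ω.2.1 + ω.2.2)))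
      = x2 := by
    have := H_equiv (swapX G) (μ := P) (ν := P)
      (by intro ω; simp only [hP, tens, swapX, Equiv.coe_fn_mk]; ring)
      (fun ω => (ω.1.1 + ω.1.2, ω.1.1 + ω.2.1, (ω.1.1 + ω.1.2) + (ω.2.1 + ω.2.2)))
    rw [hx2, ← this]
    congr 1
    funext ω
    simp only [swapX, Equiv.coe_fn_mk, Prod.mk.injEq, true_and]
    constructor <;> abel
  -- first estimate
  have a1 := hM (conv p q) (conv q p) hC (conv_pm hq hp)
  have b1 := cond_min_prod hη hp hq hM hpq hpq (fun x => x.1) (fun x => x.2)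
    (fun x => x.1 + x.2) (fun x => x.1 + x.2)
  have e1 : H (tens (tens p q) (tens p q))
      (fun ω => ((ω.1.1 + ω.1.2, ω.2.1 + ω.2.2), ω.1.1 + ω.2.2)) = x1 := by
    rw [← H_equiv (swapY G) (μ := P) (ν := P)
      (by intro ω; simp only [hP, tens, swapY, Equiv.coe_fn_mk]; ring)]
    exact H_congr hPp.1 _ _ (fun y => (y.2, y.1.2, y.1.1 + y.1.2))
      (fun y => ((y.2.2 - y.2.1, y.2.1), y.1))
      (by intro ω; simp [swapY]; abel) (by intro ω; simp [swapY]; abel)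
  rw [e1, (H_pair hp hq).1, (H_pair hp hq).2.1, (H_pair hp hq).2.2.1, (H_pair hp hq).2.2.2.1,
    (H_pair hp hq).2.2.2.2] at b1
  -- second estimate
  have a2 := hM (conv p p) (conv q q) (conv_pm hp hp) (conv_pm hq hq)
  have b2 := cond_min_prod hη hp hq hM hpp hqq (fun x => x.1) (fun x => x.1)
    (fun x => x.1 + x.2) (fun x => x.1 + x.2)
  have e2 : H (tens (tens p p) (tens q q))
      (fun ω => ((ω.1.1 + ω.1.2, ω.2.1 + ω.2.2), ω.1.1 + ω.2.1)) = x2 := by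
    rw [← H_equiv (regr G) (μ := P) (ν := tens (tens p p) (tens q q))
      (by intro ω; simp only [hP, tens, regr, Equiv.coe_fn_mk]; ring)]
    exact H_congr hPp.1 _ _ (fun y => (y.2, y.1.1, y.1.1 + y.1.2))
      (fun y => ((y.2.1, y.2.2 - y.2.1), y.1))
      (by intro ω; simp [regr]; abel) (by intro ω; simp [regr]; abel)
  rw [e2, (H_pair hp hp).1, (H_pair hq hq).1, (H_pair hp hp).2.2.1, (H_pair hq hq).2.2.1,
    (H_pair hp hp).2.2.2.1, (H_pair hq hq).2.2.2.1] at b2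
  -- endgame
  have c1 := bsg_min h2 hη hp hq hM hPp (fun ω => ω.1.1 + ω.1.2) (fun ω => ω.2.1 + ω.1.2)
    (fun ω => (ω.1.1 + ω.1.2) + (ω.2.1 + ω.2.2)) _ _ _ x1 (pp + qq) HUS HVS HS rfl (by
      rw [← HWS]; congr 1; funext ω
      have : ω.1.1 + ω.1.2 + (ω.2.1 + ω.1.2) = ω.1.1 + ω.2.1 := by
        rw [add_add_add_comm, h2, add_zero]
      rw [this])
  have c2' := bsg_min h2 hη hp hq hM hPp (fun ω => ω.2.1 + ω.1.2) (fun ω => ω.1.1 + ω.2.1)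
    (fun ω => (ω.1.1 + ω.1.2) + (ω.2.1 + ω.2.2)) _ _ _ x2 (2 * u) HVS HWS HS HVWS (by
      rw [← HUS]; congr 1; funext ω
      have : ω.2.1 + ω.1.2 + (ω.1.1 + ω.2.1) = ω.1.1 + ω.1.2 := by
        rw [add_comm ω.1.1, add_add_add_comm, h2, zero_add, add_comm]
      rw [this])
  rw [lawU, lawV] at c1
  rw [lawV, lawW] at c2'
  -- sums
  have k1 := kv hp hq hp
  have k2 := kv hq hp hq
  have k3 := kv hp hp hq
  have k4 := kv hp hq hq
  have k5 := kv hp hp hp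
  have k6 := kv hq hq hq
  have k7 := kv hC hp hq
  have k8 := ent_le_conv hp hq
  have k9 := ent_le_conv' hp hq
  have sEq : conv (conv p q) (conv q p) = conv (conv p q) (conv p q) := by rw [conv_comm q p]
  have sEq2 : conv (conv p p) (conv q q) = conv (conv p q) (conv p q) := by
    rw [conv_assoc, ← conv_assoc p q q, conv_comm (conv p q) q, ← conv_assoc]
  have sEq3 : conv (conv (conv p q) p) q = conv (conv p q) (conv p q) := by rw [conv_assoc]
  have qp : conv q p = conv p q := conv_comm q p
  have t1 : conv p (conv p q) = conv (conv p p) q := (conv_assoc _ _ _).symm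
  have t2 : conv q (conv p q) = conv (conv p q) q := conv_comm _ _
  have t3 : conv q (conv p p) = conv (conv p p) q := conv_comm _ _
  have t4 : conv p (conv p p) = conv (conv p p) p := conv_comm _ _
  have t5 : conv q (conv q q) = conv (conv q q) q := conv_comm _ _
  have t6 : conv (conv p q) p = conv (conv p p) q := by rw [conv_comm, t1]
  rw [sEq3] at k7
  rw [t6] at k7
  unfold dd at *
  rw [sEq, qp] at a1
  rw [sEq2] at a2
  simp only [qp, t1, t2, t3, t4, t5, t6, ← hh, ← hh', ← hu, ← hpp', ← hqq', ← hs] at *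
  have k10 : pp ≤ 2 * u - h' := by
    have : pp ≤ ent (conv (conv p p) q) := ent_le_conv (conv_pm hp hp) hq
    linarith
  have k11 : qq ≤ 2 * u - h := by
    have : qq ≤ ent (conv (conv p q) q) := by
      rw [conv_assoc]
      exact ent_le_conv' hp (conv_pm hq hq)
    linarith
  clear_value x1 x2 h h' u pp qq s
  clear HS HUS HVS HWS HVWS lawS lawU lawV lawW e1 e2
  linarith
end four

section pfr
variable {G : Type*} [AddCommGroup G] [Fintype G]

lemma conv_apply (p q : G → ℝ) (s : G) : conv p q s = ∑ y, q y * p (s - y) := by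
  classical
  have h := conv_sum q p (fun t => if t = s then 1 else 0)
  rw [conv_comm] at h
  simp only [mul_ite, mul_one, mul_zero, Finset.sum_ite_eq', Finset.mem_univ, if_true] at h
  rw [h]
  refine Finset.sum_congr rfl fun y _ => ?_
  congr 1
  rw [Finset.sum_eq_single (s - y)]
  · simp
  · intro b _ hb
    rw [if_neg]
    intro h
    exact hb (by rw [← h]; simp)
  · simp

lemma continuous_ent {S : Type*} [Fintype S] : Continuous (ent : (S → ℝ) → ℝ) := by
  unfold ent
  exact continuous_finsetSum _ fun i _ => Real.continuous_negMulLog.comp (continuous_apply i)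

lemma continuous_conv : Continuous (fun x : (G → ℝ) × (G → ℝ) => conv x.1 x.2) := by
  refine continuous_pi fun s => ?_
  simp only [conv_apply]
  exact continuous_finsetSum _ fun i _ =>
    ((continuous_apply i).comp continuous_snd).mul ((continuous_apply (s - i)).comp continuous_fst)

lemma continuous_dd : Continuous (fun x : (G → ℝ) × (G → ℝ) => dd x.1 x.2) := by
  unfold dd
  have h1 := (continuous_ent (S := G)).comp (continuous_conv (G := G))
  have h3 : Continuous (fun x : (G → ℝ) × (G → ℝ) => ent x.1) := continuous_ent.comp continuous_fst
  have h4 : Continuous (fun x : (G → ℝ) × (G → ℝ) => ent x.2) := continuous_ent.comp continuous_snd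
  exact h1.sub ((h3.add h4).div_const 2)

lemma exists_min (r : G → ℝ) (hr : Pm r) (η : ℝ) : ∃ p q : G → ℝ, Pm p ∧ Pm q ∧
    ∀ a b : G → ℝ, Pm a → Pm b →
      dd p q + η * (dd r p + dd r q) ≤ dd a b + η * (dd r a + dd r b) := by
  have hc : IsCompact (stdSimplex ℝ G ×ˢ stdSimplex ℝ G) :=
    (isCompact_stdSimplex ℝ G).prod (isCompact_stdSimplex ℝ G)
  have c1 : Continuous (fun x : (G → ℝ) × (G → ℝ) => dd r x.1) :=
    Continuous.comp (g := fun x : (G → ℝ) × (G → ℝ) => dd x.1 x.2)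
      (f := fun x : (G → ℝ) × (G → ℝ) => (r, x.1)) continuous_dd
      (continuous_const.prodMk continuous_fst)
  have c2 : Continuous (fun x : (G → ℝ) × (G → ℝ) => dd r x.2) :=
    Continuous.comp (g := fun x : (G → ℝ) × (G → ℝ) => dd x.1 x.2)
      (f := fun x : (G → ℝ) × (G → ℝ) => (r, x.2)) continuous_dd
      (continuous_const.prodMk continuous_snd)
  have hcont : Continuous (fun x : (G → ℝ) × (G → ℝ) =>
      dd x.1 x.2 + η * (dd r x.1 + dd r x.2)) :=
    continuous_dd.add (continuous_const.mul (c1.add c2))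
  have hne : (stdSimplex ℝ G ×ˢ stdSimplex ℝ G).Nonempty := ⟨(r, r), Set.mk_mem_prod hr hr⟩
  obtain ⟨x, hx, hmin⟩ := hc.exists_isMinOn hne hcont.continuousOn
  rw [isMinOn_iff] at hmin
  refine ⟨x.1, x.2, (Set.mem_prod.1 hx).1, (Set.mem_prod.1 hx).2, fun a b ha hb => ?_⟩
  exact hmin (a, b) (Set.mk_mem_prod ha hb)

lemma ent_le_log {S : Type*} [Fintype S] {p : S → ℝ} (hp : Pm p) (D : Finset S) (hD : D.Nonempty)
    (h : ∀ x, p x ≠ 0 → x ∈ D) : ent p ≤ Real.log (D.card) := by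
  classical
  have hN : (0:ℝ) < D.card := by exact_mod_cast hD.card_pos
  have hs : ∑ x ∈ D, p x = 1 := by
    rw [← hp.2]
    apply Finset.sum_subset (Finset.subset_univ _)
    intro x _ hx
    by_contra hh
    exact hx (h x hh)
  have e : ent p = ∑ x ∈ D, Real.negMulLog (p x) := by
    unfold ent
    symm
    apply Finset.sum_subset (Finset.subset_univ _)
    intro x _ hx
    have : p x = 0 := by
      by_contra hh
      exact hx (h x hh)
    simp [this]
  rw [e]
  have : ∀ x ∈ D, Real.negMulLog (p x) ≤ p x * Real.log D.card + 1 / D.card - p x := by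
    intro x _
    rcases (hp.1 x).eq_or_lt with h0 | h0
    · simp [← h0]
    · have := Real.log_le_sub_one_of_pos (inv_pos.2 (mul_pos hN h0))
      rw [Real.log_inv, Real.log_mul hN.ne' h0.ne'] at this
      have h3 := mul_le_mul_of_nonneg_left this h0.le
      have h4 : p x * ((D.card * p x)⁻¹ - 1) = 1 / D.card - p x := by field_simp
      rw [h4] at h3
      simp only [Real.negMulLog]
      linarith
  refine (Finset.sum_le_sum this).trans ?_
  rw [Finset.sum_sub_distrib, Finset.sum_add_distrib, ← Finset.sum_mul, hs]
  simp only [Finset.sum_const, nsmul_eq_mul]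
  field_simp
  simp

lemma le_ent {S : Type*} [Fintype S] {p : S → ℝ} (hp : Pm p) (c : ℝ)
    (h : ∀ x, p x ≤ c) : - Real.log c ≤ ent p := by
  have : ∑ x, p x * (- Real.log c) ≤ ent p := by
    apply Finset.sum_le_sum
    intro x _
    rcases (hp.1 x).eq_or_lt with h0 | h0
    · simp [← h0]
    · have := Real.log_le_log h0 (h x)
      simp only [Real.negMulLog]
      nlinarith
  rwa [← Finset.sum_mul, hp.2, one_mul] at this

lemma exists_large {S : Type*} [Fintype S] {p : S → ℝ} (hp : Pm p) :
    ∃ x, Real.exp (- ent p) ≤ p x := by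
  have : (Finset.univ : Finset S).Nonempty := by
    rw [Finset.nonempty_iff_ne_empty]
    intro h
    have := hp.2
    simp [h] at this
  obtain ⟨x, _, hx⟩ := Finset.exists_max_image Finset.univ p this
  refine ⟨x, ?_⟩
  have h1 := le_ent hp (p x) (fun y => hx y (Finset.mem_univ _))
  have h0 : 0 < p x := by
    by_contra hh
    have : ∑ y, p y ≤ 0 := Finset.sum_nonpos fun y _ => (hx y (Finset.mem_univ _)).trans (not_lt.1 hh)
    rw [hp.2] at this
    linarith
  rw [← Real.le_log_iff_exp_le h0]
  linarith

/-- Period group. -/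
def per (p : G → ℝ) : AddSubgroup G where
  carrier := {h | ∀ x, p (x + h) = p x}
  zero_mem' := by simp
  add_mem' := by
    intro a b ha hb x
    rw [← add_assoc, hb, ha]
  neg_mem' := by
    intro a ha x
    have := ha (x + -a)
    simpa using this.symm

lemma support_coset {p q : G → ℝ} (hp : Pm p) (hq : Pm q) (h : ent (conv p q) ≤ ent p) (y y' : G)
    (hy : q y ≠ 0) (hy' : q y' ≠ 0) : y - y' ∈ per p := by
  have jen : ∀ s, ∑ y, q y * Real.negMulLog (p (s - y)) ≤ Real.negMulLog (conv p q s) := by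
    intro s
    rw [conv_apply]
    exact Real.concaveOn_negMulLog.le_map_sum (fun i _ => hq.1 i) hq.2 (fun i _ => hp.1 _)
  have tot : ∑ s, ∑ y, q y * Real.negMulLog (p (s - y)) = ent p := by
    rw [Finset.sum_comm]
    simp only [← Finset.mul_sum]
    have : ∀ y, ∑ s, Real.negMulLog (p (s - y)) = ent p := fun y =>
      Equiv.sum_comp (Equiv.subRight y) (fun s => Real.negMulLog (p s))
    simp only [this, ← Finset.sum_mul, hq.2, one_mul]
  have heq : ∀ s, ∑ y, q y * Real.negMulLog (p (s - y)) = Real.negMulLog (conv p q s) := by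
    have h1 := (Finset.sum_eq_sum_iff_of_le (fun s (_ : s ∈ Finset.univ) => jen s)).1
      (le_antisymm (Finset.sum_le_sum fun s _ => jen s) (by rw [tot]; exact h))
    exact fun s => h1 s (Finset.mem_univ s)
  have heq' : ∀ s, p (s - y) = p (s - y') := by
    intro s
    have := heq s
    rw [conv_apply] at this
    exact (Real.strictConcaveOn_negMulLog.map_sum_eq_iff_of_nonneg (fun i _ => hq.1 i) hq.2
      (fun i _ => hp.1 (s - i))).1 this.symm (Finset.mem_univ y) hy (Finset.mem_univ y') hy'
  intro x
  have := heq' (x + y)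
  rw [add_sub_cancel_right] at this
  rw [this, add_sub_assoc]

open Classical in
theorem pfr (h2 : ∀ x : G, x + x = 0) (A D : Finset G) (hA : A.Nonempty) (K : ℝ) (hK : 1 ≤ K)
    (hD : ∀ x ∈ A, ∀ y ∈ A, x + y ∈ D) (hDc : (D.card : ℝ) ≤ K * A.card) :
    ∃ (V : AddSubgroup G) (t : G), (Fintype.card V : ℝ) ≤ K ^ (2004 : ℝ) * A.card ∧
      (A.card : ℝ) * K ^ (-2004 : ℝ) ≤ (A.filter (fun a => a - t ∈ V)).card := by
  have hN : (0:ℝ) < A.card := by exact_mod_cast hA.card_pos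
  have hK0 : 0 < K := by linarith
  set r : G → ℝ := fun x => if x ∈ A then (A.card : ℝ)⁻¹ else 0 with hr
  have hrp : Pm r := by
    refine ⟨fun x => ?_, ?_⟩
    · simp only [hr]; split_ifs
      · positivity
      · exact le_rfl
    · simp only [hr, Finset.sum_ite_mem, Finset.univ_inter, Finset.sum_const, nsmul_eq_mul]
      field_simp
  have hrA : ∀ x, r x ≠ 0 → x ∈ A := by
    intro x hx
    by_contra h
    exact hx (by simp [hr, h])
  have er : ent r = Real.log A.card := by
    apply le_antisymm (ent_le_log hrp A hA hrA)
    have := le_ent hrp (A.card : ℝ)⁻¹ (by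
      intro x
      simp only [hr]; split_ifs
      · exact le_rfl
      · positivity)
    simpa [Real.log_inv] using this
  have hDn : D.Nonempty := by
    obtain ⟨a, ha⟩ := hA
    exact ⟨_, hD a ha a ha⟩
  have drr : dd r r ≤ Real.log K := by
    have h1 : ent (conv r r) ≤ Real.log D.card := by
      apply ent_le_log (conv_pm hrp hrp) D hDn
      intro x hx
      rw [conv_apply] at hx
      obtain ⟨y, _, hy⟩ := Finset.exists_ne_zero_of_sum_ne_zero hx
      have h3 := hD _ (hrA _ (right_ne_zero_of_mul hy)) _ (hrA _ (left_ne_zero_of_mul hy))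
      simpa using h3
    have h3 : Real.log D.card ≤ Real.log K + Real.log A.card := by
      rw [← Real.log_mul hK0.ne' hN.ne']
      exact Real.log_le_log (by exact_mod_cast hDn.card_pos) hDc
    unfold dd
    linarith
  obtain ⟨p, q, hp, hq, hmin⟩ := exists_min r hrp (1/1000)
  have hM : Mini (1/1000) p q := by
    intro a b ha hb
    have h1 := hmin a b ha hb
    have h3 := triangle hrp hp ha
    have h4 := triangle hrp hq hb
    linarith
  have hd0 := endgame h2 hp hq hM
  have hmin0 := hmin r r hrp hrp
  have n1 := dd_nonneg hp hq
  have n2 := dd_nonneg hrp hp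
  have n3 := dd_nonneg hrp hq
  have drp : dd r p ≤ 1002 * Real.log K := by linarith
  have i1 := ent_le_conv hp hq
  have i2 := ent_le_conv' hp hq
  have i3 := ent_le_conv hrp hp
  have i4 := ent_le_conv' hrp hp
  have hsupp : ∀ y y', q y ≠ 0 → q y' ≠ 0 → y - y' ∈ per p := by
    apply support_coset hp hq
    unfold dd at hd0
    linarith
  obtain ⟨y0, hy0⟩ : ∃ y, q y ≠ 0 := by
    by_contra! h
    have := hq.2
    simp [h] at this
  have cV : (0:ℝ) < Fintype.card (per p) := by exact_mod_cast Fintype.card_pos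
  -- ent q ≤ log |V|
  have eq1 : ent q ≤ Real.log (Fintype.card (per p)) := by
    have := ent_le_log hq (Finset.univ.filter (fun y => y - y0 ∈ per p)) ⟨y0, by simp⟩
      (fun x hx => by simpa using hsupp x y0 hx hy0)
    refine this.trans (le_of_eq ?_)
    congr 2
    rw [Fintype.card_subtype]
    apply Finset.card_bij' (fun y _ => y - y0) (fun y _ => y + y0) <;> simp
  have ep1 : Real.log (Fintype.card (per p)) ≤ ent p := by
    have := le_ent hp (Fintype.card (per p) : ℝ)⁻¹ (by
      intro x
      have h1 : ∑ h : per p, p (x + h) ≤ 1 := by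
        rw [← hp.2]
        have : ∑ h : per p, p (x + h) = ∑ y ∈ Finset.univ.image (fun h : per p => x + (h : G)), p y := by
          rw [Finset.sum_image]
          intro a _ b _ hab
          simpa using hab
        rw [this]
        exact Finset.sum_le_sum_of_subset_of_nonneg (Finset.subset_univ _) (fun i _ _ => hp.1 i)
      have h3 : ∀ h : per p, p (x + h) = p x := fun h => h.2 x
      simp only [h3, Finset.sum_const, Finset.card_univ, nsmul_eq_mul] at h1
      rw [inv_eq_one_div, le_div_iff₀ cV]
      linarith)
    simpa [Real.log_inv] using this
  -- a popular coset
  obtain ⟨x, hx⟩ := exists_large (conv_pm hrp hp)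
  have hsum : (Fintype.card (per p) : ℝ) * conv r p x =
      ∑ z, p z * ∑ h : per p, r (x - z + h) := by
    have inv : ∀ h : per p, conv r p (x + h) = conv r p x := by
      intro h
      rw [conv_comm, conv_apply, conv_apply]
      refine Finset.sum_congr rfl fun y _ => ?_
      rw [add_sub_right_comm, h.2]
    have : ∑ h : per p, conv r p (x + h) = Fintype.card (per p) * conv r p x := by
      simp [inv]
    rw [← this]
    simp only [conv_apply, Finset.mul_sum]
    rw [Finset.sum_comm]
    simp only [add_sub_right_comm]
  obtain ⟨z, hz⟩ : ∃ z, (Fintype.card (per p) : ℝ) * conv r p x ≤ ∑ h : per p, r (x - z + h) := by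
    by_contra! hcon
    have h1 : ∑ z, p z * ∑ h : per p, r (x - z + h) <
        ∑ z, p z * ((Fintype.card (per p) : ℝ) * conv r p x) := by
      obtain ⟨z0, hz0⟩ : ∃ y, p y ≠ 0 := by
        by_contra! h
        have := hp.2
        simp [h] at this
      apply Finset.sum_lt_sum
      · intro z _
        exact mul_le_mul_of_nonneg_left (hcon z).le (hp.1 z)
      · exact ⟨z0, Finset.mem_univ _, mul_lt_mul_of_pos_left (hcon z0)
          (lt_of_le_of_ne (hp.1 z0) (Ne.symm hz0))⟩
    rw [← Finset.sum_mul, hp.2, one_mul, ← hsum] at h1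
    exact lt_irrefl _ h1
  have hcount : ∑ h : per p, r (x - z + h) =
      (A.filter (fun a => a - (x - z) ∈ per p)).card * (A.card : ℝ)⁻¹ := by
    simp only [hr]
    rw [Finset.sum_ite, Finset.sum_const_zero, add_zero, Finset.sum_const, nsmul_eq_mul]
    congr 2
    apply Finset.card_bij (fun (h : per p) _ => x - z + (h : G))
    · intro h hh
      simpa using hh
    · intro a _ b _ hab
      simpa using hab
    · intro b hb
      simp only [Finset.mem_filter] at hb
      exact ⟨⟨_, hb.2⟩, by simpa using hb.1, by simp⟩
  have Kpow : ∀ c : ℝ, K ^ c = Real.exp (c * Real.log K) := fun c => by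
    rw [Real.rpow_def_of_pos hK0, mul_comm]
  refine ⟨per p, x - z, ?_, ?_⟩
  · rw [← Real.exp_log cV, ← Real.exp_log hN, Kpow, ← Real.exp_add]
    rw [Real.exp_le_exp]
    unfold dd at drp
    linarith
  · rw [hcount] at hz
    have h3 : K ^ (-2004 : ℝ) ≤ (Fintype.card (per p) : ℝ) * conv r p x := by
      refine le_trans ?_ (mul_le_mul_of_nonneg_left hx cV.le)
      rw [← Real.exp_log cV, Kpow, ← Real.exp_add, Real.exp_le_exp]
      unfold dd at drp hd0
      linarith
    have := mul_le_mul_of_nonneg_left (h3.trans hz) hN.le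
    refine this.trans (le_of_eq ?_)
    field_simp
end pfr

section finish
variable {X Y : Type*} [AddCommGroup X] [Module (ZMod 2) X] [Fintype X]
  [AddCommGroup Y] [Module (ZMod 2) Y] [Fintype Y]

lemma two_zero {Z : Type*} [AddCommGroup Z] [Module (ZMod 2) Z] (x : Z) : x + x = 0 := by
  have h : ((1 : ZMod 2) + 1) • x = 0 := by
    rw [show (1 : ZMod 2) + 1 = 0 from rfl, zero_smul]
  rwa [add_smul, one_smul] at h

lemma exists_lin (V : AddSubgroup (X × Y)) :
    ∃ g : X →ₗ[ZMod 2] Y, ∀ x y, (x, y) ∈ V → (x, g x) ∈ V := by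
  let W : Submodule (ZMod 2) (X × Y) := AddSubgroup.toZModSubmodule 2 V
  let π : W →ₗ[ZMod 2] X := (LinearMap.fst (ZMod 2) X Y).comp W.subtype
  obtain ⟨s, hs⟩ := π.rangeRestrict.exists_rightInverse_of_surjective π.range_rangeRestrict
  obtain ⟨g, hg⟩ := LinearMap.exists_extend
    (((LinearMap.snd (ZMod 2) X Y).comp W.subtype).comp s)
  refine ⟨g, fun x y hxy => ?_⟩
  have hx : x ∈ LinearMap.range π := ⟨⟨(x, y), hxy⟩, rfl⟩
  have h1 : g x = ((s ⟨x, hx⟩ : W) : X × Y).2 := LinearMap.congr_fun hg ⟨x, hx⟩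
  have h3 : ((s ⟨x, hx⟩ : W) : X × Y).1 = x :=
    congrArg Subtype.val (LinearMap.congr_fun hs ⟨x, hx⟩)
  have h4 : (x, g x) = ((s ⟨x, hx⟩ : W) : X × Y) := by
    rw [h1]; exact Prod.ext h3.symm rfl
  rw [h4]
  exact (s ⟨x, hx⟩).2

open Classical in
theorem finish (f : X → Y) (D : Finset Y) (K : ℝ) (hD : ∀ x y, f x + f y - f (x + y) ∈ D)
    (hK : (D.card : ℝ) ≤ K) : ∃ (g : X →ₗ[ZMod 2] Y) (R : Finset Y),
      (∀ x, f x - g x ∈ R) ∧ (R.card : ℝ) ≤ K ^ (10022 : ℝ) := by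
  have hD1 : (1 : ℝ) ≤ D.card := by
    exact_mod_cast Finset.card_pos.2 ⟨_, hD 0 0⟩
  have hK1 : 1 ≤ K := hD1.trans hK
  have hK0 : 0 < K := by linarith
  let A : Finset (X × Y) := Finset.univ.image (fun x => (x, f x))
  have cA : A.card = Fintype.card X := by
    rw [Finset.card_image_of_injective _ (fun a b h => (Prod.ext_iff.1 h).1), Finset.card_univ]
  let E : Finset (X × Y) := (Finset.univ ×ˢ D).image (fun z => (z.1, f z.1 + z.2))
  have cE : (E.card : ℝ) ≤ K * A.card := by
    have h1 : E.card ≤ Fintype.card X * D.card := by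
      refine Finset.card_image_le.trans ?_
      rw [Finset.card_product, Finset.card_univ]
    have h3 : (E.card : ℝ) ≤ Fintype.card X * D.card := by exact_mod_cast h1
    rw [cA, mul_comm]
    exact h3.trans (mul_le_mul_of_nonneg_left hK (by positivity))
  have hN : (0 : ℝ) < Fintype.card X := by exact_mod_cast Fintype.card_pos
  obtain ⟨V, t, hV, ht⟩ := pfr (G := X × Y) two_zero A E ⟨_, Finset.mem_image_of_mem _ (Finset.mem_univ 0)⟩
    K hK1 (by
      intro x hx y hy
      obtain ⟨a, _, rfl⟩ := Finset.mem_image.1 hx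
      obtain ⟨b, _, rfl⟩ := Finset.mem_image.1 hy
      refine Finset.mem_image.2 ⟨(a + b, f a + f b - f (a + b)), ?_, ?_⟩
      · exact Finset.mem_product.2 ⟨Finset.mem_univ _, hD a b⟩
      · simp) cE
  rw [cA] at hV ht
  obtain ⟨g, hg⟩ := exists_lin V
  obtain ⟨t1, t2⟩ := t
  let B : Finset X := Finset.univ.filter (fun x => (x, f x) - (t1, t2) ∈ V)
  have cB : (A.filter (fun a => a - (t1, t2) ∈ V)).card = B.card := by
    rw [Finset.filter_image, Finset.card_image_of_injective _ (fun a b h => (Prod.ext_iff.1 h).1)]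
  rw [cB] at ht
  have hKm : (0 : ℝ) < K ^ (-2004 : ℝ) := Real.rpow_pos_of_pos hK0 _
  have hBpos : (0 : ℝ) < B.card := lt_of_lt_of_le (mul_pos hN hKm) ht
  have hBne : B.Nonempty := Finset.card_pos.1 (by exact_mod_cast hBpos)
  have hKK : K ^ (-2004 : ℝ) * K ^ (2004 : ℝ) = 1 := by
    rw [← Real.rpow_add hK0]; norm_num
  have hNB : (Fintype.card X : ℝ) ≤ K ^ (2004 : ℝ) * B.card := by
    have := mul_le_mul_of_nonneg_right ht (Real.rpow_nonneg hK0.le 2004)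
    rw [mul_assoc, hKK, mul_one] at this
    linarith
  let H0 : Finset Y := Finset.univ.filter (fun v => ((0 : X), v) ∈ V)
  have hH0B : H0.card * B.card ≤ Fintype.card V := by
    rw [← Finset.card_product, Fintype.card_subtype]
    refine Finset.card_le_card_of_injOn (fun z => (z.2 - t1, f z.2 - t2 + z.1)) ?_ ?_
    · rintro ⟨v, x⟩ hz
      have hz' := Finset.mem_product.1 (Finset.mem_coe.1 hz)
      have h1 := (Finset.mem_filter.1 hz'.1).2
      have h3 := (Finset.mem_filter.1 hz'.2).2
      have h4 := V.add_mem h3 h1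
      simpa using h4
    · rintro ⟨v, x⟩ _ ⟨v', x'⟩ _ h
      have h1 := (Prod.ext_iff.1 h).1
      have h3 := (Prod.ext_iff.1 h).2
      simp only [sub_left_inj] at h1 h3
      subst h1
      simp only [add_right_inj] at h3
      rw [h3]
  have hH0 : (H0.card : ℝ) ≤ K ^ (2004 : ℝ) * K ^ (2004 : ℝ) := by
    have h1 : (H0.card : ℝ) * B.card ≤ Fintype.card V := by exact_mod_cast hH0B
    have h3 : (H0.card : ℝ) * B.card ≤ (K ^ (2004 : ℝ) * K ^ (2004 : ℝ)) * B.card := by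
      refine (h1.trans hV).trans ?_
      rw [mul_assoc]
      exact mul_le_mul_of_nonneg_left hNB (Real.rpow_nonneg hK0.le 2004)
    exact le_of_mul_le_mul_right h3 hBpos
  obtain ⟨F, _, cF, hF⟩ := Finset.ruzsa_covering_add (A := (Finset.univ : Finset X)) (B := B)
    (K := K ^ (2004 : ℝ)) hBne (by
      refine le_trans ?_ hNB
      exact_mod_cast Finset.card_le_univ _)
  have hB : ∀ x ∈ B, (f x - g x) - (t2 - g t1) ∈ H0 := by
    intro x hx
    have h1 := (Finset.mem_filter.1 hx).2
    have h3 := hg (x - t1) (f x - t2) h1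
    refine Finset.mem_filter.2 ⟨Finset.mem_univ _, ?_⟩
    have h4 := V.sub_mem h1 h3
    have e : ((x, f x) - (t1, t2) - (x - t1, g (x - t1)) : X × Y) =
        (0, (f x - g x) - (t2 - g t1)) := by
      ext
      · simp
      · simp only [Prod.snd_sub, map_sub]; abel
    rwa [e] at h4
  set c := t2 - g t1 with hc
  let R : Finset Y := (F ×ˢ (D ×ˢ (D ×ˢ (H0 ×ˢ H0)))).image
    (fun z => (f z.1 - g z.1) + (z.2.2.2.1 + c) + (z.2.2.2.2 + c) - z.2.1 - z.2.2.1)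
  refine ⟨g, R, ?_, ?_⟩
  · intro x
    obtain ⟨s, hs, u, hu, rfl⟩ := Finset.mem_add.1 (hF (Finset.mem_univ x))
    obtain ⟨b, hb, b', hb', rfl⟩ := Finset.mem_sub.1 hu
    have hbb : b - b' = b + b' := by
      rw [sub_eq_iff_eq_add, add_assoc, two_zero, add_zero]
    rw [hbb]
    refine Finset.mem_image.2 ⟨(s, f s + f (b + b') - f (s + (b + b')), f b + f b' - f (b + b'),
      (f b - g b) - c, (f b' - g b') - c), ?_, ?_⟩
    · simp only [Finset.mem_product]
      exact ⟨hs, hD _ _, hD _ _, hB b hb, hB b' hb'⟩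
    · simp only [map_add]
      abel
  · have h1 : R.card ≤ F.card * (D.card * (D.card * (H0.card * H0.card))) := by
      refine Finset.card_image_le.trans ?_
      simp only [Finset.card_product]
      exact le_rfl
    have h3 : (R.card : ℝ) ≤ F.card * (D.card * (D.card * (H0.card * H0.card))) := by
      exact_mod_cast h1
    refine h3.trans ?_
    have hP : K ^ (10022 : ℝ) = K ^ (2004 : ℝ) * (K * (K *
        ((K ^ (2004 : ℝ) * K ^ (2004 : ℝ)) * (K ^ (2004 : ℝ) * K ^ (2004 : ℝ))))) := by
      have : K * K = K ^ (2 : ℝ) := by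
        rw [Real.rpow_two, sq]
      rw [← mul_assoc K K, this]
      simp only [← Real.rpow_add hK0]
      norm_num
    rw [hP]
    gcongr
end finish

end PFRx

/-- **Additive stability of almost-homomorphisms.** There is an absolute constant `C₃`
such that if `f : F_2^m → F_2^n` has `|{f(x) + f(y) - f(x+y)}| ≤ K`, then `f = g + h`
with `g` linear and `|range h| = O(K^C₃)`. -/
theorem approximate_hom_stability :
    ∃ C₃ C : ℝ, 0 < C₃ ∧ 0 < C ∧
      ∀ (m n : ℕ) (K : ℝ) (f : (Fin m → ZMod 2) → (Fin n → ZMod 2)),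
        (Nat.card {d : Fin n → ZMod 2 | ∃ x y, d = f x + f y - f (x + y)} : ℝ) ≤ K →
        ∃ g h : (Fin m → ZMod 2) → (Fin n → ZMod 2),
          IsLinearMap (ZMod 2) g ∧ f = g + h ∧
          (Nat.card (Set.range h) : ℝ) ≤ C * K ^ C₃ := by
  refine ⟨10022, 1, by norm_num, one_pos, ?_⟩
  intro m n K f hK
  classical
  set S : Set (Fin n → ZMod 2) := {d | ∃ x y, d = f x + f y - f (x + y)} with hS
  have hc : (S.toFinset.card : ℝ) ≤ K := by
    rw [Set.toFinset_card, ← Nat.card_eq_fintype_card]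
    exact hK
  obtain ⟨g, R, hR, hRc⟩ := PFRx.finish f S.toFinset K
    (fun x y => Set.mem_toFinset.2 ⟨x, y, rfl⟩) hc
  refine ⟨g, fun x => f x - g x, g.isLinear, ?_, ?_⟩
  · funext x
    simp
  · rw [one_mul]
    refine le_trans ?_ hRc
    have h1 : Set.range (fun x => f x - g x) ⊆ (R : Set (Fin n → ZMod 2)) := by
      rintro _ ⟨x, rfl⟩
      exact hR x
    have h3 := Nat.card_mono R.finite_toSet h1
    rw [Nat.card_eq_fintype_card (α := (R : Set (Fin n → ZMod 2)))] at h3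
    have h4 : Nat.card (Set.range (fun x => f x - g x)) ≤ R.card := by simpa using h3
    exact_mod_cast h4
end
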